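/- Let p : ℝⁿ → [1,∞] be measurable with 1 < ess inf p and ess sup p < ∞, and let p' be its pointwise conjugate exponent, 1/p(x) + 1/p'(x) = 1 a.e. Then the Hardy–Littlewood maximal operator M is bounded on the variable Lebesgue space L^{p(·)}(ℝⁿ) if and only if M is bounded on L^{p'(·)}(ℝⁿ); that is, p ∈ 𝓑_M(ℝⁿ) if and only if p' ∈ 𝓑_M(ℝⁿ). -/

import Mathlib

open MeasureTheory Filter Set Topology
open scoped ENNReal NNReal

noncomputable section

/-- Euclidean space `ℝⁿ`. -/
abbrev En (n : ℕ) := EuclideanSpace ℝ (Fin n)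

/-- The axis-parallel closed cube with lower corner `a` and side length `l`. -/
def cube {n : ℕ} (a : En n) (l : ℝ) : Set (En n) := {y | ∀ i, a i ≤ y i ∧ y i ≤ a i + l}

/-- Average of the `ℝ≥0∞`-valued function `g` over the cube with corner `a` and side `l`. -/
def cubeAvg {n : ℕ} (g : En n → ℝ≥0∞) (a : En n) (l : ℝ) : ℝ≥0∞ :=
  (volume (cube a l))⁻¹ * ∫⁻ y in cube a l, g y

/-- The Hardy–Littlewood maximal operator (supremum of averages over all
axis-parallel cubes containing the point). -/
def maximal {n : ℕ} (g : En n → ℝ≥0∞) (x : En n) : ℝ≥0∞ :=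
  ⨆ (a : En n) (l : ℝ) (_ : 0 < l) (_ : x ∈ cube a l), cubeAvg g a l

/-- The norm of the variable Lebesgue space `L^{p(·)}`, applied to an
`ℝ≥0∞`-valued function. -/
def vNorm {α : Type*} [MeasureSpace α] (p : α → ℝ) (g : α → ℝ≥0∞) : ℝ≥0∞ :=
  sInf {lam : ℝ≥0∞ | 0 < lam ∧ (∫⁻ x, (g x / lam) ^ (p x)) ≤ 1}

/-- The norm of a complex-valued function in the variable Lebesgue space `L^{p(·)}`. -/
def vNormC {α : Type*} [MeasureSpace α] (p : α → ℝ) (f : α → ℂ) : ℝ≥0∞ :=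
  vNorm p (fun x => (‖f x‖₊ : ℝ≥0∞))

/-- The class `𝓑_M(ℝⁿ)`: measurable exponents `p` with `1 < ess inf p` and
`ess sup p < ∞` such that the Hardy–Littlewood maximal operator is bounded
on `L^{p(·)}(ℝⁿ)`. -/
def MemBM {n : ℕ} (p : En n → ℝ) : Prop :=
  Measurable p ∧ (∃ c : ℝ, 1 < c ∧ ∀ᵐ x ∂volume, c ≤ p x) ∧
    (∃ C : ℝ, ∀ᵐ x ∂volume, p x ≤ C) ∧
    ∃ C : ℝ≥0, ∀ f : En n → ℂ,
      vNorm p (maximal fun x => (‖f x‖₊ : ℝ≥0∞)) ≤ C * vNormC p f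

section

/-- The average of `g` over the set `Q`. -/
def avgOn {X : Type*} [MeasurableSpace X] (μ : Measure X) (g : X → ℝ≥0∞) (Q : Set X) : ℝ≥0∞ :=
  (μ Q)⁻¹ * ∫⁻ x in Q, g x ∂μ

/-- The maximal function associated with a family `𝓓` of sets. -/
def gridMax {X : Type*} [MeasurableSpace X] (μ : Measure X) (𝓓 : Set (Set X)) (g : X → ℝ≥0∞)
    (x : X) : ℝ≥0∞ :=
  ⨆ (Q : Set X) (_ : Q ∈ 𝓓) (_ : x ∈ Q), avgOn μ g Q

/-- An abstract dyadic grid: a countable laminar family of sets of positive finite measure, with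
a doubling stopping-time property and Lebesgue differentiation. -/
structure IsGrid {X : Type*} [MeasurableSpace X] (μ : Measure X) (D : ℝ≥0) (𝓓 : Set (Set X)) :
    Prop where
  one_le : 1 ≤ D
  countable : 𝓓.Countable
  measurableSet : ∀ Q ∈ 𝓓, MeasurableSet Q
  measure_ne_zero : ∀ Q ∈ 𝓓, μ Q ≠ 0
  measure_ne_top : ∀ Q ∈ 𝓓, μ Q ≠ ∞
  nested : ∀ Q ∈ 𝓓, ∀ R ∈ 𝓓, Q ⊆ R ∨ R ⊆ Q ∨ Disjoint Q R
  exists_maximal : ∀ R ∈ 𝓓, ∀ T ⊆ 𝓓, R ∉ T → ∀ P₀ ∈ T, P₀ ⊆ R → ∃ P ∈ T, P₀ ⊆ P ∧ P ⊆ R ∧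
    (∃ P' ∈ 𝓓, P' ⊆ R ∧ P ⊆ P' ∧ P' ∉ T ∧ μ P' ≤ D * μ P) ∧
    ∀ P' ∈ 𝓓, P ⊂ P' → P' ⊆ R → P' ∉ T
  ae_le : ∀ w : X → ℝ≥0∞, Measurable w → (∃ C : ℝ≥0, ∀ x, w x ≤ C) → ∀ R ∈ 𝓓,
    ∀ᵐ x ∂μ, x ∈ R → ∀ c, (∀ Q ∈ 𝓓, x ∈ Q → Q ⊆ R → avgOn μ w Q ≤ c) → w x ≤ c

section Modular

variable {X : Type*} [MeasurableSpace X] {μ : Measure X} {p : X → ℝ} {P : ℝ}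

theorem modular_const_mul_le (hp0 : ∀ x, 0 ≤ p x) (hP : ∀ x, p x ≤ P) (f : X → ℝ≥0∞)
    {c : ℝ≥0∞} (hc : 1 ≤ c) (hct : c ≠ ∞) :
    ∫⁻ x, (c * f x) ^ p x ∂μ ≤ c ^ P * ∫⁻ x, f x ^ p x ∂μ := by
  by_cases hX : Nonempty X
  · have h0 : 0 ≤ P := (hp0 hX.some).trans (hP _)
    rw [← lintegral_const_mul' _ _ (ENNReal.rpow_ne_top_of_nonneg h0 hct)]
    refine lintegral_mono fun x => ?_
    rw [ENNReal.mul_rpow_of_nonneg _ _ (hp0 x)]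
    gcongr
    exact hP x
  · have := not_nonempty_iff.1 hX
    simp [Measure.eq_zero_of_isEmpty μ]

theorem le_modular_const_mul (h1 : ∀ x, 1 ≤ p x) (f : X → ℝ≥0∞)
    {c : ℝ≥0∞} (hc : 1 ≤ c) (hct : c ≠ ∞) :
    c * ∫⁻ x, f x ^ p x ∂μ ≤ ∫⁻ x, (c * f x) ^ p x ∂μ := by
  rw [← lintegral_const_mul' _ _ hct]
  refine lintegral_mono fun x => ?_
  rw [ENNReal.mul_rpow_of_nonneg _ _ (zero_le_one.trans (h1 x))]
  gcongr
  simpa using ENNReal.rpow_le_rpow_of_exponent_le hc (h1 x)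

theorem modular_const_mul_le_of_le_one (h1 : ∀ x, 1 ≤ p x) (f : X → ℝ≥0∞)
    {c : ℝ≥0∞} (hc : c ≤ 1) :
    ∫⁻ x, (c * f x) ^ p x ∂μ ≤ c * ∫⁻ x, f x ^ p x ∂μ := by
  rw [← lintegral_const_mul' _ _ (ne_top_of_le_ne_top ENNReal.one_ne_top hc)]
  refine lintegral_mono fun x => ?_
  rw [ENNReal.mul_rpow_of_nonneg _ _ (zero_le_one.trans (h1 x))]
  gcongr
  simpa using ENNReal.rpow_le_rpow_of_exponent_ge hc (h1 x)

theorem lintegral_indicator_rpow (hp0 : ∀ x, 0 < p x) (f : X → ℝ≥0∞) {E : Set X}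
    (hE : MeasurableSet E) :
    ∫⁻ x, (E.indicator f x) ^ p x ∂μ = ∫⁻ x in E, f x ^ p x ∂μ := by
  rw [← lintegral_indicator hE]
  refine lintegral_congr fun x => ?_
  by_cases hx : x ∈ E <;> simp [hx, hp0 x]

end Modular

section Averages

variable {X : Type*} [MeasurableSpace X] {μ : Measure X}

theorem avgOn_mono {f g : X → ℝ≥0∞} (h : f ≤ g) (Q : Set X) : avgOn μ f Q ≤ avgOn μ g Q := by
  unfold avgOn; gcongr; exact h _

theorem avgOn_const_mul {c : ℝ≥0∞} (hc : c ≠ ∞) (f : X → ℝ≥0∞) (Q : Set X) :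
    avgOn μ (fun x => c * f x) Q = c * avgOn μ f Q := by
  unfold avgOn; rw [lintegral_const_mul' _ _ hc]; ring

theorem measure_mul_avgOn {Q : Set X} (h0 : μ Q ≠ 0) (ht : μ Q ≠ ∞) (f : X → ℝ≥0∞) :
    μ Q * avgOn μ f Q = ∫⁻ x in Q, f x ∂μ := by
  unfold avgOn; rw [← mul_assoc, ENNReal.mul_inv_cancel h0 ht, one_mul]

theorem gridMax_const_mul {𝓓 : Set (Set X)} {c : ℝ≥0∞} (hc : c ≠ ∞) (f : X → ℝ≥0∞) (x : X) :
    gridMax μ 𝓓 (fun x => c * f x) x = c * gridMax μ 𝓓 f x := by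
  simp only [gridMax, avgOn_const_mul hc, ENNReal.mul_iSup]

theorem avgOn_le_gridMax {𝓓 : Set (Set X)} {Q : Set X} (hQ : Q ∈ 𝓓) {x : X} (hx : x ∈ Q)
    (f : X → ℝ≥0∞) : avgOn μ f Q ≤ gridMax μ 𝓓 f x :=
  le_iSup_of_le Q (le_iSup_of_le hQ (le_iSup_of_le hx le_rfl))

end Averages

section MaximalElements

variable {X : Type*}

/-- The inclusion-maximal elements of a finite family of sets. -/
def maxElems (F : Finset (Set X)) : Finset (Set X) :=
  @Finset.filter _ (fun P => ∀ Q ∈ F, P ⊆ Q → P = Q) (Classical.decPred _) F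

theorem mem_maxElems {F : Finset (Set X)} {P : Set X} :
    P ∈ maxElems F ↔ P ∈ F ∧ ∀ Q ∈ F, P ⊆ Q → P = Q :=
  @Finset.mem_filter _ _ (Classical.decPred _) _ _

theorem maxElems_subset (F : Finset (Set X)) : maxElems F ⊆ F := fun _ h => (mem_maxElems.1 h).1

theorem exists_mem_maxElems {F : Finset (Set X)} {P : Set X} (hP : P ∈ F) :
    ∃ Q ∈ maxElems F, P ⊆ Q := by
  obtain ⟨Q, hPQ, hQ⟩ := F.exists_le_maximal hP
  exact ⟨Q, mem_maxElems.2 ⟨hQ.1, fun R hR h => h.antisymm (hQ.2 hR h)⟩, hPQ⟩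

theorem pairwiseDisjoint_maxElems {F : Finset (Set X)}
    (h : ∀ Q ∈ F, ∀ R ∈ F, Q ⊆ R ∨ R ⊆ Q ∨ Disjoint Q R) :
    (maxElems F : Set (Set X)).PairwiseDisjoint id := by
  intro Q hQ R hR hne
  rw [Finset.mem_coe, mem_maxElems] at hQ hR
  rcases h Q hQ.1 R hR.1 with h' | h' | h'
  · exact absurd (hQ.2 R hR.1 h') hne
  · exact absurd (hR.2 Q hQ.1 h').symm hne
  · exact h'

end MaximalElements

namespace IsGrid

variable {X : Type*} [MeasurableSpace X] {μ : Measure X} {D : ℝ≥0} {𝓓 : Set (Set X)}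

theorem mul_measure_biUnion_finset_le (hD : IsGrid μ D 𝓓) {F : Finset (Set X)}
    (hF : ∀ Q ∈ F, Q ∈ 𝓓) {c : ℝ≥0∞} {w : X → ℝ≥0∞} {R : Set X}
    (hR : ∀ Q ∈ F, Q ⊆ R) (hc : ∀ Q ∈ F, c * μ Q ≤ ∫⁻ x in Q, w x ∂μ) :
    c * μ (⋃ Q ∈ F, Q) ≤ ∫⁻ x in R, w x ∂μ := by
  have hsub : (⋃ Q ∈ F, Q) ⊆ ⋃ Q ∈ maxElems F, Q := by
    refine iUnion₂_subset fun Q hQ => ?_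
    obtain ⟨Q', hQ', h⟩ := exists_mem_maxElems hQ
    exact h.trans (subset_biUnion_of_mem (u := fun x => x) hQ')
  calc c * μ (⋃ Q ∈ F, Q) ≤ c * ∑ Q ∈ maxElems F, μ Q := by
        gcongr; exact (measure_mono hsub).trans (measure_biUnion_finset_le _ _)
    _ = ∑ Q ∈ maxElems F, c * μ Q := Finset.mul_sum ..
    _ ≤ ∑ Q ∈ maxElems F, ∫⁻ x in Q, w x ∂μ :=
        Finset.sum_le_sum fun Q hQ => hc Q (maxElems_subset F hQ)
    _ = ∫⁻ x in ⋃ Q ∈ maxElems F, id Q, w x ∂μ := by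
        rw [lintegral_biUnion_finset]
        · rfl
        · exact pairwiseDisjoint_maxElems fun Q hQ R hR => hD.nested Q (hF Q hQ) R (hF R hR)
        · exact fun Q hQ => hD.measurableSet Q (hF Q (maxElems_subset F hQ))
    _ ≤ ∫⁻ x in R, w x ∂μ :=
        lintegral_mono_set (iUnion₂_subset fun Q hQ => hR Q (maxElems_subset F hQ))

theorem mul_measure_sUnion_le (hD : IsGrid μ D 𝓓) {T : Set (Set X)} (hT : T ⊆ 𝓓)
    {c : ℝ≥0∞} {w : X → ℝ≥0∞} {R : Set X}
    (hR : ∀ Q ∈ T, Q ⊆ R) (hc : ∀ Q ∈ T, c * μ Q ≤ ∫⁻ x in Q, w x ∂μ) :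
    c * μ (⋃₀ T) ≤ ∫⁻ x in R, w x ∂μ := by
  have hcount : Countable T := (hD.countable.mono hT).to_subtype
  have h1 : ⋃₀ T = ⋃ s : Finset T, ⋃ Q ∈ s.map (Function.Embedding.subtype _), Q := by
    ext x
    simp only [mem_sUnion, mem_iUnion]
    constructor
    · rintro ⟨Q, hQ, hx⟩
      exact ⟨{⟨Q, hQ⟩}, Q, by simp, hx⟩
    · rintro ⟨s, Q, hQ, hx⟩
      obtain ⟨Q', _, rfl⟩ := Finset.mem_map.1 hQ
      exact ⟨Q', Q'.2, hx⟩
  rw [h1, Directed.measure_iUnion, ENNReal.mul_iSup]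
  · refine iSup_le fun s => hD.mul_measure_biUnion_finset_le ?_ ?_ ?_
    all_goals
      intro Q hQ
      simp only [Finset.mem_map, Function.Embedding.subtype_apply] at hQ
      obtain ⟨Q', _, rfl⟩ := hQ
    exacts [hT Q'.2, hR _ Q'.2, hc _ Q'.2]
  · refine Monotone.directed_le fun s t hst => ?_
    exact biUnion_subset_biUnion_left (Finset.map_subset_map.2 hst)

end IsGrid

section Contraction

variable {X : Type*} [MeasurableSpace X] {μ : Measure X} {𝓓 : Set (Set X)}
  {p : X → ℝ} {P : ℝ} {C₀ : ℝ≥0}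

/-- The modular boundedness of the grid maximal operator. -/
def GridBounded (μ : Measure X) (𝓓 : Set (Set X)) (p : X → ℝ) (C₀ : ℝ≥0) : Prop :=
  ∀ g : X → ℝ≥0∞, Measurable g → ∫⁻ x, g x ^ p x ∂μ ≤ 1 →
    ∫⁻ x, gridMax μ 𝓓 g x ^ p x ∂μ ≤ C₀

theorem GridBounded.modular_le (H : GridBounded μ 𝓓 p C₀) (h1 : ∀ x, 1 ≤ p x)
    (hP : ∀ x, p x ≤ P) {f : X → ℝ≥0∞} (hf : Measurable f) {E G : Set X} (hE : MeasurableSet E)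
    (hfE : ∀ x ∈ G, f x ≤ 2 * gridMax μ 𝓓 (E.indicator f) x)
    (hG : MeasurableSet G)
    {κ : ℝ≥0∞} (hκ : κ ≠ ∞) (hκ1 : 1 ≤ κ) (hle : κ ^ P * ∫⁻ x in E, f x ^ p x ∂μ ≤ 1) :
    κ * ∫⁻ x in G, f x ^ p x ∂μ ≤ 2 ^ P * C₀ := by
  have h0 : ∀ x, 0 < p x := fun x => zero_lt_one.trans_le (h1 x)
  have hg := H (fun x => κ * E.indicator f x) ((hf.indicator hE).const_mul κ) <| by
    refine (modular_const_mul_le (fun x => (h0 x).le) hP _ hκ1 hκ).trans ?_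
    rwa [lintegral_indicator_rpow h0 f hE]
  calc κ * ∫⁻ x in G, f x ^ p x ∂μ = κ * ∫⁻ x, (G.indicator f x) ^ p x ∂μ := by
        rw [lintegral_indicator_rpow h0 f hG]
    _ ≤ ∫⁻ x, (κ * G.indicator f x) ^ p x ∂μ := le_modular_const_mul h1 _ hκ1 hκ
    _ ≤ ∫⁻ x, (2 * gridMax μ 𝓓 (fun x => κ * E.indicator f x) x) ^ p x ∂μ := by
        refine lintegral_mono fun x => ENNReal.rpow_le_rpow ?_ (h0 x).le
        by_cases hx : x ∈ G
        · rw [indicator_of_mem hx, gridMax_const_mul hκ, mul_left_comm]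
          gcongr
          exact hfE x hx
        · simp [hx]
    _ ≤ 2 ^ P * ∫⁻ x, gridMax μ 𝓓 (fun x => κ * E.indicator f x) x ^ p x ∂μ :=
        modular_const_mul_le (fun x => (h0 x).le) hP _ (by norm_num) (by norm_num)
    _ ≤ 2 ^ P * C₀ := by gcongr

theorem GridBounded.exists_modular_le_one (H : GridBounded μ 𝓓 p C₀) (h1 : ∀ x, 1 ≤ p x)
    (hP : ∀ x, p x ≤ P) (hP1 : 1 ≤ P) : ∃ η : ℝ≥0, 0 < η ∧ ∀ f : X → ℝ≥0∞, Measurable f →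
      ∀ E G : Set X, MeasurableSet E → MeasurableSet G →
      (∀ x ∈ G, f x ≤ 2 * gridMax μ 𝓓 (E.indicator f) x) →
      ∫⁻ x in E, f x ^ p x ∂μ ≤ η → ∫⁻ x in G, f x ^ p x ∂μ ≤ 1 := by
  set κ : ℝ≥0 := 2 ^ P * C₀ + 1 with hκ
  have hκ1 : 1 ≤ κ := by simp [hκ]
  have hκP : 0 < κ ^ P := NNReal.rpow_pos (zero_lt_one.trans_le hκ1)
  refine ⟨(κ ^ P)⁻¹, inv_pos.2 hκP, fun f hf E G hE hG hfE hle => ?_⟩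
  have key := H.modular_le h1 hP hf hE hfE hG (κ := κ) (by simp) (by exact_mod_cast hκ1) <| by
    rw [← ENNReal.coe_rpow_of_nonneg _ (by linarith)]
    calc _ ≤ ((κ ^ P : ℝ≥0) : ℝ≥0∞) * ((κ ^ P)⁻¹ : ℝ≥0) := by gcongr
      _ = 1 := by rw [← ENNReal.coe_mul, mul_inv_cancel₀ hκP.ne', ENNReal.coe_one]
  have h2 : (κ : ℝ≥0∞) * ∫⁻ x in G, f x ^ p x ∂μ ≤ κ * 1 := by
    refine key.trans ?_
    rw [hκ, mul_one, ENNReal.coe_add, ENNReal.coe_mul, ENNReal.coe_rpow_of_nonneg _ (by linarith)]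
    simp
  have hκ0 : (κ : ℝ≥0∞) ≠ 0 := by
    have : κ ≠ 0 := (zero_lt_one.trans_le hκ1).ne'
    exact_mod_cast this
  exact (ENNReal.mul_le_mul_iff_right hκ0 ENNReal.coe_ne_top).1 h2

theorem GridBounded.exists_contraction (H : GridBounded μ 𝓓 p C₀) (h1 : ∀ x, 1 ≤ p x)
    (hP : ∀ x, p x ≤ P) (hP1 : 1 ≤ P) : ∃ r : ℝ≥0, 1 < r ∧ ∀ f : X → ℝ≥0∞, Measurable f →
      ∀ F G : Set X, MeasurableSet F → MeasurableSet G → F ⊆ G →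
      (∀ x ∈ G, f x ≤ 2 * gridMax μ 𝓓 ((G \ F).indicator f) x) →
      ∫⁻ x in G, f x ^ p x ∂μ ≤ 1 → ∫⁻ x in F, (r * f x) ^ p x ∂μ ≤ 1 := by
  have hP0 : 0 < P := by linarith
  have hp0 : ∀ x, 0 ≤ p x := fun x => zero_le_one.trans (h1 x)
  set κ : ℝ≥0 := 2 * (2 ^ P * C₀ + 1) with hκ
  have hκ2 : 2 ≤ κ := by rw [hκ]; nth_rewrite 1 [← mul_one 2]; gcongr; simp
  have hκ1 : 1 ≤ κ := le_trans (by norm_num) hκ2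
  have hκP : κ ≤ κ ^ P := by simpa using NNReal.rpow_le_rpow_of_exponent_le hκ1 hP1
  set c : ℝ≥0 := (κ ^ P)⁻¹ with hc
  have hc0 : 0 < c := inv_pos.2 (lt_of_lt_of_le (by positivity) hκP)
  have hc2 : c ≤ 1 / 2 := by
    rw [hc, one_div]; exact inv_anti₀ (by norm_num) (hκ2.trans hκP)
  have hc1 : 0 < 1 - c := tsub_pos_of_lt (lt_of_le_of_lt hc2 (by norm_num))
  have hc3 : 1 / 2 ≤ 1 - c := by
    rw [le_tsub_iff_right (hc2.trans (by norm_num))]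
    calc (1 / 2 : ℝ≥0) + c ≤ 1 / 2 + 1 / 2 := by gcongr
      _ = 1 := by norm_num
  set r : ℝ≥0 := ((1 - c)⁻¹) ^ (1 / P) with hr
  have hr1 : 1 < r := NNReal.one_lt_rpow (by
    rw [one_lt_inv₀ hc1]; exact tsub_lt_self one_pos hc0) (by positivity)
  have hrP : r ^ P = (1 - c)⁻¹ := by
    rw [hr, ← NNReal.rpow_mul, one_div, inv_mul_cancel₀ hP0.ne', NNReal.rpow_one]
  refine ⟨r, hr1, fun f hf F G hF hG hFG hfE hle => ?_⟩
  have main : ∫⁻ x in F, f x ^ p x ∂μ ≤ ((1 - c : ℝ≥0) : ℝ≥0∞) := by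
    have hsplit : ∫⁻ x in F, f x ^ p x ∂μ + ∫⁻ x in G \ F, f x ^ p x ∂μ ≤ 1 := by
      have := lintegral_inter_add_sdiff (μ := μ) (fun x => f x ^ p x) G hF
      rw [inter_eq_right.2 hFG] at this
      rwa [this]
    by_cases hs : (c : ℝ≥0∞) ≤ ∫⁻ x in G \ F, f x ^ p x ∂μ
    · rw [ENNReal.coe_sub, ENNReal.coe_one]
      refine ENNReal.le_sub_of_add_le_right ENNReal.coe_ne_top ?_
      exact le_trans (by gcongr) hsplit
    · have key := H.modular_le h1 hP hf (hG.diff hF) hfE hG (κ := κ) (by simp)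
        (by exact_mod_cast hκ1) <| by
        rw [← ENNReal.coe_rpow_of_nonneg _ (by linarith)]
        calc _ ≤ ((κ ^ P : ℝ≥0) : ℝ≥0∞) * c := by gcongr; exact (not_le.1 hs).le
          _ = 1 := by
            rw [← ENNReal.coe_mul, hc, mul_inv_cancel₀ (lt_of_lt_of_le (by positivity) hκP).ne',
              ENNReal.coe_one]
      have h2 : (κ : ℝ≥0∞) * ∫⁻ x in G, f x ^ p x ∂μ ≤ κ * ((1 / 2 : ℝ≥0) : ℝ≥0∞) := by
        refine key.trans ?_
        rw [← ENNReal.coe_mul, hκ]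
        have : (2 * (2 ^ P * C₀ + 1) * (1 / 2) : ℝ≥0) = 2 ^ P * C₀ + 1 := by
          field_simp
        rw [this, ENNReal.coe_add, ENNReal.coe_mul, ENNReal.coe_rpow_of_nonneg _ (by linarith)]
        simp
      have hκ0 : (κ : ℝ≥0∞) ≠ 0 := by
        have : κ ≠ 0 := (zero_lt_one.trans_le hκ1).ne'
        exact_mod_cast this
      have h3 := (ENNReal.mul_le_mul_iff_right hκ0 ENNReal.coe_ne_top).1 h2
      exact (lintegral_mono_set hFG).trans (h3.trans (by exact_mod_cast hc3))
  calc ∫⁻ x in F, (r * f x) ^ p x ∂μ ≤ (r : ℝ≥0∞) ^ P * ∫⁻ x in F, f x ^ p x ∂μ :=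
        modular_const_mul_le hp0 hP _ (by exact_mod_cast hr1.le) (by simp)
    _ ≤ ((r ^ P : ℝ≥0) : ℝ≥0∞) * ((1 - c : ℝ≥0) : ℝ≥0∞) := by
        rw [ENNReal.coe_rpow_of_nonneg _ hP0.le]; gcongr
    _ = 1 := by rw [hrP, ← ENNReal.coe_mul, inv_mul_cancel₀ hc1.ne', ENNReal.coe_one]

end Contraction

end

section

section Stopping

variable {X : Type*} [MeasurableSpace X] {μ : Measure X} {D : ℝ≥0} {𝓓 : Set (Set X)}

/-- The cubes inside `Q` on which the average of `w` is at least `c` times its average on `Q`. -/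
def stopFamily (μ : Measure X) (𝓓 : Set (Set X)) (w : X → ℝ≥0∞) (Q : Set X) (c : ℝ≥0∞) :
    Set (Set X) :=
  {P | P ∈ 𝓓 ∧ P ⊆ Q ∧ c * avgOn μ w Q ≤ avgOn μ w P}

theorem stopFamily_subset {w : X → ℝ≥0∞} {Q : Set X} {c : ℝ≥0∞} :
    stopFamily μ 𝓓 w Q c ⊆ 𝓓 := fun _ h => h.1

theorem sUnion_stopFamily_subset {w : X → ℝ≥0∞} {Q : Set X} {c : ℝ≥0∞} :
    ⋃₀ stopFamily μ 𝓓 w Q c ⊆ Q := sUnion_subset fun _ h => h.2.1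

theorem IsGrid.measurableSet_sUnion (hD : IsGrid μ D 𝓓) {T : Set (Set X)} (hT : T ⊆ 𝓓) :
    MeasurableSet (⋃₀ T) :=
  MeasurableSet.sUnion (hD.countable.mono hT) fun Q hQ => hD.measurableSet Q (hT hQ)

theorem IsGrid.avgOn_le_mul (hD : IsGrid μ D 𝓓) {P P' : Set X} (hP : P ∈ 𝓓) (hP' : P' ∈ 𝓓)
    (hPP' : P ⊆ P') (h : μ P' ≤ D * μ P) (w : X → ℝ≥0∞) : avgOn μ w P ≤ D * avgOn μ w P' := by
  rw [← ENNReal.mul_le_mul_iff_right (hD.measure_ne_zero P hP) (hD.measure_ne_top P hP),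
    measure_mul_avgOn (hD.measure_ne_zero P hP) (hD.measure_ne_top P hP)]
  calc ∫⁻ x in P, w x ∂μ ≤ ∫⁻ x in P', w x ∂μ := lintegral_mono_set hPP'
    _ = μ P' * avgOn μ w P' :=
        (measure_mul_avgOn (hD.measure_ne_zero P' hP') (hD.measure_ne_top P' hP') w).symm
    _ ≤ (D * μ P) * avgOn μ w P' := by gcongr
    _ = _ := by ring

theorem IsGrid.exists_mem_stopFamily (hD : IsGrid μ D 𝓓) {w : X → ℝ≥0∞} {Q : Set X} (hQ : Q ∈ 𝓓)
    (h0 : avgOn μ w Q ≠ 0) (ht : avgOn μ w Q ≠ ∞) {c : ℝ≥0} (hc1 : 1 ≤ c) {x : X}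
    (hx : x ∈ ⋃₀ stopFamily μ 𝓓 w Q c) :
    ∃ P ∈ 𝓓, x ∈ P ∧ P ⊆ ⋃₀ stopFamily μ 𝓓 w Q c ∧
      2 * μ (P ∩ ⋃₀ stopFamily μ 𝓓 w Q (2 * D * c)) ≤ μ P := by
  have hD1 : (1 : ℝ≥0∞) ≤ D := by exact_mod_cast hD.one_le
  obtain ⟨P₀, hP₀, hxP₀⟩ := hx
  obtain ⟨P, hP, hP₀P, hPle, hmax⟩ : ∃ P ∈ stopFamily μ 𝓓 w Q c, P₀ ⊆ P ∧
      avgOn μ w P ≤ D * c * avgOn μ w Q ∧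
      ∀ P' ∈ 𝓓, P ⊂ P' → P' ⊆ Q → P' ∉ stopFamily μ 𝓓 w Q c := by
    by_cases hQT : Q ∈ stopFamily μ 𝓓 w Q c
    · refine ⟨Q, hQT, hP₀.2.1, ?_, fun P' _ h h' => absurd h' h.2⟩
      calc avgOn μ w Q = 1 * 1 * avgOn μ w Q := by simp
        _ ≤ _ := by gcongr; exact_mod_cast hc1
    · obtain ⟨P, hP, hP₀P, -, ⟨P', hP', hP'Q, hPP', hP'T, hμ⟩, hmax⟩ :=
        hD.exists_maximal Q hQ _ stopFamily_subset hQT P₀ hP₀ hP₀.2.1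
      refine ⟨P, hP, hP₀P, ?_, hmax⟩
      refine (hD.avgOn_le_mul hP.1 hP' hPP' hμ w).trans ?_
      rw [mul_assoc]
      gcongr
      exact le_of_not_ge fun h => hP'T ⟨hP', hP'Q, h⟩
  refine ⟨P, hP.1, hP₀P hxP₀, subset_sUnion_of_mem hP, ?_⟩
  set T' := {P' | P' ∈ stopFamily μ 𝓓 w Q (2 * D * c) ∧ P' ⊆ P} with hT'
  have hsub : P ∩ ⋃₀ stopFamily μ 𝓓 w Q (2 * D * c) ⊆ ⋃₀ T' := by
    rintro y ⟨hyP, P', hP', hyP'⟩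
    refine ⟨P', ⟨hP', ?_⟩, hyP'⟩
    rcases hD.nested P' hP'.1 P hP.1 with h | h | h
    · exact h
    · by_contra hne
      refine hmax P' hP'.1 ⟨h, hne⟩ hP'.2.1 ⟨hP'.1, hP'.2.1, le_trans ?_ hP'.2.2⟩
      gcongr
      calc (c : ℝ≥0∞) = 1 * 1 * c := by simp
        _ ≤ _ := by gcongr; norm_num
    · exact absurd hyP (disjoint_left.1 h hyP')
  have key := hD.mul_measure_sUnion_le (T := T') (c := 2 * D * c * avgOn μ w Q) (w := w) (R := P)
    (fun P' h => h.1.1) (fun P' h => h.2) fun P' h => by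
      rw [← measure_mul_avgOn (hD.measure_ne_zero P' h.1.1) (hD.measure_ne_top P' h.1.1), mul_comm]
      gcongr
      exact h.1.2.2
  rw [← measure_mul_avgOn (hD.measure_ne_zero P hP.1) (hD.measure_ne_top P hP.1)] at key
  have hne0 : (D : ℝ≥0∞) * c * avgOn μ w Q ≠ 0 := by
    have hc0 : (c : ℝ≥0∞) ≠ 0 := by
      have := (zero_lt_one.trans_le hc1).ne'
      exact_mod_cast this
    exact mul_ne_zero (mul_ne_zero (zero_lt_one.trans_le hD1).ne' hc0) h0
  have hnet : (D : ℝ≥0∞) * c * avgOn μ w Q ≠ ∞ :=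
    ENNReal.mul_ne_top (ENNReal.mul_ne_top (by simp) (by simp)) ht
  refine (ENNReal.mul_le_mul_iff_right hne0 hnet).1 ?_
  calc D * c * avgOn μ w Q * (2 * μ (P ∩ ⋃₀ stopFamily μ 𝓓 w Q (2 * D * c)))
      ≤ D * c * avgOn μ w Q * (2 * μ (⋃₀ T')) := by gcongr
    _ = 2 * D * c * avgOn μ w Q * μ (⋃₀ T') := by ring
    _ ≤ μ P * avgOn μ w P := key
    _ ≤ μ P * (D * c * avgOn μ w Q) := by gcongr
    _ = _ := by ring

theorem IsGrid.ae_le_of_notMem_stopFamily (hD : IsGrid μ D 𝓓) {w : X → ℝ≥0∞} (hw : Measurable w)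
    (hwb : ∃ C : ℝ≥0, ∀ x, w x ≤ C) {Q : Set X} (hQ : Q ∈ 𝓓) :
    ∀ᵐ x ∂μ, x ∈ Q → ∀ c, x ∉ ⋃₀ stopFamily μ 𝓓 w Q c → w x ≤ c * avgOn μ w Q := by
  filter_upwards [hD.ae_le w hw hwb Q hQ] with x hx hxQ c hxc
  refine hx hxQ _ fun P hP hxP hPQ => ?_
  by_contra h
  exact hxc ⟨P, ⟨hP, hPQ, (not_le.1 h).le⟩, hxP⟩

end Stopping

section StepFunction

variable {X : Type*}

/-- The step function with value `α Q` on each `Q ∈ F`. -/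
def stepFun (F : Finset (Set X)) (α : Set X → ℝ≥0∞) (x : X) : ℝ≥0∞ :=
  ∑ Q ∈ F, Q.indicator (fun _ => α Q) x

theorem stepFun_eq {F : Finset (Set X)} (hF : (F : Set (Set X)).PairwiseDisjoint id)
    (α : Set X → ℝ≥0∞) {Q : Set X} (hQ : Q ∈ F) {x : X} (hx : x ∈ Q) : stepFun F α x = α Q := by
  unfold stepFun
  rw [Finset.sum_eq_single_of_mem Q hQ, indicator_of_mem hx]
  intro R hR hne
  refine indicator_of_notMem (fun hxR => ?_) _
  exact disjoint_left.1 (hF hR hQ hne) hxR hx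

theorem measurable_stepFun [MeasurableSpace X] {F : Finset (Set X)}
    (hF : ∀ Q ∈ F, MeasurableSet Q) (α : Set X → ℝ≥0∞) : Measurable (stepFun F α) :=
  Finset.measurable_fun_sum _ fun Q hQ => measurable_const.indicator (hF Q hQ)

end StepFunction

end

section

/-- The average of `w` over `Q` in the `L^γ` sense. -/
def powMean {X : Type*} [MeasurableSpace X] (μ : Measure X) (w : X → ℝ≥0∞) (γ : ℝ) (Q : Set X) :
    ℝ≥0∞ :=
  avgOn μ (fun x => w x ^ γ) Q ^ (1 / γ)

theorem coe_rpow_le_bound {X : Type*} {p : X → ℝ} {P : ℝ} (hp0 : ∀ x, 0 ≤ p x) (hP : ∀ x, p x ≤ P) (a : ℝ≥0) (x : X) :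
    (a : ℝ≥0∞) ^ p x ≤ ((max a 1) ^ P : ℝ≥0) := by
  have h0 : 0 ≤ P := (hp0 x).trans (hP x)
  rw [ENNReal.coe_rpow_of_nonneg _ h0]
  calc (a : ℝ≥0∞) ^ p x ≤ ((max a 1 : ℝ≥0) : ℝ≥0∞) ^ p x :=
        ENNReal.rpow_le_rpow (by exact_mod_cast le_max_left _ _) (hp0 x)
    _ ≤ _ := ENNReal.rpow_le_rpow_of_exponent_le (by exact_mod_cast le_max_right _ _) (hP x)

section ReverseHolder

variable {X : Type*} [MeasurableSpace X] {μ : Measure X} {D : ℝ≥0} {𝓓 : Set (Set X)}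
  {p : X → ℝ} {P : ℝ} {C₀ : ℝ≥0}

theorem avgOn_le_of_le {w : X → ℝ≥0∞} {C : ℝ≥0∞} (h : ∀ x, w x ≤ C) (Q : Set X) :
    avgOn μ w Q ≤ C := by
  unfold avgOn
  calc (μ Q)⁻¹ * ∫⁻ x in Q, w x ∂μ ≤ (μ Q)⁻¹ * (C * μ Q) := by
        gcongr
        calc ∫⁻ x in Q, w x ∂μ ≤ ∫⁻ x in Q, C ∂μ := lintegral_mono h
          _ = _ := by simp
    _ = C * ((μ Q)⁻¹ * μ Q) := by ring
    _ ≤ C * 1 := by gcongr; exact ENNReal.inv_mul_le_one _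
    _ = C := mul_one _

theorem avgOn_ne_zero {w : X → ℝ≥0∞} (hw : Measurable w) (h : ∀ x, w x ≠ 0) {Q : Set X}
    (h0 : μ Q ≠ 0) (ht : μ Q ≠ ∞) : avgOn μ w Q ≠ 0 := by
  unfold avgOn
  refine mul_ne_zero (ENNReal.inv_ne_zero.2 ht) ?_
  rw [Ne, lintegral_eq_zero_iff hw]
  intro hz
  have : ∀ᵐ x ∂μ.restrict Q, False := hz.mono fun x hx => h x hx
  rw [eventually_false_iff_eq_bot, ae_eq_bot, Measure.restrict_eq_zero] at this
  exact h0 this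

theorem coe_rpow_ne_zero {a : ℝ≥0} (ha : a ≠ 0) (y : ℝ) : (a : ℝ≥0∞) ^ y ≠ 0 :=
  (ENNReal.rpow_pos (by exact_mod_cast pos_iff_ne_zero.2 ha) ENNReal.coe_ne_top).ne'

theorem stopFamily_anti {w : X → ℝ≥0∞} {Q : Set X} {c c' : ℝ≥0∞} (h : c ≤ c') :
    stopFamily μ 𝓓 w Q c' ⊆ stopFamily μ 𝓓 w Q c := fun _ hP =>
  ⟨hP.1, hP.2.1, le_trans (by gcongr) hP.2.2⟩

/-- The `γ`-power of a bounded weight is controlled on `Q` by its masses on the stopping sets. -/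
theorem IsGrid.mul_powMean_le (hD : IsGrid μ D 𝓓) {w : X → ℝ≥0∞} (hw : Measurable w)
    (hwb : ∃ C : ℝ≥0, ∀ x, w x ≤ C) {Q : Set X} (hQ : Q ∈ 𝓓) (h0 : avgOn μ w Q ≠ 0)
    {B : ℝ≥0} (hB : 2 ≤ B) {γ : ℝ} (hγ : 1 < γ) :
    μ Q * powMean μ w γ Q ≤ ∫⁻ x in Q, w x ∂μ + ∑' i : ℕ, ((B : ℝ≥0∞) ^ (γ - 1)) ^ (i + 1) *
      ∫⁻ x in ⋃₀ stopFamily μ 𝓓 w Q (B ^ i), w x ∂μ := by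
  obtain ⟨C, hC⟩ := hwb
  set c := avgOn μ w Q with hc
  have hct : c ≠ ∞ := ne_top_of_le_ne_top ENNReal.coe_ne_top (avgOn_le_of_le hC Q)
  have hB1 : 1 < (B : ℝ≥0∞) := by
    have : 1 < B := lt_of_lt_of_le (by norm_num) hB
    exact_mod_cast this
  have hμ0 := hD.measure_ne_zero Q hQ
  have hμt := hD.measure_ne_top Q hQ
  set S : ℕ → Set X := fun i => ⋃₀ stopFamily μ 𝓓 w Q (B ^ i) with hS
  have hSm : ∀ i, MeasurableSet (S i) := fun i => hD.measurableSet_sUnion stopFamily_subset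
  set u := ∑' i : ℕ, ((B : ℝ≥0∞) ^ (γ - 1)) ^ (i + 1) * ∫⁻ x in S i, w x ∂μ with hu
  -- the stopping sets are eventually empty
  have hemp : ∃ N, ∀ x, x ∉ S N := by
    have hlim : Tendsto (fun i : ℕ => (B : ℝ≥0∞) ^ i) atTop (𝓝 ∞) :=
      ENNReal.tendsto_pow_atTop_nhds_top_iff.2 hB1
    have hlt : (C : ℝ≥0∞) / c < ∞ := ENNReal.div_lt_top ENNReal.coe_ne_top h0
    obtain ⟨N, hN⟩ := (hlim.eventually (lt_mem_nhds hlt)).exists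
    refine ⟨N, ?_⟩
    rintro x ⟨R, ⟨hR, hRQ, hle⟩, hx⟩
    have h2 : (B : ℝ≥0∞) ^ N * c ≤ C := hle.trans (avgOn_le_of_le hC R)
    rw [ENNReal.div_lt_iff (Or.inl h0) (Or.inl hct)] at hN
    exact absurd hN (not_lt.2 h2)
  have hpt : ∀ᵐ x ∂μ, x ∈ Q → w x ^ γ ≤ ∑' i : ℕ,
      c ^ (γ - 1) * (((B : ℝ≥0∞) ^ (γ - 1)) ^ (i + 1) * (S i).indicator w x) := by
    filter_upwards [hD.ae_le_of_notMem_stopFamily hw ⟨C, hC⟩ hQ] with x hx hxQ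
    have hx0 : x ∈ S 0 := ⟨Q, ⟨hQ, subset_rfl, by simp⟩, hxQ⟩
    obtain ⟨N, hN⟩ := hemp
    obtain ⟨i, hi, hi'⟩ : ∃ i, x ∈ S i ∧ x ∉ S (i + 1) := by
      by_contra! hcon
      exact hN x (Nat.rec hx0 (fun i hi => hcon i hi) N)
    refine le_trans ?_ (ENNReal.le_tsum i)
    rw [indicator_of_mem hi]
    have hle := hx hxQ _ hi'
    calc w x ^ γ = w x ^ (γ - 1) * w x := by
          conv_lhs => rw [show γ = (γ - 1) + 1 by ring]
          rw [ENNReal.rpow_add_of_nonneg _ _ (by linarith) (by norm_num), ENNReal.rpow_one]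
      _ ≤ (B ^ (i + 1) * c) ^ (γ - 1) * w x := by
          gcongr
      _ = _ := by
          rw [ENNReal.mul_rpow_of_nonneg _ _ (by linarith), ← ENNReal.rpow_natCast,
            ← ENNReal.rpow_natCast, ← ENNReal.rpow_mul, ← ENNReal.rpow_mul, mul_comm (γ - 1)]
          ring
  have hgint : ∫⁻ x in Q, w x ^ γ ∂μ ≤ c ^ (γ - 1) * u := by
    calc ∫⁻ x in Q, w x ^ γ ∂μ ≤ ∫⁻ x in Q, ∑' i : ℕ,
          c ^ (γ - 1) * (((B : ℝ≥0∞) ^ (γ - 1)) ^ (i + 1) * (S i).indicator w x) ∂μ := by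
          refine setLIntegral_mono_ae' (hD.measurableSet Q hQ) hpt
      _ ≤ ∫⁻ x, ∑' i : ℕ,
          c ^ (γ - 1) * (((B : ℝ≥0∞) ^ (γ - 1)) ^ (i + 1) * (S i).indicator w x) ∂μ :=
          setLIntegral_le_lintegral _ _
      _ = c ^ (γ - 1) * u := by
          rw [lintegral_tsum fun i => by
            have := hw.indicator (hSm i)
            fun_prop, hu, ← ENNReal.tsum_mul_left]
          refine tsum_congr fun i => ?_
          have := hw.indicator (hSm i)
          rw [lintegral_const_mul _ (by fun_prop), lintegral_const_mul _ this,
            lintegral_indicator (hSm i)]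
  rw [← measure_mul_avgOn hμ0 hμt, ← hc]
  have havg : avgOn μ (fun x => w x ^ γ) Q ≤ c ^ γ * (u / (μ Q * c)) := by
    unfold avgOn
    calc _ ≤ (μ Q)⁻¹ * (c ^ (γ - 1) * u) := by gcongr
      _ = c ^ γ * (u / (μ Q * c)) := by
        rw [ENNReal.rpow_sub _ _ h0 hct, ENNReal.rpow_one, div_eq_mul_inv, div_eq_mul_inv,
          ENNReal.mul_inv (Or.inl hμ0) (Or.inl hμt)]
        ring
  have hA : powMean μ w γ Q ≤ c * (1 + u / (μ Q * c)) := by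
    unfold powMean
    have h1γ : (0 : ℝ) ≤ 1 / γ := by positivity
    calc _ ≤ (c ^ γ * (u / (μ Q * c))) ^ (1 / γ) := ENNReal.rpow_le_rpow havg h1γ
      _ = c * (u / (μ Q * c)) ^ (1 / γ) := by
        rw [ENNReal.mul_rpow_of_nonneg _ _ h1γ, ← ENNReal.rpow_mul, mul_one_div_cancel (by linarith),
          ENNReal.rpow_one]
      _ ≤ c * (1 + u / (μ Q * c)) := by
        gcongr
        rcases le_total (u / (μ Q * c)) 1 with h | h
        · exact le_add_right (ENNReal.rpow_le_one h h1γ)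
        · refine le_trans (ENNReal.rpow_le_rpow_of_exponent_le h (?_ : 1 / γ ≤ 1)) ?_
          · rw [div_le_one (by linarith)]; exact hγ.le
          · rw [ENNReal.rpow_one]; exact le_add_self
  calc μ Q * powMean μ w γ Q ≤ μ Q * (c * (1 + u / (μ Q * c))) := by gcongr
    _ = μ Q * c + (μ Q * c) * (u / (μ Q * c)) := by ring
    _ ≤ μ Q * c + u := by gcongr; exact ENNReal.mul_div_le

theorem GridBounded.exists_reverseHolder (H : GridBounded μ 𝓓 p C₀) (hD : IsGrid μ D 𝓓)
    (hpm : Measurable p) (h1 : ∀ x, 1 ≤ p x) (hP : ∀ x, p x ≤ P) (hP1 : 1 ≤ P) :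
    ∃ γ : ℝ, 1 < γ ∧ ∃ C : ℝ≥0, ∀ F : Finset (Set X), (∀ Q ∈ F, Q ∈ 𝓓) →
      (F : Set (Set X)).PairwiseDisjoint id → ∀ α : Set X → ℝ≥0, (∀ Q ∈ F, α Q ≠ 0) →
      ∑ Q ∈ F, ∫⁻ x in Q, (α Q : ℝ≥0∞) ^ p x ∂μ ≤ 1 →
      ∑ Q ∈ F, μ Q * powMean μ (fun x => (α Q : ℝ≥0∞) ^ p x) γ Q ≤ C := by
  obtain ⟨r, hr, hcontr⟩ := H.exists_contraction h1 hP hP1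
  have hp0 : ∀ x, 0 ≤ p x := fun x => zero_le_one.trans (h1 x)
  set B : ℝ≥0 := 2 * D with hB
  have hB2 : 2 ≤ B := by
    rw [hB]; nth_rewrite 1 [← mul_one 2]; gcongr; exact hD.one_le
  have hB1 : (1 : ℝ) < B := by
    have : (1 : ℝ≥0) < B := lt_of_lt_of_le (by norm_num) hB2
    exact_mod_cast this
  have hr0 : 0 < r := zero_lt_one.trans hr
  set s : ℝ≥0 := NNReal.sqrt r with hs
  have hs2 : s * s = r := NNReal.mul_self_sqrt r
  have hs1 : 1 < s := by
    rw [hs]; by_contra h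
    rw [not_lt] at h
    have : s * s ≤ 1 * 1 := by gcongr
    rw [hs2, mul_one] at this
    exact absurd hr (not_lt.2 this)
  have hs0 : 0 < s := zero_lt_one.trans hs1
  set γ : ℝ := 1 + Real.logb B s with hγ
  have hγ1 : 1 < γ := by
    have := Real.logb_pos hB1 (show (1 : ℝ) < s by exact_mod_cast hs1)
    linarith
  have hβ : (B : ℝ≥0∞) ^ (γ - 1) = s := by
    rw [← ENNReal.coe_rpow_of_nonneg _ (by linarith)]
    congr 1
    rw [← NNReal.coe_inj, NNReal.coe_rpow, hγ, add_sub_cancel_left]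
    exact Real.rpow_logb (by linarith) hB1.ne' (by exact_mod_cast hs0)
  refine ⟨γ, hγ1, 1 + s * (1 - s⁻¹)⁻¹, fun F hF hdis α hα hle => ?_⟩
  set f := stepFun F (fun Q => (α Q : ℝ≥0∞)) with hf
  have hfm : Measurable f := measurable_stepFun (fun Q hQ => hD.measurableSet Q (hF Q hQ)) _
  set w : Set X → X → ℝ≥0∞ := fun Q x => (α Q : ℝ≥0∞) ^ p x with hw
  have hwm : ∀ Q, Measurable (w Q) := fun Q => by simp only [hw]; fun_prop
  have hwb : ∀ Q, ∃ C : ℝ≥0, ∀ x, w Q x ≤ C := fun Q => ⟨_, coe_rpow_le_bound hp0 hP (α Q)⟩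
  have hw0 : ∀ Q ∈ F, avgOn μ (w Q) Q ≠ 0 := fun Q hQ =>
    avgOn_ne_zero (hwm Q) (fun x => coe_rpow_ne_zero (hα Q hQ) _)
      (hD.measure_ne_zero Q (hF Q hQ)) (hD.measure_ne_top Q (hF Q hQ))
  have hwt : ∀ Q ∈ F, avgOn μ (w Q) Q ≠ ∞ := fun Q _ => by
    obtain ⟨C, hC⟩ := hwb Q
    exact ne_top_of_le_ne_top ENNReal.coe_ne_top (avgOn_le_of_le hC Q)
  set S : Set X → ℕ → Set X := fun Q i => ⋃₀ stopFamily μ 𝓓 (w Q) Q (B ^ i) with hS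
  have hSm : ∀ Q i, MeasurableSet (S Q i) := fun Q i => hD.measurableSet_sUnion stopFamily_subset
  have hSQ : ∀ Q i, S Q i ⊆ Q := fun Q i => sUnion_stopFamily_subset
  have hfS : ∀ Q ∈ F, ∀ x ∈ Q, f x = α Q := fun Q hQ x hx => stepFun_eq hdis _ hQ hx
  set G : ℕ → Set X := fun i => ⋃ Q ∈ F, S Q i with hG
  have hGm : ∀ i, MeasurableSet (G i) := fun i =>
    Finset.measurableSet_biUnion _ fun Q _ => hSm Q i
  have hGa : ∀ i, G (i + 1) ⊆ G i := fun i => iUnion₂_mono fun Q _ =>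
    sUnion_subset_sUnion (stopFamily_anti (by
      refine pow_le_pow_right₀ ?_ (Nat.le_succ i)
      exact_mod_cast hB1.le))
  have hGS : ∀ i, ∀ Q ∈ F, ∀ x ∈ Q, x ∈ G i → x ∈ S Q i := by
    intro i Q hQ x hx hxG
    simp only [hG, mem_iUnion] at hxG
    obtain ⟨Q', hQ', hx'⟩ := hxG
    have : Q = Q' := hdis.elim_set hQ hQ' x hx (hSQ Q' i hx')
    rwa [this]
  have hGint : ∀ i, ∫⁻ x in G i, f x ^ p x ∂μ = ∑ Q ∈ F, ∫⁻ x in S Q i, w Q x ∂μ := by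
    intro i
    rw [hG, lintegral_biUnion_finset]
    · refine Finset.sum_congr rfl fun Q hQ => setLIntegral_congr_fun (hSm Q i) fun x hx => ?_
      simp only [hw]
      rw [hfS Q hQ x (hSQ Q i hx)]
    · exact hdis.mono_on fun Q _ => hSQ Q i
    · exact fun Q _ => hSm Q i
  have hf2 : ∀ i, ∀ x ∈ G i, f x ≤ 2 * gridMax μ 𝓓 ((G i \ G (i + 1)).indicator f) x := by
    intro i x hx
    simp only [hG, mem_iUnion] at hx
    obtain ⟨Q, hQ, hx⟩ := hx
    obtain ⟨R, hR, hxR, hRS, hμ⟩ := hD.exists_mem_stopFamily (hF Q hQ) (hw0 Q hQ) (hwt Q hQ)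
      (c := B ^ i) (one_le_pow₀ (by exact_mod_cast hB1.le)) (x := x) (by simpa [hS] using hx)
    have hRS' : R ⊆ S Q i := by simpa [hS] using hRS
    have hμ' : 2 * μ (R ∩ S Q (i + 1)) ≤ μ R := by
      convert hμ using 5
      rw [pow_succ, hB]; push_cast; ring_nf
    have hμ0 := hD.measure_ne_zero R hR
    have hμt := hD.measure_ne_top R hR
    have hhalf : μ R ≤ 2 * μ (R \ S Q (i + 1)) := by
      have := measure_inter_add_sdiff (μ := μ) R (hSm Q (i + 1))
      have h3 : μ R + μ R ≤ μ R + 2 * μ (R \ S Q (i + 1)) := by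
        calc μ R + μ R = 2 * μ (R ∩ S Q (i + 1)) + 2 * μ (R \ S Q (i + 1)) := by
              rw [← mul_add, this, two_mul]
          _ ≤ _ := by gcongr
      exact (ENNReal.add_le_add_iff_left hμt).1 h3
    rw [hfS Q hQ x (hSQ Q i hx)]
    refine le_trans ?_ (mul_le_mul_right (avgOn_le_gridMax hR hxR _) _)
    rw [← ENNReal.mul_le_mul_iff_right hμ0 hμt, mul_left_comm, measure_mul_avgOn hμ0 hμt]
    calc μ R * α Q ≤ 2 * μ (R \ S Q (i + 1)) * α Q := by gcongr
      _ = 2 * ∫⁻ x in R \ S Q (i + 1), α Q ∂μ := by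
          rw [setLIntegral_const]; ring
      _ ≤ 2 * ∫⁻ x in R \ S Q (i + 1), (G i \ G (i + 1)).indicator f x ∂μ := by
          refine mul_le_mul_right (setLIntegral_mono' ((hD.measurableSet R hR).diff (hSm _ _)) ?_) _
          intro y hy
          have hyQ := hSQ Q i (hRS' hy.1)
          rw [indicator_of_mem, hfS Q hQ y hyQ]
          refine ⟨mem_biUnion hQ (hRS' hy.1), fun hyG => hy.2 (hGS _ Q hQ y hyQ hyG)⟩
      _ ≤ _ := by
          refine mul_le_mul_right (lintegral_mono_set sdiff_subset) _
  have hGi : ∀ i : ℕ, ∫⁻ x in G i, ((r : ℝ≥0∞) ^ i * f x) ^ p x ∂μ ≤ 1 := by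
    intro i
    induction i with
    | zero =>
      simp only [pow_zero, one_mul]
      rw [hGint]
      exact le_trans (Finset.sum_le_sum fun Q _ => lintegral_mono_set (hSQ Q 0)) hle
    | succ i ih =>
      have := hcontr (fun x => (r : ℝ≥0∞) ^ i * f x) (hfm.const_mul _) _ _ (hGm (i + 1)) (hGm i)
        (hGa i) (fun x hx => by
          rw [show (G i \ G (i + 1)).indicator (fun x => (r : ℝ≥0∞) ^ i * f x) =
            fun x => (r : ℝ≥0∞) ^ i * (G i \ G (i + 1)).indicator f x by
              ext y; by_cases hy : y ∈ G i \ G (i + 1) <;> simp [hy]]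
          rw [gridMax_const_mul (by simp), mul_left_comm]
          gcongr
          exact hf2 i x hx) ih
      simpa only [pow_succ', mul_assoc] using this
  have hGi' : ∀ i : ℕ, ∫⁻ x in G i, f x ^ p x ∂μ ≤ ((r : ℝ≥0∞) ^ i)⁻¹ := by
    intro i
    have hri : (1 : ℝ≥0∞) ≤ (r : ℝ≥0∞) ^ i := one_le_pow₀ (by exact_mod_cast hr.le)
    rw [ENNReal.le_inv_iff_mul_le, mul_comm]
    exact (le_modular_const_mul h1 f hri (by simp)).trans (hGi i)
  calc ∑ Q ∈ F, μ Q * powMean μ (w Q) γ Q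
      ≤ ∑ Q ∈ F, (∫⁻ x in Q, w Q x ∂μ + ∑' i : ℕ, ((B : ℝ≥0∞) ^ (γ - 1)) ^ (i + 1) *
          ∫⁻ x in S Q i, w Q x ∂μ) := Finset.sum_le_sum fun Q hQ =>
        hD.mul_powMean_le (hwm Q) (hwb Q) (hF Q hQ) (hw0 Q hQ) hB2 hγ1
    _ ≤ 1 + ∑ Q ∈ F, ∑' i : ℕ, (s : ℝ≥0∞) ^ (i + 1) * ∫⁻ x in S Q i, w Q x ∂μ := by
        rw [Finset.sum_add_distrib, hβ]; gcongr
    _ = 1 + ∑' i : ℕ, (s : ℝ≥0∞) ^ (i + 1) * ∫⁻ x in G i, f x ^ p x ∂μ := by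
        rw [← Summable.tsum_finsetSum fun _ _ => ENNReal.summable]
        simp only [hGint, Finset.mul_sum]
    _ ≤ 1 + ∑' i : ℕ, (s : ℝ≥0∞) * ((s⁻¹ : ℝ≥0) : ℝ≥0∞) ^ i := by
        refine add_le_add_right (ENNReal.tsum_le_tsum fun i => ?_) _
        calc (s : ℝ≥0∞) ^ (i + 1) * ∫⁻ x in G i, f x ^ p x ∂μ
            ≤ (s : ℝ≥0∞) ^ (i + 1) * ((r : ℝ≥0∞) ^ i)⁻¹ := by gcongr; exact hGi' i
          _ = _ := by
            rw [← hs2, ← ENNReal.coe_pow, ← ENNReal.coe_pow, ← ENNReal.coe_pow,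
              ← ENNReal.coe_inv (by positivity), ← ENNReal.coe_mul, ← ENNReal.coe_mul]
            congr 1
            have := (pow_pos hs0 i).ne'
            rw [mul_pow, inv_pow, pow_succ']
            field_simp
    _ = _ := by
        rw [ENNReal.tsum_mul_left, ENNReal.tsum_geometric]
        have : s⁻¹ < 1 := inv_lt_one_of_one_lt₀ hs1
        rw [ENNReal.coe_add, ENNReal.coe_mul, ENNReal.coe_inv (tsub_pos_of_lt this).ne',
          ENNReal.coe_sub, ENNReal.coe_one]

end ReverseHolder

end

section

section PowerMeans

variable {X : Type*} [MeasurableSpace X] {μ : Measure X}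

theorem avgOn_rpow_mul_rpow_le {f g : X → ℝ≥0∞} (hf : Measurable f) (hg : Measurable g) {a b : ℝ}
    (ha : 0 ≤ a) (hb : 0 ≤ b) (hab : a + b = 1) (Q : Set X) :
    avgOn μ (fun x => f x ^ a * g x ^ b) Q ≤ avgOn μ f Q ^ a * avgOn μ g Q ^ b := by
  unfold avgOn
  rw [ENNReal.mul_rpow_of_nonneg _ _ ha, ENNReal.mul_rpow_of_nonneg _ _ hb]
  calc (μ Q)⁻¹ * ∫⁻ x in Q, f x ^ a * g x ^ b ∂μ
      ≤ (μ Q)⁻¹ * ((∫⁻ x in Q, f x ∂μ) ^ a * (∫⁻ x in Q, g x ∂μ) ^ b) := by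
        gcongr
        exact ENNReal.lintegral_mul_norm_pow_le hf.aemeasurable hg.aemeasurable ha hb hab
    _ = ((μ Q)⁻¹ ^ a * (μ Q)⁻¹ ^ b) * ((∫⁻ x in Q, f x ∂μ) ^ a * (∫⁻ x in Q, g x ∂μ) ^ b) := by
        rw [← ENNReal.rpow_add_of_nonneg _ _ ha hb, hab, ENNReal.rpow_one]
    _ = _ := by ring

theorem avgOn_rpow_le {f : X → ℝ≥0∞} (hf : Measurable f) {a : ℝ}
    (ha : 0 ≤ a) (ha1 : a ≤ 1) (Q : Set X) :
    avgOn μ (fun x => f x ^ a) Q ≤ avgOn μ f Q ^ a := by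
  have := avgOn_rpow_mul_rpow_le (μ := μ) hf (measurable_const (a := (1 : ℝ≥0∞))) ha
    (sub_nonneg.2 ha1) (by ring) Q
  simp only [ENNReal.one_rpow, mul_one] at this
  refine this.trans ?_
  calc _ ≤ avgOn μ f Q ^ a * 1 := by
        gcongr
        exact ENNReal.rpow_le_one (avgOn_le_of_le (fun _ => le_rfl) Q) (sub_nonneg.2 ha1)
    _ = _ := mul_one _

theorem powMean_le_powMean {w : X → ℝ≥0∞} (hw : Measurable w) {a b : ℝ} (ha : 0 < a) (hab : a ≤ b)
    (Q : Set X) : powMean μ w a Q ≤ powMean μ w b Q := by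
  unfold powMean
  have hb : 0 < b := ha.trans_le hab
  have h := avgOn_rpow_le (μ := μ) (hw.pow_const b) (a := a / b) (by positivity)
    (by rw [div_le_one hb]; exact hab) Q
  have h2 : (fun x => (w x ^ b) ^ (a / b)) = fun x => w x ^ a := by
    ext x; rw [← ENNReal.rpow_mul, mul_div_cancel₀ _ hb.ne']
  rw [h2] at h
  refine (ENNReal.rpow_le_rpow h (by positivity)).trans_eq ?_
  rw [← ENNReal.rpow_mul]
  congr 1
  field_simp

theorem powMean_mono {v w : X → ℝ≥0∞} (h : v ≤ w) {a : ℝ} (ha : 0 ≤ a) (Q : Set X) :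
    powMean μ v a Q ≤ powMean μ w a Q := by
  unfold powMean
  refine ENNReal.rpow_le_rpow (avgOn_mono (fun x => ?_) Q) (by positivity)
  exact ENNReal.rpow_le_rpow (h x) ha

theorem powMean_const_mul {c : ℝ≥0∞} (hc : c ≠ ∞) (w : X → ℝ≥0∞) {a : ℝ} (ha : 0 < a)
    (Q : Set X) : powMean μ (fun x => c * w x) a Q = c * powMean μ w a Q := by
  unfold powMean
  simp_rw [ENNReal.mul_rpow_of_nonneg _ _ ha.le]
  rw [avgOn_const_mul (ENNReal.rpow_ne_top_of_nonneg ha.le hc), ENNReal.mul_rpow_of_nonneg _ _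
    (by positivity), ← ENNReal.rpow_mul, mul_one_div_cancel ha.ne', ENNReal.rpow_one]

theorem avgOn_ne_top_of_le {w : X → ℝ≥0∞} {C : ℝ≥0} (h : ∀ x, w x ≤ C) (Q : Set X) :
    avgOn μ w Q ≠ ∞ := ne_top_of_le_ne_top ENNReal.coe_ne_top (avgOn_le_of_le h Q)

/-- If the `γ`-mean of `w` is much larger than its mean, then the `γ / t`-mean of `w ^ t` is
larger than its mean, for `t` in a neighbourhood of `1`. -/
theorem mul_avgOn_rpow_le_of_mul_avgOn_le {w : X → ℝ≥0∞} (hw : Measurable w) {γ t : ℝ}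
    (hγ : 1 < γ) (ht : γ⁻¹ ≤ t) (ht' : t ≤ (1 + γ) / 2) {K' : ℝ≥0} (hK' : 1 ≤ K') {Q : Set X}
    (hbad : (K' : ℝ≥0∞) ^ (2 * γ) * avgOn μ w Q ≤ powMean μ w γ Q) :
    K' * avgOn μ (fun x => w x ^ t) Q ≤ powMean μ w γ Q ^ t := by
  have hγ0 : 0 < γ := by linarith
  have ht0 : 0 < t := (inv_pos.2 hγ0).trans_le ht
  have hK1 : (1 : ℝ≥0∞) ≤ K' := by exact_mod_cast hK'
  have hK0 : (K' : ℝ≥0∞) ≠ 0 := (zero_lt_one.trans_le hK1).ne'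
  set A := powMean μ w γ Q with hA
  have hpow : ∀ y : ℝ, 1 ≤ y → (K' : ℝ≥0∞) ≤ (K' : ℝ≥0∞) ^ y := fun y hy => by
    simpa using ENNReal.rpow_le_rpow_of_exponent_le hK1 hy
  rcases le_total t 1 with h1 | h1
  · calc K' * avgOn μ (fun x => w x ^ t) Q ≤ (K' : ℝ≥0∞) ^ (2 * γ * t) * avgOn μ w Q ^ t := by
          gcongr
          · refine hpow _ ?_
            have : γ * γ⁻¹ = 1 := mul_inv_cancel₀ hγ0.ne'
            nlinarith
          · exact avgOn_rpow_le hw ht0.le h1 Q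
      _ = ((K' : ℝ≥0∞) ^ (2 * γ) * avgOn μ w Q) ^ t := by
          rw [ENNReal.mul_rpow_of_nonneg _ _ ht0.le, ← ENNReal.rpow_mul]
      _ ≤ _ := ENNReal.rpow_le_rpow hbad ht0.le
  · set θ := (t - 1) / (γ - 1) with hθ
    have hγ1 : 0 < γ - 1 := by linarith
    have hθ0 : 0 ≤ θ := div_nonneg (by linarith) hγ1.le
    have hθ2 : θ ≤ 1 / 2 := by
      rw [hθ, div_le_iff₀ hγ1]; linarith
    have hθt : (1 - θ) + γ * θ = t := by
      rw [hθ]; field_simp; ring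
    have h2 := avgOn_rpow_mul_rpow_le (μ := μ) hw (hw.pow_const γ) (a := 1 - θ) (b := θ)
      (by linarith) hθ0 (by ring) Q
    have h3 : (fun x => w x ^ (1 - θ) * (w x ^ γ) ^ θ) = fun x => w x ^ t := by
      ext x
      rw [← ENNReal.rpow_mul, ← ENNReal.rpow_add_of_nonneg _ _ (by linarith) (by positivity), hθt]
    have hAγ : avgOn μ (fun x => w x ^ γ) Q = A ^ γ := by
      rw [hA, powMean, ← ENNReal.rpow_mul, one_div_mul_cancel hγ0.ne', ENNReal.rpow_one]
    rw [h3, hAγ] at h2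
    calc K' * avgOn μ (fun x => w x ^ t) Q
        ≤ (K' : ℝ≥0∞) ^ (2 * γ * (1 - θ)) * (avgOn μ w Q ^ (1 - θ) * (A ^ γ) ^ θ) := by
          gcongr
          refine hpow _ ?_
          nlinarith
      _ = ((K' : ℝ≥0∞) ^ (2 * γ) * avgOn μ w Q) ^ (1 - θ) * (A ^ γ) ^ θ := by
          rw [ENNReal.mul_rpow_of_nonneg _ _ (by linarith),
            ENNReal.rpow_mul (K' : ℝ≥0∞) (2 * γ) (1 - θ), mul_assoc]
      _ ≤ A ^ (1 - θ) * (A ^ γ) ^ θ := by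
          gcongr
          linarith
      _ = A ^ t := by
          rw [← ENNReal.rpow_mul, ← ENNReal.rpow_add_of_nonneg _ _ (by linarith) (by positivity),
            hθt]

end PowerMeans

section BadCubes

variable {X : Type*} [MeasurableSpace X] {μ : Measure X} {D : ℝ≥0} {𝓓 : Set (Set X)}
  {p : X → ℝ} {P : ℝ} {C₀ : ℝ≥0}

theorem coe_rpow_rpow_comm (a : ℝ≥0) {t : ℝ} (ht : 0 ≤ t) (y : ℝ) :
    ((a ^ t : ℝ≥0) : ℝ≥0∞) ^ y = ((a : ℝ≥0∞) ^ y) ^ t := by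
  rw [ENNReal.coe_rpow_of_nonneg _ ht, ← ENNReal.rpow_mul, ← ENNReal.rpow_mul, mul_comm]

theorem continuousOn_setLIntegral_rpow (hpm : Measurable p) (hp0 : ∀ x, 0 ≤ p x)
    (hP : ∀ x, p x ≤ P) {a : ℝ≥0} (ha : a ≠ 0) {Q : Set X} (hQ : μ Q ≠ ∞) :
    ContinuousOn (fun t : ℝ => ∫⁻ x in Q, ((a ^ t : ℝ≥0) : ℝ≥0∞) ^ p x ∂μ) (Ioi 0) := by
  intro t ht
  refine ContinuousAt.continuousWithinAt ?_
  have ht : 0 < t := ht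
  by_cases hX : Nonempty X
  swap
  · have := not_nonempty_iff.1 hX
    simp only [Measure.eq_zero_of_isEmpty μ, Measure.restrict_zero, lintegral_zero_measure]
    exact continuousAt_const
  have hP0 : 0 ≤ P := (hp0 hX.some).trans (hP _)
  set M : ℝ≥0 := max a 1 with hM
  have hM1 : 1 ≤ M := le_max_right _ _
  refine tendsto_lintegral_filter_of_dominated_convergence
    (fun _ => ((max (M ^ (t + 1)) 1 ^ P : ℝ≥0) : ℝ≥0∞)) ?_ ?_ ?_ ?_
  · exact Eventually.of_forall fun s => by fun_prop
  · filter_upwards [Iio_mem_nhds (show t < t + 1 by linarith), Ioi_mem_nhds ht] with s hs hs0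
    refine Eventually.of_forall fun x => ?_
    refine le_trans (ENNReal.rpow_le_rpow ?_ (hp0 x)) (coe_rpow_le_bound hp0 hP (M ^ (t + 1)) x)
    have h1 : a ^ s ≤ M ^ s := NNReal.rpow_le_rpow (le_max_left _ _) (le_of_lt hs0)
    have h2 : M ^ s ≤ M ^ (t + 1) := NNReal.rpow_le_rpow_of_exponent_le hM1 (le_of_lt hs)
    exact_mod_cast h1.trans h2
  · rw [setLIntegral_const]
    exact ENNReal.mul_ne_top ENNReal.coe_ne_top hQ
  · refine Eventually.of_forall fun x => ?_
    have h1 : Tendsto (fun s : ℝ => a ^ s) (𝓝 t) (𝓝 (a ^ t)) :=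
      tendsto_const_nhds.nnrpow tendsto_id (Or.inl ha)
    exact (ENNReal.continuous_rpow_const.tendsto _).comp (ENNReal.tendsto_coe.2 h1)

theorem GridBounded.exists_bad_le (H : GridBounded μ 𝓓 p C₀) (hD : IsGrid μ D 𝓓)
    (hpm : Measurable p) (h1 : ∀ x, 1 ≤ p x) (hP : ∀ x, p x ≤ P) (hP1 : 1 ≤ P) :
    ∃ γ : ℝ, 1 < γ ∧ ∃ σ : ℝ, 0 < σ ∧ ∃ K C : ℝ≥0, 1 ≤ K ∧ ∀ F : Finset (Set X),
      (∀ Q ∈ F, Q ∈ 𝓓) → (F : Set (Set X)).PairwiseDisjoint id →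
      ∀ α : Set X → ℝ≥0, (∀ Q ∈ F, α Q ≠ 0) →
      (∀ Q ∈ F, K * avgOn μ (fun x => (α Q : ℝ≥0∞) ^ p x) Q ≤
        powMean μ (fun x => (α Q : ℝ≥0∞) ^ p x) γ Q) →
      ∑ Q ∈ F, ∫⁻ x in Q, (α Q : ℝ≥0∞) ^ p x ∂μ ≤ 1 →
      ∀ δ : ℝ≥0, δ ≤ 1 → ((∀ Q ∈ F, α Q ≤ δ) ∨ ∀ Q ∈ F, (α Q)⁻¹ ≤ δ) →
      ∑ Q ∈ F, μ Q * powMean μ (fun x => (α Q : ℝ≥0∞) ^ p x) γ Q ≤ C * δ ^ σ := by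
  obtain ⟨γ₂, hγ₂, C, hRH⟩ := H.exists_reverseHolder hD hpm h1 hP hP1
  have hp0 : ∀ x, 0 ≤ p x := fun x => zero_le_one.trans (h1 x)
  set γ := √γ₂ with hγ
  have hγγ : γ * γ = γ₂ := Real.mul_self_sqrt (by linarith)
  have hγ1 : 1 < γ := by rw [hγ, Real.lt_sqrt (by norm_num)]; simpa using hγ₂
  have hγ0 : 0 < γ := by linarith
  set l := γ⁻¹ with hl
  set ν := (1 + γ) / 2 with hν
  have hl0 : 0 < l := inv_pos.2 hγ0
  have hl1 : l < 1 := inv_lt_one_of_one_lt₀ hγ1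
  have hν1 : 1 < ν := by rw [hν]; linarith
  set K' : ℝ≥0 := C + 1 with hK'
  have hK'1 : 1 ≤ K' := by simp [hK']
  refine ⟨γ, hγ1, min (1 - l) (ν - 1), lt_min (by linarith) (by linarith), K' ^ (2 * γ), C,
    NNReal.one_le_rpow hK'1 (by positivity), fun F hF hdis α hα hbad hle δ hδ hδα => ?_⟩
  have hwm : ∀ a : ℝ≥0, Measurable fun x => (a : ℝ≥0∞) ^ p x := fun a => by fun_prop
  -- the modular of `α ^ t`
  set h : ℝ → ℝ≥0∞ := fun t => ∑ Q ∈ F, ∫⁻ x in Q, ((α Q ^ t : ℝ≥0) : ℝ≥0∞) ^ p x ∂μ with hh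
  have hcont : ContinuousOn h (Ioi 0) := by
    refine continuousOn_finsetSum _ fun Q hQ => ?_
    exact continuousOn_setLIntegral_rpow hpm hp0 hP (hα Q hQ) (hD.measure_ne_top Q (hF Q hQ))
  have hαt : ∀ t : ℝ, ∀ Q ∈ F, α Q ^ t ≠ 0 := fun t Q hQ =>
    (NNReal.rpow_pos (pos_iff_ne_zero.2 (hα Q hQ))).ne'
  have hK : ∀ t ∈ Icc l ν, K' * h t ≤
      ∑ Q ∈ F, μ Q * powMean μ (fun x => ((α Q ^ t : ℝ≥0) : ℝ≥0∞) ^ p x) γ₂ Q := by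
    intro t ht
    have ht0 : 0 < t := hl0.trans_le ht.1
    rw [hh, Finset.mul_sum]
    refine Finset.sum_le_sum fun Q hQ => ?_
    rw [← measure_mul_avgOn (hD.measure_ne_zero Q (hF Q hQ)) (hD.measure_ne_top Q (hF Q hQ)),
      mul_left_comm]
    gcongr
    simp_rw [coe_rpow_rpow_comm (α Q) ht0.le]
    refine (mul_avgOn_rpow_le_of_mul_avgOn_le (hwm (α Q)) hγ1 ht.1 ht.2 hK'1 ?_).trans ?_
    · rw [← ENNReal.coe_rpow_of_nonneg _ (by positivity)]
      exact hbad Q hQ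
    · have h2 : powMean μ (fun x => (α Q : ℝ≥0∞) ^ p x) γ Q ^ t =
          powMean μ (fun x => ((α Q : ℝ≥0∞) ^ p x) ^ t) (γ / t) Q := by
        have h5 : (fun x => (((α Q : ℝ≥0∞) ^ p x) ^ t) ^ (γ / t)) =
            fun x => ((α Q : ℝ≥0∞) ^ p x) ^ γ := by
          ext x; rw [← ENNReal.rpow_mul, mul_div_cancel₀ _ ht0.ne']
        unfold powMean
        rw [h5, ← ENNReal.rpow_mul]
        congr 1
        field_simp
      rw [h2]
      refine powMean_le_powMean ((hwm _).pow_const _) (by positivity) ?_ Q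
      rw [div_le_iff₀ ht0, ← hγγ]
      have : γ * l = 1 := mul_inv_cancel₀ hγ0.ne'
      nlinarith [ht.1, mul_le_mul_of_nonneg_left ht.1 hγ0.le]
  have hone : ∀ t ∈ Icc l ν, h t ≤ 1 := by
    intro t ht
    by_contra hcon
    rw [not_le] at hcon
    have hsub : uIcc 1 t ⊆ Icc l ν := by
      rw [← uIcc_of_le (hl1.le.trans hν1.le)]
      refine uIcc_subset_uIcc ?_ ?_
      · rw [uIcc_of_le (hl1.le.trans hν1.le)]; exact ⟨hl1.le, hν1.le⟩
      · rw [uIcc_of_le (hl1.le.trans hν1.le)]; exact ht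
    have hivt := intermediate_value_uIcc (f := h) (a := 1) (b := t)
      (hcont.mono fun s hs => hl0.trans_le (hsub hs).1)
    have h11 : h 1 ≤ 1 := by simpa [hh] using hle
    obtain ⟨s, hs, hs1⟩ := hivt (by
      rw [uIcc_of_le (h11.trans hcon.le)]; exact ⟨h11, hcon.le⟩ : (1 : ℝ≥0∞) ∈ uIcc (h 1) (h t))
    have h3 := (hK s (hsub hs)).trans
      (hRH F hF hdis (fun Q => α Q ^ s) (hαt s) (by rw [← hs1]))
    rw [hs1, mul_one] at h3
    have h4 : K' ≤ C := by exact_mod_cast h3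
    rw [hK'] at h4
    exact absurd h4 (not_le.2 (lt_add_one C))
  have hRH' : ∀ t ∈ Icc l ν,
      ∑ Q ∈ F, μ Q * powMean μ (fun x => ((α Q ^ t : ℝ≥0) : ℝ≥0∞) ^ p x) γ Q ≤ C := by
    intro t ht
    refine le_trans (Finset.sum_le_sum fun Q hQ => ?_)
      (hRH F hF hdis (fun Q => α Q ^ t) (hαt t) (hone t ht))
    gcongr
    exact powMean_le_powMean (hwm _) hγ0 (by nlinarith) Q
  have hfin : ∀ t ∈ Icc l ν, ∀ c : ℝ≥0, (∀ Q ∈ F, ∀ x, (α Q : ℝ≥0∞) ^ p x ≤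
      c * ((α Q ^ t : ℝ≥0) : ℝ≥0∞) ^ p x) →
      ∑ Q ∈ F, μ Q * powMean μ (fun x => (α Q : ℝ≥0∞) ^ p x) γ Q ≤ C * c := by
    intro t ht c hc
    calc ∑ Q ∈ F, μ Q * powMean μ (fun x => (α Q : ℝ≥0∞) ^ p x) γ Q
        ≤ ∑ Q ∈ F, c * (μ Q * powMean μ (fun x => ((α Q ^ t : ℝ≥0) : ℝ≥0∞) ^ p x) γ Q) := by
          refine Finset.sum_le_sum fun Q hQ => ?_
          rw [mul_left_comm, ← powMean_const_mul ENNReal.coe_ne_top _ hγ0]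
          gcongr
          exact powMean_mono (hc Q hQ) hγ0.le Q
      _ ≤ C * c := by
          rw [← Finset.mul_sum, mul_comm]
          gcongr
          exact hRH' t ht
  have hfactor : ∀ t : ℝ, 0 ≤ t → ∀ Q ∈ F, ∀ x, (α Q : ℝ≥0∞) ^ p x =
      ((α Q : ℝ≥0∞) ^ (1 - t)) ^ p x * ((α Q ^ t : ℝ≥0) : ℝ≥0∞) ^ p x := by
    intro t ht Q hQ x
    have h0 : (α Q : ℝ≥0∞) ≠ 0 := by exact_mod_cast hα Q hQ
    rw [ENNReal.coe_rpow_of_nonneg _ ht, ← ENNReal.rpow_mul, ← ENNReal.rpow_mul,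
      ← ENNReal.rpow_add _ _ h0 ENNReal.coe_ne_top]
    congr 1
    ring
  have hδp : ∀ s : ℝ, min (1 - l) (ν - 1) ≤ s → ∀ x,
      ((δ : ℝ≥0∞) ^ s) ^ p x ≤ ((δ ^ min (1 - l) (ν - 1) : ℝ≥0) : ℝ≥0∞) := by
    intro s hs x
    have hm0 : 0 < min (1 - l) (ν - 1) := lt_min (by linarith) (by linarith)
    have hδ1 : (δ : ℝ≥0∞) ≤ 1 := by exact_mod_cast hδ
    rw [ENNReal.coe_rpow_of_nonneg _ hm0.le, ← ENNReal.rpow_mul]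
    refine ENNReal.rpow_le_rpow_of_exponent_ge hδ1 (hs.trans ?_)
    nlinarith [h1 x, hm0.trans_le hs]
  rw [← ENNReal.coe_rpow_of_nonneg _ (lt_min (by linarith) (by linarith)).le]
  rcases hδα with hδα | hδα
  · refine hfin l ⟨le_rfl, hl1.le.trans hν1.le⟩ _ fun Q hQ x => ?_
    rw [hfactor l hl0.le Q hQ x]
    refine mul_le_mul_left (le_trans ?_ (hδp (1 - l) (min_le_left _ _) x)) _
    refine ENNReal.rpow_le_rpow (ENNReal.rpow_le_rpow ?_ (by linarith)) (hp0 x)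
    exact_mod_cast hδα Q hQ
  · refine hfin ν ⟨hl1.le.trans hν1.le, le_rfl⟩ _ fun Q hQ x => ?_
    rw [hfactor ν (by linarith) Q hQ x]
    refine mul_le_mul_left (le_trans ?_ (hδp (ν - 1) (min_le_right _ _) x)) _
    refine ENNReal.rpow_le_rpow ?_ (hp0 x)
    rw [show 1 - ν = -(ν - 1) by ring, ENNReal.rpow_neg, ← ENNReal.inv_rpow,
      ← ENNReal.coe_inv (hα Q hQ)]
    refine ENNReal.rpow_le_rpow ?_ (by linarith)
    exact_mod_cast hδα Q hQ

end BadCubes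

end

section

section SparseFamilies

variable {X : Type*}

/-- The union of the members of `S` strictly contained in `Q`. -/
def below (S : Finset (Set X)) (Q : Set X) : Set X := ⋃₀ {Q' | Q' ∈ S ∧ Q' ⊂ Q}

/-- The part of `Q` not covered by smaller members of `S`. -/
def core (S : Finset (Set X)) (Q : Set X) : Set X := Q \ below S Q

/-- The members of `S` strictly contained in `Q` and containing `x`. -/
def tower (S : Finset (Set X)) (Q : Set X) (x : X) : Finset (Set X) :=
  @Finset.filter _ (fun Q' => Q' ⊂ Q ∧ x ∈ Q') (Classical.decPred _) S

theorem mem_tower {S : Finset (Set X)} {Q Q' : Set X} {x : X} :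
    Q' ∈ tower S Q x ↔ Q' ∈ S ∧ Q' ⊂ Q ∧ x ∈ Q' :=
  @Finset.mem_filter _ _ (Classical.decPred _) _ _

theorem below_subset (S : Finset (Set X)) (Q : Set X) : below S Q ⊆ Q :=
  sUnion_subset fun _ h => h.2.subset

theorem core_subset (S : Finset (Set X)) (Q : Set X) : core S Q ⊆ Q := sdiff_subset

theorem core_subset_below {S : Finset (Set X)} {Q Q' : Set X} (h : Q' ∈ S) (h' : Q' ⊂ Q) :
    core S Q' ⊆ below S Q := (core_subset S Q').trans (subset_sUnion_of_mem ⟨h, h'⟩)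

theorem pairwiseDisjoint_core {S : Finset (Set X)}
    (h : ∀ Q ∈ S, ∀ R ∈ S, Q ⊆ R ∨ R ⊆ Q ∨ Disjoint Q R) :
    (S : Set (Set X)).PairwiseDisjoint (core S) := by
  have key : ∀ Q ∈ S, ∀ R ∈ S, Q ≠ R → Q ⊆ R → Disjoint (core S Q) (core S R) := by
    intro Q hQ R hR hne hQR
    exact (disjoint_sdiff_right (s := below S R) (t := R)).mono_left
      (core_subset_below hQ (hQR.ssubset_of_ne hne))
  intro Q hQ R hR hne
  rcases h Q hQ R hR with h' | h' | h'
  · exact key Q hQ R hR hne h'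
  · exact (key R hR Q hQ hne.symm h').symm
  · exact h'.mono (core_subset S Q) (core_subset S R)

theorem add_rpow_le_two_rpow_mul {p P : ℝ} (h0 : 0 ≤ p) (hP : p ≤ P) (u v : ℝ≥0∞) :
    (u + v) ^ p ≤ 2 ^ P * (u ^ p + v ^ p) := by
  wlog h : u ≤ v generalizing u v
  · rw [add_comm u, add_comm (u ^ p)]
    exact this v u (le_of_not_ge h)
  calc (u + v) ^ p ≤ (2 * v) ^ p := by
        refine ENNReal.rpow_le_rpow ?_ h0
        rw [two_mul]; gcongr
    _ = 2 ^ p * v ^ p := ENNReal.mul_rpow_of_nonneg _ _ h0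
    _ ≤ 2 ^ P * (u ^ p + v ^ p) := by
        gcongr
        · norm_num
        · exact le_add_self

/-- A weighted power-sum bound along a chain of sets. -/
theorem sum_rpow_le_of_chain {p P : ℝ} (h0 : 0 < p) (hP : p ≤ P) (T : Finset (Set X))
    (hT : ∀ Q ∈ T, ∀ R ∈ T, Q ⊆ R ∨ R ⊆ Q) (x : X) (hx : ∀ Q ∈ T, x ∈ Q) (α : Set X → ℝ≥0∞) :
    (∑ Q ∈ T, α Q) ^ p ≤ 2 ^ P * ∑ Q ∈ T, (2 ^ P) ^ (tower T Q x).card * α Q ^ p := by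
  classical
  induction hn : T.card generalizing T with
  | zero => simp [Finset.card_eq_zero.1 hn, h0]
  | succ n ih =>
    have hne : T.Nonempty := by rw [← Finset.card_pos]; omega
    obtain ⟨Q₀, hQ₀, hmin⟩ := T.exists_minimal hne
    have hlt : ∀ Q ∈ T.erase Q₀, Q₀ ⊂ Q := by
      intro Q hQ
      rw [Finset.mem_erase] at hQ
      refine LE.le.ssubset_of_ne ?_ hQ.1.symm
      rcases hT Q₀ hQ₀ Q hQ.2 with h | h
      · exact h
      · exact hmin hQ.2 h
    have ih' := ih (T.erase Q₀) (fun Q hQ R hR => hT Q (Finset.mem_of_mem_erase hQ) R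
      (Finset.mem_of_mem_erase hR)) (fun Q hQ => hx Q (Finset.mem_of_mem_erase hQ))
      (by rw [Finset.card_erase_of_mem hQ₀]; omega)
    rw [← Finset.add_sum_erase T _ hQ₀, ← Finset.add_sum_erase T _ hQ₀]
    refine (add_rpow_le_two_rpow_mul h0.le hP _ _).trans ?_
    gcongr
    · refine le_mul_of_one_le_left' (one_le_pow₀ (ENNReal.one_le_rpow (by norm_num) (by linarith)))
    · refine ih'.trans ?_
      rw [Finset.mul_sum]
      refine Finset.sum_le_sum fun Q hQ => ?_
      rw [← mul_assoc, ← pow_succ']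
      refine mul_le_mul_left (pow_le_pow_right₀
        (ENNReal.one_le_rpow (by norm_num) (by linarith)) ?_) _
      have hnot : Q₀ ∉ tower (T.erase Q₀) Q x := fun h => by
        simpa using (mem_tower.1 h).1
      rw [← Finset.card_insert_of_notMem hnot]
      refine Finset.card_le_card fun R hR => ?_
      rw [Finset.mem_insert] at hR
      rcases hR with rfl | hR
      · exact mem_tower.2 ⟨hQ₀, hlt Q hQ, hx _ hQ₀⟩
      · rw [mem_tower] at hR ⊢
        exact ⟨Finset.mem_of_mem_erase hR.1, hR.2⟩

theorem measurable_pow_card_tower [MeasurableSpace X] {S : Finset (Set X)}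
    (hS : ∀ Q ∈ S, MeasurableSet Q) (c : ℝ≥0∞) (Q : Set X) :
    Measurable fun x => c ^ (tower S Q x).card := by
  classical
  have h : Measurable fun x => (tower S Q x).card := by
    have : (fun x => (tower S Q x).card) = fun x => ∑ Q' ∈ S with Q' ⊂ Q,
        if x ∈ Q' then 1 else 0 := by
      ext x
      rw [← Finset.card_filter, Finset.filter_filter]
      congr 1
      ext R
      rw [mem_tower, Finset.mem_filter]
    rw [this]
    refine Finset.measurable_fun_sum _ fun R hR => ?_
    exact Measurable.ite (hS R (Finset.mem_filter.1 hR).1) measurable_const measurable_const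
  exact (measurable_of_countable (fun n : ℕ => c ^ n)).comp h

/-- Summing the tower weight over the members of `S` inside `Q`. -/
theorem sum_indicator_pow_card_tower_le {S : Finset (Set X)} {c : ℝ≥0∞} (hc : 1 ≤ c) {Q : Set X}
    (F : Finset (Set X)) (hF : ∀ R ∈ F, R ∈ S ∧ R ⊆ Q) (x : X) :
    ∑ R ∈ F, R.indicator (fun x => c ^ (tower S R x).card) x ≤ (2 * c) ^ (tower S Q x).card := by
  classical
  have h1 : ∀ R ∈ F, R.indicator (fun x => c ^ (tower S R x).card) x ≤
      if x ∈ R then c ^ (tower S Q x).card else 0 := by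
    intro R hR
    by_cases hx : x ∈ R
    · rw [indicator_of_mem hx, if_pos hx]
      refine pow_le_pow_right₀ hc (Finset.card_le_card fun T hT => ?_)
      rw [mem_tower] at hT ⊢
      exact ⟨hT.1, hT.2.1.trans_subset (hF R hR).2, hT.2.2⟩
    · simp [hx]
  refine (Finset.sum_le_sum h1).trans ?_
  rw [← Finset.sum_filter, Finset.sum_const, nsmul_eq_mul, mul_pow]
  gcongr
  have h2 : (F.filter (x ∈ ·)) ⊆ insert Q (tower S Q x) := by
    intro R hR
    rw [Finset.mem_filter] at hR
    rw [Finset.mem_insert, mem_tower]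
    by_cases h : R = Q
    · exact Or.inl h
    · exact Or.inr ⟨(hF R hR.1).1, (hF R hR.1).2.ssubset_of_ne h, hR.2⟩
  have h3 := (Finset.card_le_card h2).trans (Finset.card_insert_le _ _)
  have h4 : (F.filter (x ∈ ·)).card ≤ 2 ^ (tower S Q x).card :=
    h3.trans (Nat.lt_two_pow_self)
  exact_mod_cast h4

/-- Recursion for the tower weight. -/
theorem pow_card_tower_le {S : Finset (Set X)}
    (hS : ∀ Q ∈ S, ∀ R ∈ S, Q ⊆ R ∨ R ⊆ Q ∨ Disjoint Q R) (c : ℝ≥0∞) (Q : Set X) (x : X)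
    [DecidablePred fun R : Set X => R ⊂ Q] :
    c ^ (tower S Q x).card ≤
      1 + ∑ R ∈ S with R ⊂ Q, R.indicator (fun x => c * c ^ (tower S R x).card) x := by
  classical
  rcases (tower S Q x).eq_empty_or_nonempty with h | h
  · simp [h]
  · obtain ⟨R, hR, hmax⟩ := (tower S Q x).exists_maximal h
    have hR' := mem_tower.1 hR
    have hsub : tower S Q x ⊆ insert R (tower S R x) := by
      intro T hT
      have hT' := mem_tower.1 hT
      rw [Finset.mem_insert, mem_tower]
      rcases eq_or_ne T R with h | hne
      · exact Or.inl h
      refine Or.inr ⟨hT'.1, LE.le.ssubset_of_ne ?_ hne, hT'.2.2⟩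
      rcases hS T hT'.1 R hR'.1 with h | h | h
      · exact h
      · exact hmax hT h
      · exact absurd hR'.2.2 (disjoint_left.1 h hT'.2.2)
    have hsub' : insert R (tower S R x) ⊆ tower S Q x := by
      refine Finset.insert_subset hR fun T hT => ?_
      rw [mem_tower] at hT ⊢
      exact ⟨hT.1, hT.2.1.trans hR'.2.1, hT.2.2⟩
    have hcard : (tower S Q x).card = (tower S R x).card + 1 := by
      rw [hsub.antisymm hsub', Finset.card_insert_of_notMem]
      exact fun h => (mem_tower.1 h).2.1.ne rfl
    rw [hcard, pow_succ']
    refine le_add_left ?_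
    refine le_trans ?_ (Finset.single_le_sum (fun _ _ => zero_le)
      (Finset.mem_filter.2 ⟨hR'.1, hR'.2.1⟩))
    rw [indicator_of_mem hR'.2.2]

end SparseFamilies

section SparseEstimates

variable {X : Type*} [MeasurableSpace X] {μ : Measure X} {D : ℝ≥0} {𝓓 : Set (Set X)}
  {S : Finset (Set X)}

theorem IsGrid.measurableSet_below (hD : IsGrid μ D 𝓓) (hS : ∀ Q ∈ S, Q ∈ 𝓓) (Q : Set X) :
    MeasurableSet (below S Q) := hD.measurableSet_sUnion fun R hR => hS R hR.1

theorem IsGrid.measurableSet_core (hD : IsGrid μ D 𝓓) (hS : ∀ Q ∈ S, Q ∈ 𝓓) {Q : Set X}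
    (hQ : Q ∈ S) : MeasurableSet (core S Q) :=
  (hD.measurableSet Q (hS Q hQ)).diff (hD.measurableSet_below hS Q)

theorem IsGrid.measure_le_two_mul_core (hD : IsGrid μ D 𝓓) (hS : ∀ Q ∈ S, Q ∈ 𝓓) {Q : Set X}
    (hQ : Q ∈ S) (hsp : 2 * μ (below S Q) ≤ μ Q) : μ Q ≤ 2 * μ (core S Q) := by
  have h1 : μ (below S Q) + μ (core S Q) = μ Q := by
    rw [core, ← measure_inter_add_sdiff Q (hD.measurableSet_below hS Q),
      inter_eq_right.2 (below_subset S Q)]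
  have ht := hD.measure_ne_top Q (hS Q hQ)
  refine (ENNReal.add_le_add_iff_left ht).1 ?_
  calc μ Q + μ Q = 2 * μ (below S Q) + 2 * μ (core S Q) := by rw [← mul_add, h1, two_mul]
    _ ≤ _ := by gcongr

theorem IsGrid.sum_measure_le_two_mul_below (hD : IsGrid μ D 𝓓) (hS : ∀ Q ∈ S, Q ∈ 𝓓)
    (hsp : ∀ Q ∈ S, 2 * μ (below S Q) ≤ μ Q) (Q : Set X) [DecidablePred fun R : Set X => R ⊂ Q] :
    ∑ R ∈ S with R ⊂ Q, μ R ≤ 2 * μ (below S Q) := by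
  have hdis := pairwiseDisjoint_core fun Q hQ R hR => hD.nested Q (hS Q hQ) R (hS R hR)
  calc ∑ R ∈ S with R ⊂ Q, μ R ≤ ∑ R ∈ S with R ⊂ Q, 2 * μ (core S R) :=
        Finset.sum_le_sum fun R hR => by
          have hR' := (Finset.mem_filter.1 hR).1
          exact hD.measure_le_two_mul_core hS hR' (hsp R hR')
    _ = 2 * μ (⋃ R ∈ S.filter (· ⊂ Q), core S R) := by
        rw [← Finset.mul_sum, measure_biUnion_finset]
        · exact hdis.subset fun R hR => (Finset.mem_filter.1 hR).1
        · exact fun R hR => hD.measurableSet_core hS (Finset.mem_filter.1 hR).1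
    _ ≤ 2 * μ (below S Q) := by
        gcongr
        refine iUnion₂_subset fun R hR => ?_
        rw [Finset.mem_filter] at hR
        exact core_subset_below hR.1 hR.2

/-- The tower weight has bounded averages over a sufficiently sparse family. -/
theorem IsGrid.lintegral_pow_card_tower_le (hD : IsGrid μ D 𝓓) (hS : ∀ Q ∈ S, Q ∈ 𝓓)
    {c : ℝ≥0∞} (hc : 1 ≤ c) (hsp : ∀ Q ∈ S, 4 * c * μ (below S Q) ≤ μ Q) {Q : Set X}
    (hQ : Q ∈ S) : ∫⁻ x in Q, c ^ (tower S Q x).card ∂μ ≤ 2 * μ Q := by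
  classical
  have hnest : ∀ Q ∈ S, ∀ R ∈ S, Q ⊆ R ∨ R ⊆ Q ∨ Disjoint Q R :=
    fun Q hQ R hR => hD.nested Q (hS Q hQ) R (hS R hR)
  have hSm : ∀ Q ∈ S, MeasurableSet Q := fun Q hQ => hD.measurableSet Q (hS Q hQ)
  have hsp2 : ∀ Q ∈ S, 2 * μ (below S Q) ≤ μ Q := fun Q hQ => le_trans (by
    gcongr
    calc (2 : ℝ≥0∞) ≤ 4 * 1 := by norm_num
      _ ≤ _ := by gcongr) (hsp Q hQ)
  suffices H : ∀ n, ∀ Q ∈ S, (S.filter (· ⊂ Q)).card = n →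
      ∫⁻ x in Q, c ^ (tower S Q x).card ∂μ ≤ 2 * μ Q from H _ Q hQ rfl
  intro n
  induction n using Nat.strong_induction_on with
  | _ n ih =>
  intro Q hQ hn
  calc ∫⁻ x in Q, c ^ (tower S Q x).card ∂μ
      ≤ ∫⁻ x in Q, (1 + ∑ R ∈ S with R ⊂ Q,
          R.indicator (fun x => c * c ^ (tower S R x).card) x) ∂μ :=
        lintegral_mono fun x => pow_card_tower_le hnest c Q x
    _ = μ Q + ∑ R ∈ S with R ⊂ Q,
          ∫⁻ x in Q, R.indicator (fun x => c * c ^ (tower S R x).card) x ∂μ := by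
        rw [lintegral_add_left measurable_const, lintegral_finsetSum]
        · simp
        · intro R hR
          exact ((measurable_pow_card_tower hSm c R).const_mul c).indicator
            (hSm R (Finset.mem_filter.1 hR).1)
    _ ≤ μ Q + ∑ R ∈ S with R ⊂ Q, c * (2 * μ R) := by
        gcongr with R hR
        rw [Finset.mem_filter] at hR
        calc ∫⁻ x in Q, R.indicator (fun x => c * c ^ (tower S R x).card) x ∂μ
            ≤ ∫⁻ x, R.indicator (fun x => c * c ^ (tower S R x).card) x ∂μ :=
              setLIntegral_le_lintegral _ _
          _ = c * ∫⁻ x in R, c ^ (tower S R x).card ∂μ := by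
              rw [lintegral_indicator (hSm R hR.1),
                lintegral_const_mul _ (measurable_pow_card_tower hSm c R)]
          _ ≤ _ := by
              gcongr
              refine ih _ ?_ R hR.1 rfl
              rw [← hn]
              refine Finset.card_lt_card (Finset.ssubset_iff_subset_ne.2 ⟨fun T hT => ?_, ?_⟩)
              · rw [Finset.mem_filter] at hT ⊢
                exact ⟨hT.1, hT.2.trans hR.2⟩
              · intro heq
                have : R ∈ S.filter (· ⊂ R) := by
                  rw [heq]; exact Finset.mem_filter.2 hR
                exact (Finset.mem_filter.1 this).2.ne rfl
    _ = μ Q + 2 * c * ∑ R ∈ S with R ⊂ Q, μ R := by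
        rw [← Finset.mul_sum, ← Finset.mul_sum]; ring
    _ ≤ μ Q + 2 * c * (2 * μ (below S Q)) := by
        gcongr
        exact hD.sum_measure_le_two_mul_below hS hsp2 Q
    _ = μ Q + 4 * c * μ (below S Q) := by ring
    _ ≤ μ Q + μ Q := by gcongr; exact hsp Q hQ
    _ = 2 * μ Q := (two_mul _).symm

/-- Hölder's inequality on `Q` against a weight with controlled conjugate power mean. -/
theorem IsGrid.lintegral_mul_le_powMean (hD : IsGrid μ D 𝓓) {Q : Set X} (hQ : Q ∈ 𝓓)
    {v w : X → ℝ≥0∞} (hv : Measurable v) (hw : Measurable w) {γ γ' : ℝ}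
    (hγ : γ.HolderConjugate γ') :
    ∫⁻ x in Q, v x * w x ∂μ ≤ avgOn μ (fun x => v x ^ γ') Q ^ (1 / γ') *
      (μ Q * powMean μ w γ Q) := by
  have h0 : 0 < γ := hγ.pos
  have h0' : 0 < γ' := hγ.symm.pos
  have h := avgOn_rpow_mul_rpow_le (μ := μ) (hv.pow_const γ') (hw.pow_const γ) (a := 1 / γ')
    (b := 1 / γ) (by positivity) (by positivity)
    (by simpa [one_div] using hγ.symm.inv_add_inv_eq_one) Q
  have h2 : (fun x => (v x ^ γ') ^ (1 / γ') * (w x ^ γ) ^ (1 / γ)) = fun x => v x * w x := by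
    ext x
    rw [← ENNReal.rpow_mul, ← ENNReal.rpow_mul, mul_one_div_cancel h0.ne',
      mul_one_div_cancel h0'.ne', ENNReal.rpow_one, ENNReal.rpow_one]
  rw [h2] at h
  rw [← measure_mul_avgOn (hD.measure_ne_zero Q hQ) (hD.measure_ne_top Q hQ), mul_left_comm]
  gcongr
  exact h

end SparseEstimates

end

section

section SparseModular

variable {X : Type*} [MeasurableSpace X] {μ : Measure X} {D : ℝ≥0} {𝓓 : Set (Set X)}
  {S : Finset (Set X)} {p : X → ℝ} {P : ℝ} {C₀ : ℝ≥0}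

theorem IsGrid.lintegral_pow_card_tower_mul_le (hD : IsGrid μ D 𝓓) (hS : ∀ Q ∈ S, Q ∈ 𝓓)
    {c : ℝ≥0∞} (hc : 1 ≤ c) {γ γ' : ℝ} (hγ : γ.HolderConjugate γ')
    (hsp : ∀ Q ∈ S, 4 * c ^ γ' * μ (below S Q) ≤ μ Q) {Q : Set X} (hQ : Q ∈ S) {w : X → ℝ≥0∞}
    (hw : Measurable w) :
    ∫⁻ x in Q, c ^ (tower S Q x).card * w x ∂μ ≤ 2 * (μ Q * powMean μ w γ Q) := by
  have hγ' := hγ.symm.pos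
  have hSm : ∀ Q ∈ S, MeasurableSet Q := fun Q hQ => hD.measurableSet Q (hS Q hQ)
  refine (hD.lintegral_mul_le_powMean (hS Q hQ) (measurable_pow_card_tower hSm c Q) hw hγ).trans ?_
  gcongr
  have h1 : (fun x => (c ^ (tower S Q x).card) ^ γ') = fun x => (c ^ γ') ^ (tower S Q x).card := by
    ext x
    rw [← ENNReal.rpow_natCast, ← ENNReal.rpow_mul, ← ENNReal.rpow_natCast, ← ENNReal.rpow_mul,
      mul_comm]
  have h2 : avgOn μ (fun x => (c ^ γ') ^ (tower S Q x).card) Q ≤ 2 := by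
    have hc' : 1 ≤ c ^ γ' := ENNReal.one_le_rpow hc hγ'
    have := hD.lintegral_pow_card_tower_le hS hc' hsp hQ
    rw [← measure_mul_avgOn (hD.measure_ne_zero Q (hS Q hQ)) (hD.measure_ne_top Q (hS Q hQ)),
      mul_comm 2] at this
    exact (ENNReal.mul_le_mul_iff_right (hD.measure_ne_zero Q (hS Q hQ))
      (hD.measure_ne_top Q (hS Q hQ))).1 this
  rw [h1]
  calc _ ≤ (2 : ℝ≥0∞) ^ (1 / γ') := ENNReal.rpow_le_rpow h2 (by positivity)
    _ ≤ 2 ^ (1 : ℝ) := by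
      refine ENNReal.rpow_le_rpow_of_exponent_le (by norm_num) ?_
      rw [div_le_one hγ']; exact hγ.symm.lt.le
    _ = 2 := ENNReal.rpow_one 2

/-- A family of comparable coefficients is dominated by its maximal members. -/
theorem IsGrid.sum_tower_le_sum_maxElems (hD : IsGrid μ D 𝓓) (hS : ∀ Q ∈ S, Q ∈ 𝓓)
    (hpm : Measurable p) (hp0 : ∀ x, 0 ≤ p x) (hP : ∀ x, p x ≤ P)
    {c : ℝ≥0∞} (hc : 1 ≤ c) {γ γ' : ℝ} (hγ : γ.HolderConjugate γ')
    (hsp : ∀ Q ∈ S, 4 * (2 * c) ^ γ' * μ (below S Q) ≤ μ Q) {T : Finset (Set X)} (hT : T ⊆ S)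
    {α : Set X → ℝ≥0} (hα : ∀ Q ∈ T, ∀ R ∈ T, α Q ≤ 2 * α R) :
    ∑ Q ∈ T, ∫⁻ x in Q, c ^ (tower S Q x).card * (α Q : ℝ≥0∞) ^ p x ∂μ ≤
      2 ^ P * 2 * ∑ Q ∈ maxElems T, μ Q * powMean μ (fun x => (α Q : ℝ≥0∞) ^ p x) γ Q := by
  classical
  have hSm : ∀ Q ∈ S, MeasurableSet Q := fun Q hQ => hD.measurableSet Q (hS Q hQ)
  have hwm : ∀ a : ℝ≥0, Measurable fun x => (a : ℝ≥0∞) ^ p x := fun a => by fun_prop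
  have h2c : 1 ≤ 2 * c := hc.trans (by rw [two_mul]; exact le_self_add)
  choose! m hm hQm using fun Q (hQ : Q ∈ T) => exists_mem_maxElems hQ
  rw [← Finset.sum_fiberwise_of_maps_to hm, Finset.mul_sum]
  refine Finset.sum_le_sum fun R hR => ?_
  have hRT := maxElems_subset T hR
  calc ∑ Q ∈ T with m Q = R, ∫⁻ x in Q, c ^ (tower S Q x).card * (α Q : ℝ≥0∞) ^ p x ∂μ
      ≤ ∑ Q ∈ T with m Q = R, 2 ^ P * ∫⁻ x in R,
          Q.indicator (fun x => c ^ (tower S Q x).card) x * (α R : ℝ≥0∞) ^ p x ∂μ := by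
        refine Finset.sum_le_sum fun Q hQ => ?_
        rw [Finset.mem_filter] at hQ
        have hQR : Q ⊆ R := hQ.2 ▸ hQm Q hQ.1
        calc ∫⁻ x in Q, c ^ (tower S Q x).card * (α Q : ℝ≥0∞) ^ p x ∂μ
            ≤ ∫⁻ x in Q, 2 ^ P * (Q.indicator (fun x => c ^ (tower S Q x).card) x *
                (α R : ℝ≥0∞) ^ p x) ∂μ := by
              refine setLIntegral_mono' (hSm Q (hT hQ.1)) fun x hx => ?_
              rw [indicator_of_mem hx, mul_left_comm]
              gcongr
              calc (α Q : ℝ≥0∞) ^ p x ≤ (2 * α R) ^ p x := by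
                    refine ENNReal.rpow_le_rpow ?_ (hp0 x)
                    exact_mod_cast hα Q hQ.1 R hRT
                _ = 2 ^ p x * (α R : ℝ≥0∞) ^ p x := ENNReal.mul_rpow_of_nonneg _ _ (hp0 x)
                _ ≤ _ := by
                    gcongr
                    · norm_num
                    · exact hP x
          _ ≤ ∫⁻ x in R, 2 ^ P * (Q.indicator (fun x => c ^ (tower S Q x).card) x *
                (α R : ℝ≥0∞) ^ p x) ∂μ := lintegral_mono_set hQR
          _ = _ := by
              have hmm : Measurable fun x =>
                  Q.indicator (fun x => c ^ (tower S Q x).card) x * (α R : ℝ≥0∞) ^ p x :=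
                ((measurable_pow_card_tower hSm c Q).indicator (hSm Q (hT hQ.1))).mul (hwm _)
              rw [lintegral_const_mul _ hmm]
    _ = 2 ^ P * ∫⁻ x in R, (∑ Q ∈ T with m Q = R,
          Q.indicator (fun x => c ^ (tower S Q x).card) x) * (α R : ℝ≥0∞) ^ p x ∂μ := by
        rw [← Finset.mul_sum, ← lintegral_finsetSum]
        · simp_rw [Finset.sum_mul]
        · intro Q hQ
          rw [Finset.mem_filter] at hQ
          exact ((measurable_pow_card_tower hSm c Q).indicator (hSm Q (hT hQ.1))).mul (hwm _)
    _ ≤ 2 ^ P * ∫⁻ x in R, (2 * c) ^ (tower S R x).card * (α R : ℝ≥0∞) ^ p x ∂μ := by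
        gcongr with x
        refine sum_indicator_pow_card_tower_le hc _ (fun Q hQ => ?_) x
        rw [Finset.mem_filter] at hQ
        exact ⟨hT hQ.1, hQ.2 ▸ hQm Q hQ.1⟩
    _ ≤ 2 ^ P * (2 * (μ R * powMean μ (fun x => (α R : ℝ≥0∞) ^ p x) γ R)) := by
        gcongr
        exact hD.lintegral_pow_card_tower_mul_le hS h2c hγ hsp (hT hRT) (hwm _)
    _ = _ := by ring

/-- The core of a sparse cube carries half of it, so a step function is controlled by the maximal
function of its restriction to the cores. -/
theorem IsGrid.stepFun_le_gridMax (hD : IsGrid μ D 𝓓) (hS : ∀ Q ∈ S, Q ∈ 𝓓)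
    (hsp : ∀ Q ∈ S, 2 * μ (below S Q) ≤ μ Q) {M : Finset (Set X)} (hM : M ⊆ S)
    (hdis : (M : Set (Set X)).PairwiseDisjoint id) (α : Set X → ℝ≥0∞) {x : X}
    (hx : x ∈ ⋃ Q ∈ M, Q) :
    stepFun M α x ≤ 2 * gridMax μ 𝓓 ((⋃ Q ∈ M, core S Q).indicator (stepFun M α)) x := by
  simp only [mem_iUnion] at hx
  obtain ⟨Q, hQ, hx⟩ := hx
  have hQ' := hS Q (hM hQ)
  have hμ0 := hD.measure_ne_zero Q hQ'
  have hμt := hD.measure_ne_top Q hQ'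
  rw [stepFun_eq hdis α hQ hx]
  refine le_trans ?_ (mul_le_mul_right (avgOn_le_gridMax hQ' hx _) _)
  rw [← ENNReal.mul_le_mul_iff_right hμ0 hμt, mul_left_comm, measure_mul_avgOn hμ0 hμt]
  calc μ Q * α Q ≤ 2 * μ (core S Q) * α Q := by
        gcongr
        exact hD.measure_le_two_mul_core hS (hM hQ) (hsp Q (hM hQ))
    _ = 2 * ∫⁻ x in core S Q, α Q ∂μ := by rw [setLIntegral_const]; ring
    _ ≤ 2 * ∫⁻ x in core S Q, (⋃ Q ∈ M, core S Q).indicator (stepFun M α) x ∂μ := by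
        refine mul_le_mul_right (setLIntegral_mono' (hD.measurableSet_core hS (hM hQ)) ?_) _
        intro y hy
        have hyM : y ∈ ⋃ Q ∈ M, core S Q := mem_iUnion₂.2 ⟨Q, hQ, hy⟩
        rw [indicator_of_mem hyM, stepFun_eq hdis α hQ (core_subset S Q hy)]
    _ ≤ _ := mul_le_mul_right (lintegral_mono_set (core_subset S Q)) _

theorem lintegral_biUnion_stepFun {M : Finset (Set X)}
    (hdis : (M : Set (Set X)).PairwiseDisjoint id) (α : Set X → ℝ≥0∞) {E : Set X → Set X}
    (hE : ∀ Q, E Q ⊆ Q) (hEm : ∀ Q ∈ M, MeasurableSet (E Q)) :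
    ∫⁻ x in ⋃ Q ∈ M, E Q, stepFun M α x ^ p x ∂μ = ∑ Q ∈ M, ∫⁻ x in E Q, α Q ^ p x ∂μ := by
  rw [lintegral_biUnion_finset (hdis.mono_on fun Q _ => hE Q) hEm]
  refine Finset.sum_congr rfl fun Q hQ => setLIntegral_congr_fun (hEm Q hQ) fun x hx => ?_
  simp only [stepFun_eq hdis α hQ (hE Q hx)]

theorem IsGrid.lintegral_sum_rpow_le (hD : IsGrid μ D 𝓓) (hS : ∀ Q ∈ S, Q ∈ 𝓓)
    (hpm : Measurable p) (hp0 : ∀ x, 0 < p x) (hP : ∀ x, p x ≤ P) (α : Set X → ℝ≥0∞) :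
    ∫⁻ x, (∑ Q ∈ S, Q.indicator (fun _ => α Q) x) ^ p x ∂μ ≤
      2 ^ P * ∑ Q ∈ S, ∫⁻ x in Q, (2 ^ P) ^ (tower S Q x).card * α Q ^ p x ∂μ := by
  classical
  have hSm : ∀ Q ∈ S, MeasurableSet Q := fun Q hQ => hD.measurableSet Q (hS Q hQ)
  have hm : ∀ Q ∈ S, Measurable (Q.indicator fun x =>
      ((2 : ℝ≥0∞) ^ P) ^ (tower S Q x).card * α Q ^ p x) := fun Q hQ =>
    ((measurable_pow_card_tower hSm _ Q).mul (by fun_prop)).indicator (hSm Q hQ)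
  calc ∫⁻ x, (∑ Q ∈ S, Q.indicator (fun _ => α Q) x) ^ p x ∂μ
      ≤ ∫⁻ x, 2 ^ P * ∑ Q ∈ S, Q.indicator (fun x =>
          ((2 : ℝ≥0∞) ^ P) ^ (tower S Q x).card * α Q ^ p x) x ∂μ := by
        refine lintegral_mono fun x => ?_
        have hsum : ∀ g : Set X → ℝ≥0∞, ∑ Q ∈ S, Q.indicator (fun _ => g Q) x =
            ∑ Q ∈ S with x ∈ Q, g Q := fun g => by
          rw [Finset.sum_filter]
          exact Finset.sum_congr rfl fun Q _ => indicator_apply ..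
        have hsum' : ∑ Q ∈ S, Q.indicator (fun x =>
            ((2 : ℝ≥0∞) ^ P) ^ (tower S Q x).card * α Q ^ p x) x =
            ∑ Q ∈ S with x ∈ Q, ((2 : ℝ≥0∞) ^ P) ^ (tower S Q x).card * α Q ^ p x := by
          rw [Finset.sum_filter]
          exact Finset.sum_congr rfl fun Q _ => indicator_apply ..
        simp only [hsum, hsum']
        refine (sum_rpow_le_of_chain (hp0 x) (hP x) _ ?_ x
          (fun Q hQ => (Finset.mem_filter.1 hQ).2) α).trans ?_
        · intro Q hQ R hR
          rw [Finset.mem_filter] at hQ hR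
          rcases hD.nested Q (hS Q hQ.1) R (hS R hR.1) with h | h | h
          · exact Or.inl h
          · exact Or.inr h
          · exact absurd hR.2 (disjoint_left.1 h hQ.2)
        · gcongr with Q hQ
          · exact ENNReal.one_le_rpow (by norm_num) ((hp0 x).trans_le (hP x))
          · intro R hR
            rw [mem_tower] at hR ⊢
            exact ⟨(Finset.mem_filter.1 hR.1).1, hR.2⟩
    _ = _ := by
        rw [lintegral_const_mul _ (Finset.measurable_fun_sum _ hm), lintegral_finsetSum _ hm]
        congr 1
        exact Finset.sum_congr rfl fun Q hQ => lintegral_indicator (hSm Q hQ) _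

end SparseModular

end

section

section SparseBound

variable {X : Type*} [MeasurableSpace X] {μ : Measure X} {D : ℝ≥0} {𝓓 : Set (Set X)}
  {S : Finset (Set X)} {p : X → ℝ} {P : ℝ} {C₀ : ℝ≥0}

/-- Cubes failing the reverse Hölder inequality contribute a summable amount. -/
theorem GridBounded.exists_sum_tower_le_of_bad (H : GridBounded μ 𝓓 p C₀) (hD : IsGrid μ D 𝓓)
    (hpm : Measurable p) (h1 : ∀ x, 1 ≤ p x) (hP : ∀ x, p x ≤ P) (hP1 : 1 ≤ P) :
    ∃ γ : ℝ, 1 < γ ∧ ∃ K η C : ℝ≥0, 1 ≤ K ∧ 0 < η ∧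
      ∀ (γ' : ℝ) (c : ℝ≥0∞) (S T : Finset (Set X)) (α : Set X → ℝ≥0) (k : Set X → ℕ),
      γ.HolderConjugate γ' → 1 ≤ c → (∀ Q ∈ S, Q ∈ 𝓓) →
      (∀ Q ∈ S, 4 * (2 * c) ^ γ' * μ (below S Q) ≤ μ Q) → T ⊆ S → (∀ Q ∈ T, α Q ≠ 0) →
      (∀ Q ∈ T, K * avgOn μ (fun x => (α Q : ℝ≥0∞) ^ p x) Q ≤
        powMean μ (fun x => (α Q : ℝ≥0∞) ^ p x) γ Q) →
      (∀ Q ∈ T, ∀ R ∈ T, k Q = k R → α Q ≤ 2 * α R) →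
      ((∀ Q ∈ T, α Q ≤ 2⁻¹ ^ k Q) ∨ ∀ Q ∈ T, (α Q)⁻¹ ≤ 2⁻¹ ^ k Q) →
      ∑ Q ∈ T, ∫⁻ x in core S Q, (α Q : ℝ≥0∞) ^ p x ∂μ ≤ η →
      ∑ Q ∈ T, ∫⁻ x in Q, c ^ (tower S Q x).card * (α Q : ℝ≥0∞) ^ p x ∂μ ≤ C := by
  classical
  obtain ⟨γ, hγ1, σ, hσ, K, C, hK, hbad⟩ := H.exists_bad_le hD hpm h1 hP hP1
  obtain ⟨η, hη, hmod⟩ := H.exists_modular_le_one h1 hP hP1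
  have hp0 : ∀ x, 0 ≤ p x := fun x => zero_le_one.trans (h1 x)
  set r : ℝ≥0∞ := (2⁻¹ : ℝ≥0∞) ^ σ with hr
  have hr1 : r < 1 := ENNReal.rpow_lt_one (by simp) hσ
  have hfin : (2 : ℝ≥0∞) ^ P * 2 * (C * (1 - r)⁻¹) ≠ ∞ := by
    refine ENNReal.mul_ne_top (ENNReal.mul_ne_top ?_ (by norm_num))
      (ENNReal.mul_ne_top ENNReal.coe_ne_top ?_)
    · exact ENNReal.rpow_ne_top_of_nonneg (by linarith) (by norm_num)
    · rw [Ne, ENNReal.inv_eq_top, tsub_eq_zero_iff_le, not_le]; exact hr1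
  refine ⟨γ, hγ1, K, η, ((2 : ℝ≥0∞) ^ P * 2 * (C * (1 - r)⁻¹)).toNNReal, hK, hη, ?_⟩
  intro γ' c S T α k hγ hc hS hsp hTS hα0 hTbad hcomp hsmall hle
  rw [ENNReal.coe_toNNReal hfin]
  have hsp2 : ∀ Q ∈ S, 2 * μ (below S Q) ≤ μ Q := fun Q hQ => le_trans (by
    gcongr
    calc (2 : ℝ≥0∞) ≤ 4 * 1 := by norm_num
      _ ≤ _ := by
        gcongr
        refine ENNReal.one_le_rpow (hc.trans ?_) hγ.symm.pos
        rw [two_mul]; exact le_self_add) (hsp Q hQ)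
  have level : ∀ j : ℕ, ∑ Q ∈ T with k Q = j,
      ∫⁻ x in Q, c ^ (tower S Q x).card * (α Q : ℝ≥0∞) ^ p x ∂μ ≤ 2 ^ P * 2 * (C * r ^ j) := by
    intro j
    set Tj := T.filter (k · = j) with hTj
    have hTjT : Tj ⊆ T := Finset.filter_subset _ _
    have hTjk : ∀ Q ∈ Tj, k Q = j := fun Q hQ => (Finset.mem_filter.1 hQ).2
    set M := maxElems Tj with hM
    have hMT : M ⊆ T := (maxElems_subset Tj).trans hTjT
    have hMk : ∀ Q ∈ M, k Q = j := fun Q hQ => hTjk Q (maxElems_subset Tj hQ)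
    have hMD : ∀ Q ∈ M, Q ∈ 𝓓 := fun Q hQ => hS Q (hTS (hMT hQ))
    have hdis : (M : Set (Set X)).PairwiseDisjoint id := pairwiseDisjoint_maxElems
      fun Q hQ R hR => hD.nested Q (hS Q (hTS (hTjT hQ))) R (hS R (hTS (hTjT hR)))
    refine (hD.sum_tower_le_sum_maxElems hS hpm hp0 hP hc hγ hsp (hTjT.trans hTS)
      (fun Q hQ R hR => hcomp Q (hTjT hQ) R (hTjT hR)
        ((hTjk Q hQ).trans (hTjk R hR).symm))).trans ?_
    gcongr
    have hmodM : ∑ Q ∈ M, ∫⁻ x in Q, (α Q : ℝ≥0∞) ^ p x ∂μ ≤ 1 := by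
      rw [← lintegral_biUnion_stepFun hdis (fun Q => (α Q : ℝ≥0∞)) (E := fun Q => Q)
        (fun Q => Subset.rfl) (fun Q hQ => hD.measurableSet Q (hMD Q hQ))]
      refine hmod (stepFun M fun Q => (α Q : ℝ≥0∞))
        (measurable_stepFun (fun Q hQ => hD.measurableSet Q (hMD Q hQ)) _)
        (⋃ Q ∈ M, core S Q) _
        (M.measurableSet_biUnion fun Q hQ => hD.measurableSet_core hS (hTS (hMT hQ)))
        (M.measurableSet_biUnion fun Q hQ => hD.measurableSet Q (hMD Q hQ))
        (fun x hx => hD.stepFun_le_gridMax hS hsp2 (hMT.trans hTS) hdis _ hx) ?_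
      rw [lintegral_biUnion_stepFun hdis (fun Q => (α Q : ℝ≥0∞)) (core_subset S)
        (fun Q hQ => hD.measurableSet_core hS (hTS (hMT hQ)))]
      exact (Finset.sum_le_sum_of_subset hMT).trans hle
    have hδ := hbad M hMD hdis α (fun Q hQ => hα0 Q (hMT hQ)) (fun Q hQ => hTbad Q (hMT hQ)) hmodM
      (2⁻¹ ^ j) (pow_le_one₀ (by positivity) (by
        rw [inv_le_one₀ (by norm_num)]; norm_num)) (hsmall.imp
        (fun h Q hQ => hMk Q hQ ▸ h Q (hMT hQ)) (fun h Q hQ => hMk Q hQ ▸ h Q (hMT hQ)))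
    refine hδ.trans (le_of_eq ?_)
    congr 1
    rw [hr, ← ENNReal.rpow_natCast, ← ENNReal.rpow_mul, mul_comm σ, ENNReal.rpow_mul,
      ENNReal.rpow_natCast]
    rw [ENNReal.coe_pow, ENNReal.coe_inv (by norm_num)]
    rfl
  calc _ = ∑ j ∈ T.image k, ∑ Q ∈ T with k Q = j,
        ∫⁻ x in Q, c ^ (tower S Q x).card * (α Q : ℝ≥0∞) ^ p x ∂μ :=
      (Finset.sum_fiberwise_of_maps_to (fun Q hQ => Finset.mem_image_of_mem k hQ) _).symm
    _ ≤ ∑ j ∈ T.image k, 2 ^ P * 2 * (C * r ^ j) := Finset.sum_le_sum fun j _ => level j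
    _ ≤ ∑' j, 2 ^ P * 2 * (C * r ^ j) := ENNReal.sum_le_tsum _
    _ = _ := by rw [ENNReal.tsum_mul_left, ENNReal.tsum_mul_left, ENNReal.tsum_geometric]

theorem exists_dyadic_level {a : ℝ≥0} (ha : 1 ≤ a) :
    ∃ k : ℕ, a⁻¹ ≤ 2⁻¹ ^ k ∧ a < 2 ^ (k + 1) := by
  obtain ⟨k, hk, hk'⟩ := exists_nat_pow_near ha (y := 2) (by norm_num)
  exact ⟨k, by rw [inv_pow]; exact inv_anti₀ (by positivity) hk, hk'⟩

/-- The vector-valued estimate for sparse families: the modular of a sparse sum is controlled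
once the modular over the cores is small. -/
theorem GridBounded.exists_sparse_modular_le (H : GridBounded μ 𝓓 p C₀) (hD : IsGrid μ D 𝓓)
    (hpm : Measurable p) (h1 : ∀ x, 1 ≤ p x) (hP : ∀ x, p x ≤ P) (hP1 : 1 ≤ P) :
    ∃ a η C : ℝ≥0, 1 ≤ a ∧ 0 < η ∧ ∀ (S : Finset (Set X)) (α : Set X → ℝ≥0),
      (∀ Q ∈ S, Q ∈ 𝓓) → (∀ Q ∈ S, a * μ (below S Q) ≤ μ Q) →
      ∑ Q ∈ S, ∫⁻ x in core S Q, (α Q : ℝ≥0∞) ^ p x ∂μ ≤ η →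
      ∫⁻ x, (∑ Q ∈ S, Q.indicator (fun _ => (α Q : ℝ≥0∞)) x) ^ p x ∂μ ≤ C := by
  classical
  obtain ⟨γ, hγ1, K, η, C, hK, hη, hbad⟩ := H.exists_sum_tower_le_of_bad hD hpm h1 hP hP1
  have hp0 : ∀ x, 0 < p x := fun x => zero_lt_one.trans_le (h1 x)
  have hwm : ∀ a : ℝ≥0, Measurable fun x => (a : ℝ≥0∞) ^ p x := fun a => by fun_prop
  set γ' := γ.conjExponent with hγ'
  have hγ : γ.HolderConjugate γ' := Real.HolderConjugate.conjExponent hγ1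
  have hγ0 : 0 < γ' := hγ.symm.pos
  have h2P : (1 : ℝ≥0) ≤ 2 ^ P := NNReal.one_le_rpow (by norm_num) (by linarith)
  set c : ℝ≥0 := 2 ^ P with hc
  have hcE : (c : ℝ≥0∞) = 2 ^ P := by
    rw [hc, ENNReal.coe_rpow_of_nonneg _ (by linarith)]; rfl
  set a : ℝ≥0 := 4 * (2 * c) ^ γ' + (2 * K) ^ γ' with ha
  have ha1 : 4 * (2 * (c : ℝ≥0∞)) ^ γ' ≤ a := by
    have : 4 * (2 * c) ^ γ' ≤ a := le_self_add
    calc 4 * (2 * (c : ℝ≥0∞)) ^ γ' = ((4 * (2 * c) ^ γ' : ℝ≥0) : ℝ≥0∞) := by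
          rw [ENNReal.coe_mul, ENNReal.coe_rpow_of_nonneg _ hγ0.le]; norm_cast
      _ ≤ a := by exact_mod_cast this
  have ha2 : (2 * (K : ℝ≥0∞)) ^ γ' ≤ a := by
    have : (2 * K) ^ γ' ≤ a := le_add_self
    calc (2 * (K : ℝ≥0∞)) ^ γ' = (((2 * K) ^ γ' : ℝ≥0) : ℝ≥0∞) := by
          rw [ENNReal.coe_rpow_of_nonneg _ hγ0.le]; norm_cast
      _ ≤ a := by exact_mod_cast this
  have haa : 1 ≤ a := by
    refine le_trans ?_ (le_add_self : (2 * K) ^ γ' ≤ a)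
    refine NNReal.one_le_rpow ?_ hγ0.le
    calc (1 : ℝ≥0) ≤ 2 * 1 := by norm_num
      _ ≤ 2 * K := by gcongr
  refine ⟨a, η, c * (4 * K * η + C + C), haa, hη, fun S α hS hsp hle => ?_⟩
  have hsp' : ∀ Q ∈ S, 4 * (2 * (c : ℝ≥0∞)) ^ γ' * μ (below S Q) ≤ μ Q := fun Q hQ =>
    le_trans (by gcongr) (hsp Q hQ)
  have hc1 : 1 ≤ (c : ℝ≥0∞) := by exact_mod_cast h2P
  have hspc : ∀ Q ∈ S, 4 * (c : ℝ≥0∞) ^ γ' * μ (below S Q) ≤ μ Q := fun Q hQ =>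
    le_trans (by gcongr; rw [two_mul]; exact le_self_add) (hsp' Q hQ)
  have h2K0 : (2 * K : ℝ≥0∞) ≠ 0 := by
    have : K ≠ 0 := (zero_lt_one.trans_le hK).ne'
    simpa using this
  have h2Kt : (2 * K : ℝ≥0∞) ≠ ∞ := ENNReal.mul_ne_top (by norm_num) ENNReal.coe_ne_top
  have hK0 : (2 * K : ℝ≥0∞) ^ γ' ≠ 0 := by
    rw [Ne, ENNReal.rpow_eq_zero_iff_of_pos hγ0]; exact h2K0
  have hKt : (2 * K : ℝ≥0∞) ^ γ' ≠ ∞ := ENNReal.rpow_ne_top_of_nonneg hγ0.le h2Kt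
  have hsub : ∀ T ⊆ S, ∑ Q ∈ T, ∫⁻ x in core S Q, (α Q : ℝ≥0∞) ^ p x ∂μ ≤ η := fun T hT =>
    (Finset.sum_le_sum_of_subset hT).trans hle
  set W : Set X → ℝ≥0∞ := fun Q =>
    ∫⁻ x in Q, (c : ℝ≥0∞) ^ (tower S Q x).card * (α Q : ℝ≥0∞) ^ p x ∂μ with hW
  set good : Set X → Prop := fun Q => powMean μ (fun x => (α Q : ℝ≥0∞) ^ p x) γ Q ≤
    K * avgOn μ (fun x => (α Q : ℝ≥0∞) ^ p x) Q with hgood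
  have hG : ∑ Q ∈ S with good Q, W Q ≤ 4 * K * η := by
    calc _ ≤ ∑ Q ∈ S with good Q, 4 * K * ∫⁻ x in core S Q, (α Q : ℝ≥0∞) ^ p x ∂μ := by
          refine Finset.sum_le_sum fun Q hQ => ?_
          obtain ⟨hQS, hg⟩ := Finset.mem_filter.1 hQ
          have hQD := hS Q hQS
          have hμ0 := hD.measure_ne_zero Q hQD
          have hμt := hD.measure_ne_top Q hQD
          have hμg : μ Q * powMean μ (fun x => (α Q : ℝ≥0∞) ^ p x) γ Q ≤
              K * ∫⁻ x in Q, (α Q : ℝ≥0∞) ^ p x ∂μ := by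
            rw [← measure_mul_avgOn hμ0 hμt, mul_left_comm]
            gcongr
          have hbel : 2 * ∫⁻ x in below S Q, (α Q : ℝ≥0∞) ^ p x ∂μ ≤
              ∫⁻ x in Q, (α Q : ℝ≥0∞) ^ p x ∂μ := by
            have hbm := hD.measurableSet_below hS Q
            have hv : (fun x => (below S Q).indicator (1 : X → ℝ≥0∞) x ^ γ') =
                (below S Q).indicator 1 := by
              ext x
              by_cases hx : x ∈ below S Q <;> simp [hx, hγ0]
            have havg : avgOn μ ((below S Q).indicator 1) Q ≤ ((2 * K : ℝ≥0∞) ^ γ')⁻¹ := by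
              rw [avgOn, lintegral_indicator_one hbm, Measure.restrict_apply hbm,
                inter_eq_left.2 (below_subset S Q), ← ENNReal.mul_le_mul_iff_right hμ0 hμt,
                ← mul_assoc, ENNReal.mul_inv_cancel hμ0 hμt, one_mul, ← div_eq_mul_inv,
                ENNReal.le_div_iff_mul_le (Or.inl hK0) (Or.inl hKt), mul_comm]
              exact le_trans (by gcongr) (hsp Q hQS)
            have hH := hD.lintegral_mul_le_powMean hQD
              (measurable_one.indicator hbm : Measurable ((below S Q).indicator (1 : X → ℝ≥0∞)))
              (hwm (α Q)) hγ
            have hl : ∫⁻ x in Q, (below S Q).indicator (1 : X → ℝ≥0∞) x * (α Q : ℝ≥0∞) ^ p x ∂μ =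
                ∫⁻ x in below S Q, (α Q : ℝ≥0∞) ^ p x ∂μ := by
              have he : ∀ x, (below S Q).indicator (1 : X → ℝ≥0∞) x * (α Q : ℝ≥0∞) ^ p x =
                  (below S Q).indicator (fun x => (α Q : ℝ≥0∞) ^ p x) x := fun x => by
                by_cases hx : x ∈ below S Q <;> simp [hx]
              simp_rw [he]
              rw [lintegral_indicator hbm, Measure.restrict_restrict hbm,
                inter_eq_left.2 (below_subset S Q)]
            rw [hl, hv] at hH
            calc _ ≤ 2 * ((((2 * K : ℝ≥0∞) ^ γ')⁻¹) ^ (1 / γ') *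
                  (K * ∫⁻ x in Q, (α Q : ℝ≥0∞) ^ p x ∂μ)) := by
                  refine mul_le_mul_right (hH.trans ?_) _
                  gcongr
              _ = (2 * K) * (2 * K : ℝ≥0∞)⁻¹ * ∫⁻ x in Q, (α Q : ℝ≥0∞) ^ p x ∂μ := by
                  rw [← ENNReal.inv_rpow, ← ENNReal.rpow_mul, mul_one_div_cancel hγ0.ne',
                    ENNReal.rpow_one]
                  ring
              _ = _ := by rw [ENNReal.mul_inv_cancel h2K0 h2Kt, one_mul]
          have hcore : ∫⁻ x in Q, (α Q : ℝ≥0∞) ^ p x ∂μ ≤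
              2 * ∫⁻ x in core S Q, (α Q : ℝ≥0∞) ^ p x ∂μ := by
            have hsplit := lintegral_inter_add_sdiff (μ := μ) (fun x => (α Q : ℝ≥0∞) ^ p x) Q
              (hD.measurableSet_below hS Q)
            rw [inter_eq_right.2 (below_subset S Q)] at hsplit
            have hfin : ∫⁻ x in Q, (α Q : ℝ≥0∞) ^ p x ∂μ ≠ ∞ := by
              rw [← measure_mul_avgOn hμ0 hμt]
              exact ENNReal.mul_ne_top hμt (avgOn_ne_top_of_le
                (coe_rpow_le_bound (fun x => (hp0 x).le) hP (α Q)) Q)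
            rw [← ENNReal.add_le_add_iff_left hfin]
            calc _ = 2 * (∫⁻ x in below S Q, (α Q : ℝ≥0∞) ^ p x ∂μ) +
                  2 * ∫⁻ x in core S Q, (α Q : ℝ≥0∞) ^ p x ∂μ := by
                  rw [← two_mul, ← mul_add, core, hsplit]
              _ ≤ _ := by gcongr
          calc W Q ≤ 2 * (μ Q * powMean μ (fun x => (α Q : ℝ≥0∞) ^ p x) γ Q) :=
                hD.lintegral_pow_card_tower_mul_le hS hc1 hγ hspc hQS (hwm _)
            _ ≤ 2 * (K * (2 * ∫⁻ x in core S Q, (α Q : ℝ≥0∞) ^ p x ∂μ)) := by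
                exact mul_le_mul_right (hμg.trans (mul_le_mul_right hcore _)) _
            _ = _ := by ring
      _ ≤ _ := by
          rw [← Finset.mul_sum]
          gcongr
          exact hsub _ (Finset.filter_subset _ _)
  have hBad : ∀ Q ∈ S, ¬ good Q → α Q ≠ 0 ∧ K * avgOn μ (fun x => (α Q : ℝ≥0∞) ^ p x) Q ≤
        powMean μ (fun x => (α Q : ℝ≥0∞) ^ p x) γ Q := by
    intro Q hQ hg
    refine ⟨fun h0 => hg ?_, (not_le.1 hg).le⟩
    have hz : (fun x => ((α Q : ℝ≥0) : ℝ≥0∞) ^ p x) = fun _ => 0 := by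
      ext x; simp [h0, hp0 x]
    change powMean μ (fun x => ((α Q : ℝ≥0) : ℝ≥0∞) ^ p x) γ Q ≤ _
    rw [hz, powMean, avgOn]
    simp [hγ.pos]
  have hB1 : ∑ Q ∈ S with (¬ good Q ∧ 1 ≤ α Q), W Q ≤ C := by
    choose! k hk hk' using fun (Q : Set X) (h : 1 ≤ α Q) => exists_dyadic_level h
    refine hbad γ' c S _ α k hγ hc1 hS hsp' (Finset.filter_subset _ _) ?_ ?_ ?_
      (Or.inr ?_) (hsub _ (Finset.filter_subset _ _))
    · intro Q hQ
      obtain ⟨hQS, hg, -⟩ := Finset.mem_filter.1 hQ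
      exact (hBad Q hQS hg).1
    · intro Q hQ
      obtain ⟨hQS, hg, -⟩ := Finset.mem_filter.1 hQ
      exact (hBad Q hQS hg).2
    · intro Q hQ R hR hQR
      have hQ1 := (Finset.mem_filter.1 hQ).2.2
      have hR1 := (Finset.mem_filter.1 hR).2.2
      have h3 := hk R hR1
      rw [inv_pow, inv_le_inv₀ (by positivity) (by positivity), ← hQR] at h3
      calc α Q ≤ 2 * 2 ^ k Q := by rw [← pow_succ']; exact (hk' Q hQ1).le
        _ ≤ _ := by gcongr
    · exact fun Q hQ => hk Q (Finset.mem_filter.1 hQ).2.2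
  have hB2 : ∑ Q ∈ S with (¬ good Q ∧ ¬ 1 ≤ α Q), W Q ≤ C := by
    choose! k hk hk' using fun (Q : Set X) (h : 1 ≤ (α Q)⁻¹) => exists_dyadic_level h
    have hinv : ∀ Q ∈ S.filter (fun Q => ¬ good Q ∧ ¬ 1 ≤ α Q), α Q ≠ 0 ∧ 1 ≤ (α Q)⁻¹ := by
      intro Q hQ
      obtain ⟨hQS, hg, h⟩ := Finset.mem_filter.1 hQ
      have h0 := (hBad Q hQS hg).1
      exact ⟨h0, (one_le_inv₀ (pos_iff_ne_zero.2 h0)).2 (not_le.1 h).le⟩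
    refine hbad γ' c S _ α k hγ hc1 hS hsp' (Finset.filter_subset _ _)
      (fun Q hQ => (hinv Q hQ).1) ?_ ?_ (Or.inl ?_) (hsub _ (Finset.filter_subset _ _))
    · intro Q hQ
      obtain ⟨hQS, hg, -⟩ := Finset.mem_filter.1 hQ
      exact (hBad Q hQS hg).2
    · intro Q hQ R hR hQR
      have h3 := hk Q (hinv Q hQ).2
      have h4 := hk' R (hinv R hR).2
      rw [inv_inv] at h3
      have hR0 : 0 < α R := pos_iff_ne_zero.2 (hinv R hR).1
      rw [inv_lt_comm₀ hR0 (by positivity), ← hQR, pow_succ', mul_inv] at h4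
      calc α Q ≤ 2⁻¹ ^ k Q := h3
        _ = 2 * (2⁻¹ * (2 ^ k Q)⁻¹) := by rw [← mul_assoc, inv_pow]; norm_num
        _ ≤ _ := by gcongr
    · intro Q hQ
      simpa using hk Q (hinv Q hQ).2
  calc _ ≤ 2 ^ P * ∑ Q ∈ S, ∫⁻ x in Q, (2 ^ P) ^ (tower S Q x).card * (α Q : ℝ≥0∞) ^ p x ∂μ :=
        hD.lintegral_sum_rpow_le hS hpm hp0 hP _
    _ = c * ∑ Q ∈ S, W Q := by rw [hW, hcE]
    _ ≤ c * (4 * K * η + C + C) := by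
        gcongr
        rw [← Finset.sum_filter_add_sum_filter_not S good,
          ← Finset.sum_filter_add_sum_filter_not (S.filter (¬ good ·)) (1 ≤ α ·),
          Finset.filter_filter, Finset.filter_filter, add_assoc]
        gcongr
    _ = _ := by push_cast; rfl

end SparseBound

end

section

section PrincipalCubes

variable {X : Type*}

/-- Selection of principal sets from a finite family. -/
theorem exists_principal_subfamily {v : Set X → ℝ≥0∞} {a : ℝ≥0∞} (ha : 1 ≤ a)
    (𝓖 : Finset (Set X)) :
    ∃ S ⊆ 𝓖, (∀ Q ∈ S, ∀ Q' ∈ S, Q' ⊂ Q → a * v Q ≤ v Q') ∧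
      ∀ R ∈ 𝓖, ∃ Q ∈ S, R ⊆ Q ∧ v R ≤ a * v Q := by
  classical
  induction hn : 𝓖.card generalizing 𝓖 with
  | zero => exact ⟨∅, by simp, by simp, by simp [Finset.card_eq_zero.1 hn]⟩
  | succ n ih =>
    have hne : 𝓖.Nonempty := by rw [← Finset.card_pos]; omega
    obtain ⟨R, hR, hmin⟩ := 𝓖.exists_minimal hne
    obtain ⟨S, hS, hS1, hS2⟩ := ih (𝓖.erase R) (by rw [Finset.card_erase_of_mem hR]; omega)
    have hSG : S ⊆ 𝓖 := hS.trans (Finset.erase_subset _ _)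
    by_cases h : ∃ Q ∈ S, R ⊆ Q ∧ v R ≤ a * v Q
    · refine ⟨S, hSG, hS1, fun R' hR' => ?_⟩
      by_cases hRR : R' = R
      · exact hRR ▸ h
      · exact hS2 R' (Finset.mem_erase.2 ⟨hRR, hR'⟩)
    · push Not at h
      refine ⟨insert R S, Finset.insert_subset hR hSG, ?_, fun R' hR' => ?_⟩
      · intro Q hQ Q' hQ' hlt
        have hQR : Q ≠ R := by
          rintro rfl
          exact hlt.2 (hmin (Finset.insert_subset hR hSG hQ') hlt.1)
        have hQS := (Finset.mem_insert.1 hQ).resolve_left hQR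
        rcases Finset.mem_insert.1 hQ' with rfl | hQ'
        · exact (h Q hQS hlt.1).le
        · exact hS1 Q hQS Q' hQ' hlt
      · by_cases hRR : R' = R
        · subst hRR
          exact ⟨R', Finset.mem_insert_self _ _, Subset.rfl, le_mul_of_one_le_left' ha⟩
        · obtain ⟨Q, hQ, h'⟩ := hS2 R' (Finset.mem_erase.2 ⟨hRR, hR'⟩)
          exact ⟨Q, Finset.mem_insert_of_mem hQ, h'⟩

/-- Every point of a member of a finite family lies in the core of some member. -/
theorem exists_mem_core {S : Finset (Set X)} {Q : Set X} (hQ : Q ∈ S) {x : X} (hx : x ∈ Q) :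
    ∃ R ∈ S, R ⊆ Q ∧ x ∈ core S R := by
  classical
  obtain ⟨R, hR, hmin⟩ := (S.filter fun R => x ∈ R ∧ R ⊆ Q).exists_minimal
    ⟨Q, Finset.mem_filter.2 ⟨hQ, hx, Subset.rfl⟩⟩
  rw [Finset.mem_filter] at hR
  refine ⟨R, hR.1, hR.2.2, hR.2.1, ?_⟩
  rintro ⟨T, ⟨hT, hTR⟩, hxT⟩
  exact hTR.2 (hmin (Finset.mem_filter.2 ⟨hT, hxT, hTR.subset.trans hR.2.2⟩) hTR.subset)

theorem sum_indicator_eq_of_mem {S : Finset (Set X)} {E : Set X → Set X}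
    (hE : (S : Set (Set X)).PairwiseDisjoint E) (f : Set X → X → ℝ≥0∞) {Q : Set X} (hQ : Q ∈ S)
    {x : X} (hx : x ∈ E Q) : ∑ R ∈ S, (E R).indicator (f R) x = f Q x := by
  rw [Finset.sum_eq_single_of_mem Q hQ, indicator_of_mem hx]
  intro R hR hne
  exact indicator_of_notMem (fun h => disjoint_left.1 (hE hR hQ hne) h hx) _

end PrincipalCubes

section GridDuality

variable {X : Type*} [MeasurableSpace X] {μ : Measure X} {D : ℝ≥0} {𝓓 : Set (Set X)}
  {p q : X → ℝ} {P P' p₀ : ℝ} {C₀ : ℝ≥0}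

theorem IsGrid.sparse_of_principal (hD : IsGrid μ D 𝓓) {S : Finset (Set X)} (hS : ∀ Q ∈ S, Q ∈ 𝓓)
    {f : X → ℝ≥0∞} {a : ℝ≥0} (h0 : ∀ Q ∈ S, avgOn μ f Q ≠ 0)
    (ht : ∀ Q ∈ S, avgOn μ f Q ≠ ∞)
    (h : ∀ Q ∈ S, ∀ Q' ∈ S, Q' ⊂ Q → a * avgOn μ f Q ≤ avgOn μ f Q') :
    ∀ Q ∈ S, a * μ (below S Q) ≤ μ Q := by
  intro Q hQ
  have h2 := hD.mul_measure_sUnion_le (w := f) (c := a * avgOn μ f Q) (R := Q)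
    (T := {Q' | Q' ∈ S ∧ Q' ⊂ Q}) (fun R hR => hS R hR.1) (fun R hR => hR.2.subset) (fun R hR => by
      rw [← measure_mul_avgOn (hD.measure_ne_zero R (hS R hR.1))
        (hD.measure_ne_top R (hS R hR.1)), mul_comm]
      exact mul_le_mul_right (h Q hQ R hR.1 hR.2) _)
  rw [← measure_mul_avgOn (hD.measure_ne_zero Q (hS Q hQ)) (hD.measure_ne_top Q (hS Q hQ)),
    mul_comm (a : ℝ≥0∞), mul_comm (μ Q), mul_assoc] at h2
  exact (ENNReal.mul_le_mul_iff_right (h0 Q hQ) (ht Q hQ)).1 h2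

theorem le_one_add_rpow (a : ℝ≥0∞) {t : ℝ} (ht : 1 ≤ t) : a ≤ 1 + a ^ t := by
  rcases le_total a 1 with h | h
  · exact h.trans le_self_add
  · refine le_trans ?_ le_add_self
    simpa using ENNReal.rpow_le_rpow_of_exponent_le h ht

theorem mul_le_rpow_add_rpow {s t : ℝ} (h : s.HolderConjugate t) (a b : ℝ≥0∞) :
    a * b ≤ a ^ s + b ^ t := by
  refine (ENNReal.young_inequality a b h).trans (add_le_add ?_ ?_)
  · exact ENNReal.div_le_of_le_mul (le_mul_of_one_le_right' (by simpa using h.lt.le))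
  · exact ENNReal.div_le_of_le_mul (le_mul_of_one_le_right' (by simpa using h.symm.lt.le))

theorem avgOn_ne_top_of_modular_ne_top (hq : ∀ x, 1 ≤ q x) {f : X → ℝ≥0∞}
    (hf : ∫⁻ x, f x ^ q x ∂μ ≠ ∞) {Q : Set X} (h0 : μ Q ≠ 0) (ht : μ Q ≠ ∞) :
    avgOn μ f Q ≠ ∞ := by
  unfold avgOn
  refine ENNReal.mul_ne_top (ENNReal.inv_ne_top.2 h0) (ne_top_of_le_ne_top ?_
    (lintegral_mono fun x => le_one_add_rpow (f x) (hq x)))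
  rw [lintegral_add_left measurable_const]
  refine ENNReal.add_ne_top.2 ⟨by simpa using ht, ne_top_of_le_ne_top hf ?_⟩
  exact setLIntegral_le_lintegral _ _

/-- The dual estimate over the cores of a sparse family. -/
theorem GridBounded.exists_core_modular_le (H : GridBounded μ 𝓓 p C₀) (hD : IsGrid μ D 𝓓)
    (hpm : Measurable p) (hqm : Measurable q) (hpq : ∀ x, (p x).HolderConjugate (q x))
    (hp₀ : 1 < p₀) (hp₀p : ∀ x, p₀ ≤ p x) (hP : ∀ x, p x ≤ P) (hP1 : 1 ≤ P)
    (hP' : ∀ x, q x ≤ P') :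
    ∃ a C : ℝ≥0, 1 ≤ a ∧ ∀ f : X → ℝ≥0∞, Measurable f → ∫⁻ x, f x ^ q x ∂μ ≤ 1 →
      ∀ S : Finset (Set X), (∀ Q ∈ S, Q ∈ 𝓓) → (∀ Q ∈ S, a * μ (below S Q) ≤ μ Q) →
      ∑ Q ∈ S, ∫⁻ x in core S Q, avgOn μ f Q ^ q x ∂μ ≤ C := by
  classical
  have h1 : ∀ x, 1 ≤ p x := fun x => (hpq x).lt.le
  have hq1 : ∀ x, 1 < q x := fun x => (hpq x).symm.lt
  obtain ⟨a, η, C, ha, hη, hsparse⟩ := H.exists_sparse_modular_le hD hpm h1 hP hP1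
  set δ : ℝ≥0 := min 1 (η / (C₀ + 1)) with hδ
  have hδ0 : 0 < δ := lt_min one_pos (by positivity)
  have hδ1 : δ ≤ 1 := min_le_left _ _
  have hδC : δ * C₀ ≤ η := by
    calc δ * C₀ ≤ η / (C₀ + 1) * (C₀ + 1) := by
          gcongr
          · exact min_le_right _ _
          · exact le_self_add
      _ = η := div_mul_cancel₀ _ (by positivity)
  set s : ℝ := 1 - p₀⁻¹ with hs
  have hs0 : 0 < s := by rw [hs, sub_pos]; exact inv_lt_one_of_one_lt₀ hp₀
  have hp00 : 0 < p₀ := by linarith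
  refine ⟨a, max 1 (((1 + C) / δ) ^ s⁻¹), ha, fun f hf hfq S hS hsp => ?_⟩
  set v : Set X → ℝ≥0∞ := fun Q => avgOn μ f Q with hv
  have hvt : ∀ Q ∈ S, v Q ≠ ∞ := fun Q hQ => avgOn_ne_top_of_modular_ne_top (fun x => (hq1 x).le)
    (ne_top_of_le_ne_top ENNReal.one_ne_top hfq) (hD.measure_ne_zero Q (hS Q hQ))
    (hD.measure_ne_top Q (hS Q hQ))
  have hcm : ∀ Q ∈ S, MeasurableSet (core S Q) := fun Q hQ => hD.measurableSet_core hS hQ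
  have hdis : (S : Set (Set X)).PairwiseDisjoint (core S) := pairwiseDisjoint_core
    fun Q hQ R hR => hD.nested Q (hS Q hQ) R (hS R hR)
  set h : X → ℝ≥0∞ := fun x => ∑ Q ∈ S, (core S Q).indicator (fun _ => v Q) x with hh
  have hhm : Measurable h := Finset.measurable_fun_sum _ fun Q hQ =>
    measurable_const.indicator (hcm Q hQ)
  have hhQ : ∀ Q ∈ S, ∀ x ∈ core S Q, h x = v Q := fun Q hQ x hx =>
    sum_indicator_eq_of_mem hdis (fun Q _ => v Q) hQ hx
  have hhq : ∀ x, h x ^ q x = ∑ Q ∈ S, (core S Q).indicator (fun x => v Q ^ q x) x := by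
    intro x
    by_cases hx : ∃ Q ∈ S, x ∈ core S Q
    · obtain ⟨Q, hQ, hx⟩ := hx
      rw [hhQ Q hQ x hx, sum_indicator_eq_of_mem hdis (fun Q x => v Q ^ q x) hQ hx]
    · push Not at hx
      rw [Finset.sum_eq_zero fun Q hQ => indicator_of_notMem (hx Q hQ) _]
      have : h x = 0 := Finset.sum_eq_zero fun Q hQ => indicator_of_notMem (hx Q hQ) _
      rw [this, ENNReal.zero_rpow_of_pos (by linarith [hq1 x])]
  set I : ℝ≥0∞ := ∫⁻ x, h x ^ q x ∂μ with hI
  have hI' : I = ∑ Q ∈ S, ∫⁻ x in core S Q, v Q ^ q x ∂μ := by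
    rw [hI]
    simp_rw [hhq]
    rw [lintegral_finsetSum]
    · exact Finset.sum_congr rfl fun Q hQ => lintegral_indicator (hcm Q hQ) _
    · exact fun Q hQ => Measurable.indicator (by fun_prop) (hcm Q hQ)
  have hIt : I ≠ ∞ := by
    rw [hI']
    refine ENNReal.sum_ne_top.2 fun Q hQ => ?_
    have hb := coe_rpow_le_bound (fun x => (by linarith [hq1 x] : 0 ≤ q x)) hP' (v Q).toNNReal
    rw [ENNReal.coe_toNNReal (hvt Q hQ)] at hb
    refine ne_top_of_le_ne_top ?_ (lintegral_mono hb)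
    rw [setLIntegral_const]
    refine ENNReal.mul_ne_top ENNReal.coe_ne_top (ne_top_of_le_ne_top
      (hD.measure_ne_top Q (hS Q hQ)) (measure_mono (core_subset S Q)))
  rw [← hI']
  rcases le_total I 1 with hI1 | hI1
  · exact hI1.trans (by exact_mod_cast le_max_left _ _)
  have hI0 : I ≠ 0 := (zero_lt_one.trans_le hI1).ne'
  set κ : ℝ≥0∞ := I ^ (-p₀⁻¹) with hκ
  have hκ1 : κ ≤ 1 := ENNReal.rpow_le_one_of_one_le_of_neg hI1 (by simpa using hp00)
  have hκI : κ * I = I ^ s := by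
    calc κ * I = I ^ (-p₀⁻¹) * I ^ (1 : ℝ) := by rw [ENNReal.rpow_one]
      _ = I ^ s := by
        rw [← ENNReal.rpow_add _ _ hI0 hIt]
        congr 1
        rw [hs]; ring
  set g : X → ℝ≥0∞ := fun x => κ * h x ^ (q x - 1) with hg
  have hgm : Measurable g := by fun_prop
  have hgmod : ∫⁻ x, g x ^ p x ∂μ ≤ 1 := by
    calc ∫⁻ x, g x ^ p x ∂μ ≤ ∫⁻ x, I⁻¹ * h x ^ q x ∂μ := by
          refine lintegral_mono fun x => ?_
          have hpx : 0 ≤ p x := by linarith [h1 x]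
          rw [hg]
          simp only
          rw [ENNReal.mul_rpow_of_nonneg _ _ hpx, ← ENNReal.rpow_mul (h x),
            (hpq x).symm.sub_one_mul_conj]
          gcongr
          calc κ ^ p x ≤ κ ^ p₀ := ENNReal.rpow_le_rpow_of_exponent_ge hκ1 (hp₀p x)
            _ = I⁻¹ := by
              rw [hκ, ← ENNReal.rpow_mul, neg_mul, inv_mul_cancel₀ hp00.ne', ENNReal.rpow_neg_one]
      _ = I⁻¹ * I := by rw [lintegral_const_mul _ (by fun_prop)]
      _ = 1 := ENNReal.inv_mul_cancel hI0 hIt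
  have hMg := H g hgm hgmod
  set α : Set X → ℝ≥0∞ := fun Q => avgOn μ ((core S Q).indicator fun x => δ * g x) Q with hα
  have hαle : ∀ Q ∈ S, ∀ x ∈ Q, α Q ≤ δ * gridMax μ 𝓓 g x := by
    intro Q hQ x hx
    rw [← gridMax_const_mul ENNReal.coe_ne_top]
    exact (avgOn_mono (indicator_le_self _ _) Q).trans (avgOn_le_gridMax (hS Q hQ) hx _)
  have hαμ : ∀ Q ∈ S, μ Q * α Q = ∫⁻ x in core S Q, δ * g x ∂μ := by
    intro Q hQ
    rw [hα]
    simp only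
    rw [measure_mul_avgOn (hD.measure_ne_zero Q (hS Q hQ)) (hD.measure_ne_top Q (hS Q hQ)),
      lintegral_indicator (hcm Q hQ), Measure.restrict_restrict (hcm Q hQ),
      inter_eq_left.2 (core_subset S Q)]
  have hgt : ∀ Q ∈ S, α Q ≠ ∞ := by
    intro Q hQ
    refine ne_top_of_le_ne_top (avgOn_ne_top_of_modular_ne_top h1
      (ne_top_of_le_ne_top ENNReal.one_ne_top hgmod) (hD.measure_ne_zero Q (hS Q hQ))
      (hD.measure_ne_top Q (hS Q hQ))) (avgOn_mono (fun x => ?_) Q)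
    refine (indicator_le_self _ _ x).trans ?_
    calc (δ : ℝ≥0∞) * g x ≤ 1 * g x := by gcongr; exact_mod_cast hδ1
      _ = g x := one_mul _
  have hcore : ∑ Q ∈ S, ∫⁻ x in core S Q, ((α Q).toNNReal : ℝ≥0∞) ^ p x ∂μ ≤ η := by
    calc _ ≤ ∑ Q ∈ S, ∫⁻ x in core S Q, (δ * gridMax μ 𝓓 g x) ^ p x ∂μ := by
          refine Finset.sum_le_sum fun Q hQ => setLIntegral_mono' (hcm Q hQ) fun x hx => ?_
          rw [ENNReal.coe_toNNReal (hgt Q hQ)]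
          exact ENNReal.rpow_le_rpow (hαle Q hQ x (core_subset S Q hx)) (by linarith [h1 x])
      _ = ∫⁻ x in ⋃ Q ∈ S, core S Q, (δ * gridMax μ 𝓓 g x) ^ p x ∂μ :=
          (lintegral_biUnion_finset hdis hcm _).symm
      _ ≤ ∫⁻ x, (δ * gridMax μ 𝓓 g x) ^ p x ∂μ := setLIntegral_le_lintegral _ _
      _ ≤ δ * ∫⁻ x, gridMax μ 𝓓 g x ^ p x ∂μ :=
          modular_const_mul_le_of_le_one h1 _ (by exact_mod_cast hδ1)
      _ ≤ δ * C₀ := by gcongr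
      _ ≤ η := by exact_mod_cast hδC
  have hsum := hsparse S (fun Q => (α Q).toNNReal) hS hsp hcore
  set Φ : X → ℝ≥0∞ := fun x => ∑ Q ∈ S, Q.indicator (fun _ => ((α Q).toNNReal : ℝ≥0∞)) x with hΦ
  have hΦm : Measurable Φ := Finset.measurable_fun_sum _ fun Q hQ =>
    measurable_const.indicator (hD.measurableSet Q (hS Q hQ))
  have hpair : δ * I ^ s = ∫⁻ x, Φ x * f x ∂μ := by
    calc δ * I ^ s = ∫⁻ x, h x * (δ * g x) ∂μ := by
          rw [← hκI, ← mul_assoc, hI, ← lintegral_const_mul _ (by fun_prop)]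
          refine lintegral_congr fun x => ?_
          have : h x ^ q x = h x * h x ^ (q x - 1) := by
            nth_rewrite 2 [← ENNReal.rpow_one (h x)]
            rw [← ENNReal.rpow_add_of_nonneg _ _ zero_le_one (by linarith [hq1 x])]
            congr 1; ring
          rw [this, hg]; ring
      _ = ∑ Q ∈ S, v Q * ∫⁻ x in core S Q, δ * g x ∂μ := by
          have : ∀ x, h x * (δ * g x) =
              ∑ Q ∈ S, (core S Q).indicator (fun x => v Q * (δ * g x)) x := by
            intro x
            rw [hh, Finset.sum_mul]
            refine Finset.sum_congr rfl fun Q _ => ?_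
            by_cases hx : x ∈ core S Q <;> simp [hx]
          simp_rw [this]
          rw [lintegral_finsetSum]
          · refine Finset.sum_congr rfl fun Q hQ => ?_
            rw [lintegral_indicator (hcm Q hQ), lintegral_const_mul _ (by fun_prop)]
          · exact fun Q hQ => Measurable.indicator (by fun_prop) (hcm Q hQ)
      _ = ∑ Q ∈ S, α Q * ∫⁻ x in Q, f x ∂μ := by
          refine Finset.sum_congr rfl fun Q hQ => ?_
          rw [← hαμ Q hQ, ← measure_mul_avgOn (hD.measure_ne_zero Q (hS Q hQ))
            (hD.measure_ne_top Q (hS Q hQ)) f]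
          ring
      _ = ∫⁻ x, Φ x * f x ∂μ := by
          have : ∀ x, Φ x * f x = ∑ Q ∈ S, Q.indicator (fun x => α Q * f x) x := by
            intro x
            rw [hΦ, Finset.sum_mul]
            refine Finset.sum_congr rfl fun Q hQ => ?_
            rw [ENNReal.coe_toNNReal (hgt Q hQ)]
            by_cases hx : x ∈ Q <;> simp [hx]
          simp_rw [this]
          have hQm := fun Q (hQ : Q ∈ S) => hD.measurableSet Q (hS Q hQ)
          rw [lintegral_finsetSum]
          · refine Finset.sum_congr rfl fun Q hQ => ?_
            rw [lintegral_indicator (hQm Q hQ), lintegral_const_mul _ hf]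
          · exact fun Q hQ => Measurable.indicator (by fun_prop) (hQm Q hQ)
  have hfin : δ * I ^ s ≤ 1 + C := by
    rw [hpair]
    calc ∫⁻ x, Φ x * f x ∂μ ≤ ∫⁻ x, (Φ x ^ p x + f x ^ q x) ∂μ :=
          lintegral_mono fun x => mul_le_rpow_add_rpow (hpq x) _ _
      _ = ∫⁻ x, Φ x ^ p x ∂μ + ∫⁻ x, f x ^ q x ∂μ := lintegral_add_left (by fun_prop) _
      _ ≤ C + 1 := add_le_add hsum hfq
      _ = _ := add_comm _ _
  have hfin' : I ^ s ≤ ((1 + C) / δ : ℝ≥0) := by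
    rw [ENNReal.coe_div hδ0.ne', ENNReal.le_div_iff_mul_le (Or.inl (by exact_mod_cast hδ0.ne'))
      (Or.inl ENNReal.coe_ne_top), mul_comm]
    exact_mod_cast hfin
  rw [← ENNReal.le_rpow_inv_iff hs0, ← ENNReal.coe_rpow_of_nonneg _ (by positivity)] at hfin'
  exact hfin'.trans (by exact_mod_cast le_max_right _ _)

end GridDuality

end

section

section GridDuality

variable {X : Type*} [MeasurableSpace X] {μ : Measure X} {D : ℝ≥0} {𝓓 : Set (Set X)}
  {p q : X → ℝ} {P P' p₀ : ℝ} {C₀ : ℝ≥0}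

theorem measurable_gridMax {𝓖 : Set (Set X)} (h𝓖 : 𝓖.Countable)
    (hm : ∀ Q ∈ 𝓖, MeasurableSet Q) (f : X → ℝ≥0∞) : Measurable (gridMax μ 𝓖 f) := by
  have : gridMax μ 𝓖 f = fun x => ⨆ Q ∈ 𝓖, Q.indicator (fun _ => avgOn μ f Q) x := by
    ext x
    refine iSup_congr fun Q => iSup_congr fun _ => ?_
    by_cases hx : x ∈ Q <;> simp [hx]
  rw [this]
  exact Measurable.biSup 𝓖 h𝓖 fun Q hQ => measurable_const.indicator (hm Q hQ)

/-- Modular bounds for a countable family follow from bounds over its finite subfamilies. -/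
theorem lintegral_gridMax_le_of_finset (hD : IsGrid μ D 𝓓) (hq : ∀ x, 0 < q x)
    (hqm : Measurable q) {f : X → ℝ≥0∞} {C : ℝ≥0∞}
    (h : ∀ 𝓖 : Finset (Set X), (∀ Q ∈ 𝓖, Q ∈ 𝓓) → ∫⁻ x, gridMax μ 𝓖 f x ^ q x ∂μ ≤ C) :
    ∫⁻ x, gridMax μ 𝓓 f x ^ q x ∂μ ≤ C := by
  classical
  rcases 𝓓.eq_empty_or_nonempty with h0 | hne
  · simpa [h0] using h ∅ (by simp)
  obtain ⟨e, he⟩ := hD.countable.exists_eq_range hne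
  set G : ℕ → Finset (Set X) := fun n => (Finset.range n).image e with hG
  have hGD : ∀ n, ∀ Q ∈ G n, Q ∈ 𝓓 := by
    intro n Q hQ
    obtain ⟨i, -, rfl⟩ := Finset.mem_image.1 hQ
    exact he ▸ mem_range_self i
  have hmono : ∀ x, Monotone fun n => gridMax μ (G n) f x := by
    intro x m n hmn
    refine iSup_le fun Q => iSup_le fun hQ => iSup_le fun hx => avgOn_le_gridMax ?_ hx f
    exact Finset.image_subset_image (Finset.range_subset_range.2 hmn) hQ
  have hsup : ∀ x, gridMax μ 𝓓 f x ≤ ⨆ n, gridMax μ (G n) f x := by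
    intro x
    refine iSup_le fun Q => iSup_le fun hQ => iSup_le fun hx => ?_
    obtain ⟨i, rfl⟩ := he ▸ hQ
    refine le_iSup_of_le (i + 1) (avgOn_le_gridMax ?_ hx f)
    exact Finset.mem_image_of_mem e (Finset.self_mem_range_succ i)
  calc ∫⁻ x, gridMax μ 𝓓 f x ^ q x ∂μ ≤ ∫⁻ x, ⨆ n, gridMax μ (G n) f x ^ q x ∂μ := by
        refine lintegral_mono fun x => (ENNReal.rpow_le_rpow (hsup x) (hq x).le).trans ?_
        exact ((ENNReal.orderIsoRpow (q x) (hq x)).map_iSup fun n => gridMax μ (G n) f x).le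
    _ = ⨆ n, ∫⁻ x, gridMax μ (G n) f x ^ q x ∂μ := by
        refine lintegral_iSup (fun n => ?_) fun m n hmn x =>
          ENNReal.rpow_le_rpow (hmono x hmn) (hq x).le
        exact (measurable_gridMax (G n).countable_toSet
          (fun Q hQ => hD.measurableSet Q (hGD n Q hQ)) f).pow hqm
    _ ≤ C := iSup_le fun n => h (G n) (hGD n)

/-- Duality for grid maximal operators on variable Lebesgue spaces. -/
theorem GridBounded.exists_dual (H : GridBounded μ 𝓓 p C₀) (hD : IsGrid μ D 𝓓)
    (hpm : Measurable p) (hqm : Measurable q) (hpq : ∀ x, (p x).HolderConjugate (q x))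
    (hp₀ : 1 < p₀) (hp₀p : ∀ x, p₀ ≤ p x) (hP : ∀ x, p x ≤ P) (hP1 : 1 ≤ P)
    (hP' : ∀ x, q x ≤ P') : ∃ C : ℝ≥0, GridBounded μ 𝓓 q C := by
  classical
  obtain ⟨a, C, ha, hC⟩ := H.exists_core_modular_le hD hpm hqm hpq hp₀ hp₀p hP hP1 hP'
  have hq1 : ∀ x, 1 < q x := fun x => (hpq x).symm.lt
  have hq0 : ∀ x, 0 < q x := fun x => by linarith [hq1 x]
  have haE : (1 : ℝ≥0∞) ≤ a := by exact_mod_cast ha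
  have ha0 : (a : ℝ≥0∞) ≠ 0 := (zero_lt_one.trans_le haE).ne'
  refine ⟨a ^ P' * C, fun f hf hfq => lintegral_gridMax_le_of_finset hD hq0 hqm fun 𝓖 h𝓖 => ?_⟩
  obtain ⟨S, hSG, hS1, hS2⟩ := exists_principal_subfamily (v := avgOn μ f) haE
    (𝓖.filter fun Q => avgOn μ f Q ≠ 0)
  have hS : ∀ Q ∈ S, Q ∈ 𝓓 := fun Q hQ => h𝓖 Q (Finset.mem_filter.1 (hSG hQ)).1
  have hv0 : ∀ Q ∈ S, avgOn μ f Q ≠ 0 := fun Q hQ => (Finset.mem_filter.1 (hSG hQ)).2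
  have hvt : ∀ Q ∈ S, avgOn μ f Q ≠ ∞ := fun Q hQ =>
    avgOn_ne_top_of_modular_ne_top (fun x => (hq1 x).le)
      (ne_top_of_le_ne_top ENNReal.one_ne_top hfq) (hD.measure_ne_zero Q (hS Q hQ))
      (hD.measure_ne_top Q (hS Q hQ))
  have hsp := hD.sparse_of_principal hS hv0 hvt hS1
  have hcm : ∀ Q ∈ S, MeasurableSet (core S Q) := fun Q hQ => hD.measurableSet_core hS hQ
  have key : ∀ x, gridMax μ 𝓖 f x ^ q x ≤
      a ^ P' * ∑ Q ∈ S, (core S Q).indicator (fun x => avgOn μ f Q ^ q x) x := by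
    intro x
    have hle : gridMax μ 𝓖 f x ≤ a * (∑ Q ∈ S,
        (core S Q).indicator (fun x => avgOn μ f Q ^ q x) x) ^ (q x)⁻¹ := by
      refine iSup_le fun R => iSup_le fun hR => iSup_le fun hx => ?_
      by_cases hR0 : avgOn μ f R = 0
      · rw [hR0]; exact zero_le
      obtain ⟨Q, hQ, hRQ, hvR⟩ := hS2 R (Finset.mem_filter.2 ⟨hR, hR0⟩)
      obtain ⟨T, hT, hTQ, hxT⟩ := exists_mem_core hQ (hRQ hx)
      have hQT : avgOn μ f Q ≤ avgOn μ f T := by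
        by_cases h : T = Q
        · rw [h]
        · exact (le_mul_of_one_le_left' haE).trans (hS1 Q hQ T hT (hTQ.ssubset_of_ne h))
      refine hvR.trans (mul_le_mul_right (hQT.trans ?_) _)
      rw [ENNReal.le_rpow_inv_iff (hq0 x)]
      calc avgOn μ f T ^ q x = (core S T).indicator (fun x => avgOn μ f T ^ q x) x :=
            (indicator_of_mem hxT (fun x => avgOn μ f T ^ q x)).symm
        _ ≤ _ := Finset.single_le_sum
            (f := fun Q => (core S Q).indicator (fun x => avgOn μ f Q ^ q x) x)
            (fun _ _ => zero_le) hT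
    calc _ ≤ (a * (∑ Q ∈ S,
          (core S Q).indicator (fun x => avgOn μ f Q ^ q x) x) ^ (q x)⁻¹) ^ q x :=
          ENNReal.rpow_le_rpow hle (hq0 x).le
      _ = a ^ q x * ∑ Q ∈ S, (core S Q).indicator (fun x => avgOn μ f Q ^ q x) x := by
          rw [ENNReal.mul_rpow_of_nonneg _ _ (hq0 x).le, ← ENNReal.rpow_mul,
            inv_mul_cancel₀ (hq0 x).ne', ENNReal.rpow_one]
      _ ≤ _ := by
          gcongr
          exact hP' x
  calc _ ≤ ∫⁻ x, a ^ P' * ∑ Q ∈ S, (core S Q).indicator (fun x => avgOn μ f Q ^ q x) x ∂μ :=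
        lintegral_mono key
    _ = a ^ P' * ∑ Q ∈ S, ∫⁻ x in core S Q, avgOn μ f Q ^ q x ∂μ := by
        have hm : ∀ Q ∈ S, Measurable ((core S Q).indicator fun x => avgOn μ f Q ^ q x) :=
          fun Q hQ => Measurable.indicator (by fun_prop) (hcm Q hQ)
        rw [lintegral_const_mul _ (Finset.measurable_fun_sum _ hm), lintegral_finsetSum _ hm]
        congr 1
        exact Finset.sum_congr rfl fun Q hQ => lintegral_indicator (hcm Q hQ) _
    _ ≤ a ^ P' * C := by
        gcongr
        exact hC f hf hfq S hS hsp
    _ = _ := by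
        rw [ENNReal.coe_mul, ← ENNReal.coe_rpow_of_ne_zero (by exact_mod_cast ha0)]

end GridDuality

end

section

section Refining

variable {X ι : Type*}

/-- The generation-`k` cell containing `x` for a sequence `Z` of labellings of `X`. -/
def labelCell (Z : ℤ → X → ι) (k : ℤ) (x : X) : Set X := {y | Z k y = Z k x}

/-- All cells of a sequence of labellings. -/
def labelGrid (Z : ℤ → X → ι) : Set (Set X) := {Q | ∃ k x, Q = labelCell Z k x}

variable {Z : ℤ → X → ι}

theorem mem_labelCell_self (k : ℤ) (x : X) : x ∈ labelCell Z k x := rfl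

theorem labelCell_mem_labelGrid (k : ℤ) (x : X) : labelCell Z k x ∈ labelGrid Z := ⟨k, x, rfl⟩

theorem labelCell_eq_of_mem {k : ℤ} {x y : X} (h : y ∈ labelCell Z k x) :
    labelCell Z k x = labelCell Z k y := by
  have h' : Z k y = Z k x := h
  simp only [labelCell, h']

theorem labelCell_mono (hZ : ∀ k x y, Z k x = Z k y → Z (k + 1) x = Z (k + 1) y) {j k : ℤ}
    (hjk : j ≤ k) (x : X) : labelCell Z j x ⊆ labelCell Z k x := by
  intro y hy
  induction k, hjk using Int.leInduction with
  | base => exact hy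
  | succ k _ ih => exact hZ k _ _ ih

variable [MeasurableSpace X] {μ : Measure X} {D : ℝ≥0}

theorem isGrid_labelGrid [Countable ι]
    (hZ : ∀ k x y, Z k x = Z k y → Z (k + 1) x = Z (k + 1) y) (hD : 1 ≤ D)
    (hm : ∀ k x, MeasurableSet (labelCell Z k x)) (h0 : ∀ k x, μ (labelCell Z k x) ≠ 0)
    (ht : ∀ k x, μ (labelCell Z k x) ≠ ∞)
    (hdoub : ∀ k x, μ (labelCell Z (k + 1) x) ≤ D * μ (labelCell Z k x))
    (hae : ∀ w : X → ℝ≥0∞, Measurable w → (∃ C : ℝ≥0, ∀ x, w x ≤ C) → ∀ᵐ x ∂μ, ∀ c k₀,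
      (∀ k ≤ k₀, avgOn μ w (labelCell Z k x) ≤ c) → w x ≤ c) :
    IsGrid μ D (labelGrid Z) where
  one_le := hD
  countable := by
    refine (countable_range fun a : ℤ × ι => {y | Z a.1 y = a.2}).mono ?_
    rintro Q ⟨k, x, rfl⟩
    exact ⟨(k, Z k x), rfl⟩
  measurableSet := by rintro Q ⟨k, x, rfl⟩; exact hm k x
  measure_ne_zero := by rintro Q ⟨k, x, rfl⟩; exact h0 k x
  measure_ne_top := by rintro Q ⟨k, x, rfl⟩; exact ht k x
  nested := by
    rintro Q ⟨j, x, rfl⟩ R ⟨k, y, rfl⟩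
    by_cases hd : Disjoint (labelCell Z j x) (labelCell Z k y)
    · exact Or.inr (Or.inr hd)
    · obtain ⟨z, hz1, hz2⟩ := not_disjoint_iff.1 hd
      rw [labelCell_eq_of_mem hz1, labelCell_eq_of_mem hz2]
      rcases le_total j k with h | h
      · exact Or.inl (labelCell_mono hZ h z)
      · exact Or.inr (Or.inl (labelCell_mono hZ h z))
  exists_maximal := by
    rintro R ⟨k₀, z, rfl⟩ T hT hRT P₀ hP₀ hPR
    obtain ⟨j, y, rfl⟩ := hT hP₀
    have hR := labelCell_eq_of_mem (hPR (mem_labelCell_self j y))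
    rw [hR] at hRT hPR ⊢
    have hjk : j < k₀ := by
      by_contra! h
      exact hRT ((hPR.antisymm (labelCell_mono hZ h y)) ▸ hP₀)
    obtain ⟨m, ⟨hjm, hmk, hmT⟩, hmax⟩ := Int.exists_greatest_of_bdd
      (P := fun m => j ≤ m ∧ m < k₀ ∧ labelCell Z m y ∈ T) ⟨k₀, fun m hm => hm.2.1.le⟩
      ⟨j, le_rfl, hjk, hP₀⟩
    have hgt : ∀ i, m < i → i ≤ k₀ → labelCell Z i y ∉ T := by
      intro i hi hik hiT
      rcases hik.lt_or_eq with h | rfl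
      · exact absurd (hmax i ⟨by omega, h, hiT⟩) (by omega)
      · exact hRT hiT
    refine ⟨_, hmT, labelCell_mono hZ hjm y, labelCell_mono hZ hmk.le y,
      ⟨_, labelCell_mem_labelGrid (m + 1) y, labelCell_mono hZ (by omega) y,
        labelCell_mono hZ (by omega) y, hgt _ (by omega) (by omega), hdoub m y⟩, ?_⟩
    rintro _ ⟨i, x, rfl⟩ hss hsub
    have hP' := labelCell_eq_of_mem (hss.1 (mem_labelCell_self m y))
    rw [hP'] at hss hsub ⊢
    have hmi : m < i := by
      by_contra! h
      exact hss.2 (labelCell_mono hZ h y)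
    rcases le_total i k₀ with h | h
    · exact hgt i hmi h
    · rw [hsub.antisymm (labelCell_mono hZ h y)]
      exact hRT
  ae_le := by
    rintro w hw hwC R ⟨k₀, z, rfl⟩
    filter_upwards [hae w hw hwC] with x hx hxR c hc
    refine hx c k₀ fun k hk => hc _ ⟨k, x, rfl⟩ rfl ?_
    rw [labelCell_eq_of_mem hxR]
    exact labelCell_mono hZ hk x

end Refining

end

section

variable {n : ℕ}

theorem setOf_forall_eq_preimage_pi (s : Fin n → Set ℝ) :
    {y : En n | ∀ i, y i ∈ s i} = WithLp.ofLp ⁻¹' (univ.pi s) := by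
  ext y; simp

theorem measurableSet_setOf_forall {s : Fin n → Set ℝ} (hs : ∀ i, MeasurableSet (s i)) :
    MeasurableSet {y : En n | ∀ i, y i ∈ s i} := by
  rw [setOf_forall_eq_preimage_pi]
  exact (PiLp.volume_preserving_ofLp (Fin n)).measurable (MeasurableSet.univ_pi hs)

theorem volume_setOf_forall {s : Fin n → Set ℝ} (hs : ∀ i, MeasurableSet (s i)) :
    volume {y : En n | ∀ i, y i ∈ s i} = ∏ i, volume (s i) := by
  rw [setOf_forall_eq_preimage_pi, (PiLp.volume_preserving_ofLp (Fin n)).measure_preimage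
    (MeasurableSet.univ_pi hs).nullMeasurableSet, volume_pi_pi]

theorem cube_eq_setOf_Icc (a : En n) (l : ℝ) : cube a l = {y | ∀ i, y i ∈ Icc (a i) (a i + l)} :=
  rfl

theorem measurableSet_cube (a : En n) (l : ℝ) : MeasurableSet (cube a l) :=
  measurableSet_setOf_forall fun _ => measurableSet_Icc

theorem volume_cube (a : En n) (l : ℝ) : volume (cube a l) = ENNReal.ofReal l ^ n := by
  rw [cube_eq_setOf_Icc, volume_setOf_forall fun _ => measurableSet_Icc]
  simp

/-- The generation-`k` dyadic shift of the grid with pattern `σ`. -/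
def dyadicShift (σ : Fin n → Fin 2) (k : ℤ) (i : Fin n) : ℝ := (σ i : ℕ) * (-1) ^ k / 3

/-- The integer vector indexing the generation-`k` shifted dyadic cube containing `x`. -/
def dyadicLabel (σ : Fin n → Fin 2) (k : ℤ) (x : En n) : Fin n → ℤ :=
  fun i => ⌊x i / 2 ^ k - dyadicShift σ k i⌋

/-- The lower corner of the generation-`k` shifted dyadic cube containing `x`. -/
def dyadicCorner (σ : Fin n → Fin 2) (k : ℤ) (x : En n) : En n :=
  WithLp.toLp 2 fun i => 2 ^ k * (dyadicLabel σ k x i + dyadicShift σ k i)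

theorem dyadicLabel_succ (σ : Fin n → Fin 2) (k : ℤ) (x y : En n)
    (h : dyadicLabel σ k x = dyadicLabel σ k y) :
    dyadicLabel σ (k + 1) x = dyadicLabel σ (k + 1) y := by
  ext i
  have key : ∀ z : En n, dyadicLabel σ (k + 1) z i =
      (dyadicLabel σ k z i + (σ i : ℕ) * k.negOnePow) / 2 := by
    intro z
    have h2 : (2 : ℝ) ^ k ≠ 0 := by positivity
    have e : z i / 2 ^ (k + 1) - dyadicShift σ (k + 1) i =
        ((z i / 2 ^ k - dyadicShift σ k i) + ((σ i : ℕ) * k.negOnePow : ℤ)) / (2 : ℕ) := by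
      unfold dyadicShift
      push_cast
      rw [Int.cast_negOnePow, zpow_add₀ (by norm_num), zpow_add₀ (by norm_num)]
      field_simp
      ring
    unfold dyadicLabel
    rw [e, Int.floor_div_natCast, Int.floor_add_intCast]
    rfl
  rw [key, key, h]

theorem labelCell_dyadicLabel (σ : Fin n → Fin 2) (k : ℤ) (x : En n) :
    labelCell (dyadicLabel σ) k x = {y | ∀ i, y i ∈
      Ico (dyadicCorner σ k x i) (dyadicCorner σ k x i + 2 ^ k)} := by
  ext y
  have h2 : (0 : ℝ) < 2 ^ k := by positivity
  simp only [labelCell, mem_ofPred_eq, funext_iff]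
  refine forall_congr' fun i => ?_
  conv_lhs => lhs; unfold dyadicLabel
  rw [Int.floor_eq_iff]
  simp only [dyadicCorner, mem_Ico]
  refine and_congr ?_ ?_
  · rw [le_sub_iff_add_le, le_div_iff₀ h2, mul_comm]
  · rw [sub_lt_iff_lt_add, div_lt_iff₀ h2]
    constructor <;> intro h <;> nlinarith

theorem volume_labelCell (σ : Fin n → Fin 2) (k : ℤ) (x : En n) :
    volume (labelCell (dyadicLabel σ) k x) = ENNReal.ofReal (2 ^ k) ^ n := by
  rw [labelCell_dyadicLabel, volume_setOf_forall fun _ => measurableSet_Ico]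
  simp

theorem labelCell_subset_cube (σ : Fin n → Fin 2) (k : ℤ) (x : En n) :
    labelCell (dyadicLabel σ) k x ⊆ cube (dyadicCorner σ k x) (2 ^ k) := by
  rw [labelCell_dyadicLabel]
  exact fun y hy i => ⟨(hy i).1, (hy i).2.le⟩

theorem measurableSet_labelCell (σ : Fin n → Fin 2) (k : ℤ) (x : En n) :
    MeasurableSet (labelCell (dyadicLabel σ) k x) := by
  rw [labelCell_dyadicLabel]
  exact measurableSet_setOf_forall fun _ => measurableSet_Ico

theorem abs_sub_le_of_mem_cube {a : En n} {l : ℝ} {x y : En n} (hx : x ∈ cube a l)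
    (hy : y ∈ cube a l) (i : Fin n) : |x i - y i| ≤ l := by
  rw [abs_le]
  constructor <;> linarith [(hx i).1, (hx i).2, (hy i).1, (hy i).2]

theorem dist_le_of_forall_abs {x y : En n} {l : ℝ} (hl : 0 ≤ l) (h : ∀ i, |x i - y i| ≤ l) :
    dist x y ≤ (n + 1) * l := by
  rw [EuclideanSpace.dist_eq]
  refine Real.sqrt_le_iff.2 ⟨by positivity, ?_⟩
  calc ∑ i, dist (x i) (y i) ^ 2 ≤ ∑ i : Fin n, l ^ 2 := by
        gcongr with i; exact h i
    _ = n * l ^ 2 := by simp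
    _ ≤ ((n + 1) * l) ^ 2 := by
        rw [mul_pow]
        gcongr
        nlinarith [(Nat.cast_nonneg n : (0 : ℝ) ≤ n)]

theorem closedBall_subset_cube (x : En n) (r : ℝ) :
    Metric.closedBall x r ⊆ cube (WithLp.toLp 2 fun i => x i - r) (2 * r) := by
  intro y hy i
  have h1 : |y i - x i| ≤ r := by
    have := PiLp.norm_apply_le (y - x) i
    rw [Metric.mem_closedBall, dist_eq_norm] at hy
    exact this.trans hy
  rw [abs_le] at h1
  constructor <;> simp only <;> linarith

end

section

variable {n : ℕ}

theorem labelCell_subset_closedBall (σ : Fin n → Fin 2) (k : ℤ) (x : En n) :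
    labelCell (dyadicLabel σ) k x ⊆ Metric.closedBall x ((n + 1) * 2 ^ k) := by
  intro y hy
  exact dist_le_of_forall_abs (by positivity) (abs_sub_le_of_mem_cube
    (labelCell_subset_cube σ k x hy) (labelCell_subset_cube σ k x (mem_labelCell_self k x)))

theorem volume_closedBall_le (σ : Fin n → Fin 2) (k : ℤ) (x : En n) :
    volume (Metric.closedBall x ((n + 1) * 2 ^ k)) ≤
      ENNReal.ofReal (2 * (n + 1)) ^ n * volume (labelCell (dyadicLabel σ) k x) := by
  refine (measure_mono (closedBall_subset_cube x _)).trans ?_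
  rw [volume_cube, volume_labelCell, ← mul_pow, ← ENNReal.ofReal_mul (by positivity), mul_assoc]

theorem volume_labelCell_ne_zero (σ : Fin n → Fin 2) (k : ℤ) (x : En n) :
    volume (labelCell (dyadicLabel σ) k x) ≠ 0 := by
  rw [volume_labelCell]
  exact pow_ne_zero _ (ENNReal.ofReal_pos.2 (by positivity)).ne'

theorem volume_labelCell_ne_top (σ : Fin n → Fin 2) (k : ℤ) (x : En n) :
    volume (labelCell (dyadicLabel σ) k x) ≠ ∞ := by
  rw [volume_labelCell]
  exact ENNReal.pow_ne_top ENNReal.ofReal_ne_top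

theorem volume_labelCell_succ (σ : Fin n → Fin 2) (k : ℤ) (x : En n) :
    volume (labelCell (dyadicLabel σ) (k + 1) x) =
      2 ^ n * volume (labelCell (dyadicLabel σ) k x) := by
  rw [volume_labelCell, volume_labelCell, ← mul_pow, zpow_add_one₀ two_ne_zero, mul_comm,
    ENNReal.ofReal_mul two_pos.le]
  simp

theorem tendsto_two_zpow_sub (k : ℤ) {c : ℝ} (hc : 0 < c) :
    Tendsto (fun j : ℕ => c * (2 : ℝ) ^ (k - j)) atTop (𝓝[>] 0) := by
  refine tendsto_nhdsWithin_iff.2 ⟨?_, Eventually.of_forall fun j => by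
    simp only [mem_Ioi]; positivity⟩
  have := (tendsto_pow_atTop_nhds_zero_of_lt_one (r := (1 / 2 : ℝ)) (by norm_num)
    (by norm_num)).const_mul (c * 2 ^ k)
  rw [mul_zero] at this
  refine this.congr fun j => ?_
  rw [zpow_sub₀ two_ne_zero, zpow_natCast, one_div, inv_pow, mul_assoc, div_eq_mul_inv]

theorem ae_le_of_avgOn_labelCell_le (σ : Fin n → Fin 2) {w : En n → ℝ≥0∞} (hw : Measurable w)
    (hwC : ∃ C : ℝ≥0, ∀ x, w x ≤ C) : ∀ᵐ x, ∀ c k₀,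
      (∀ k ≤ k₀, avgOn volume w (labelCell (dyadicLabel σ) k x) ≤ c) → w x ≤ c := by
  obtain ⟨C, hC⟩ := hwC
  have hfin : ∀ x, w x ≠ ∞ := fun x => ne_top_of_le_ne_top ENNReal.coe_ne_top (hC x)
  have hf : LocallyIntegrable (fun x => (w x).toReal) (volume : Measure (En n)) := by
    have hb : MemLp (fun x => (w x).toReal) ∞ (volume : Measure (En n)) := by
      refine memLp_top_of_bound hw.ennreal_toReal.aestronglyMeasurable C (ae_of_all _ fun x => ?_)
      rw [Real.norm_of_nonneg ENNReal.toReal_nonneg]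
      exact ENNReal.toReal_le_coe_of_le_coe (hC x)
    exact hb.locallyIntegrable le_top
  filter_upwards [VitaliFamily.ae_tendsto_lintegral_enorm_sub_div
    (IsUnifLocDoublingMeasure.vitaliFamily volume 1) hf] with x hx c k₀ hc
  have hball := IsUnifLocDoublingMeasure.tendsto_closedBall_filterAt (volume : Measure (En n))
    (K := 1) (x := x) (fun _ : ℕ => x) _
    (tendsto_two_zpow_sub k₀ (by positivity : (0 : ℝ) < n + 1))
    (Eventually.of_forall fun j => Metric.mem_closedBall_self (by positivity))
  set K : ℝ≥0∞ := ENNReal.ofReal (2 * (n + 1)) ^ n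
  have hK0 : K ≠ 0 := pow_ne_zero _ (ENNReal.ofReal_pos.2 (by positivity)).ne'
  have hKt : K ≠ ∞ := ENNReal.pow_ne_top ENNReal.ofReal_ne_top
  have hlim := (ENNReal.Tendsto.const_mul (hx.comp hball) (Or.inr hKt)).const_add c
  rw [mul_zero, add_zero] at hlim
  refine ge_of_tendsto hlim (Eventually.of_forall fun j => ?_)
  have hk : k₀ - (j : ℤ) ≤ k₀ := by omega
  simp only [Function.comp_apply]
  generalize k₀ - (j : ℤ) = k at hk ⊢
  set Q := labelCell (dyadicLabel σ) k x
  set B := Metric.closedBall x (((n : ℝ) + 1) * 2 ^ k)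
  have hQ0 : volume Q ≠ 0 := volume_labelCell_ne_zero σ k x
  have hQt : volume Q ≠ ∞ := volume_labelCell_ne_top σ k x
  have hpt : ∀ y, w x ≤ w y + ‖(w y).toReal - (w x).toReal‖ₑ := by
    intro y
    rw [Real.enorm_eq_ofReal_abs]
    nth_rewrite 1 [← ENNReal.ofReal_toReal (hfin x)]
    nth_rewrite 1 [← ENNReal.ofReal_toReal (hfin y)]
    rw [← ENNReal.ofReal_add ENNReal.toReal_nonneg (abs_nonneg _)]
    exact ENNReal.ofReal_le_ofReal (by linarith [neg_abs_le ((w y).toReal - (w x).toReal)])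
  have h1 : volume Q * w x ≤ volume Q * c + ∫⁻ y in B, ‖(w y).toReal - (w x).toReal‖ₑ := by
    calc volume Q * w x = ∫⁻ y in Q, w x := by simp [mul_comm]
      _ ≤ ∫⁻ y in Q, (w y + ‖(w y).toReal - (w x).toReal‖ₑ) := lintegral_mono fun y => hpt y
      _ = (∫⁻ y in Q, w y) + ∫⁻ y in Q, ‖(w y).toReal - (w x).toReal‖ₑ := lintegral_add_left hw _
      _ ≤ volume Q * c + ∫⁻ y in B, ‖(w y).toReal - (w x).toReal‖ₑ := by
        rw [← measure_mul_avgOn hQ0 hQt]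
        exact add_le_add (mul_le_mul_right (hc k hk) _)
          (lintegral_mono_set (labelCell_subset_closedBall σ k x))
  have hBt : volume B ≠ ∞ := measure_closedBall_lt_top.ne
  have hB0 : volume B ≠ 0 :=
    (lt_of_lt_of_le (pos_iff_ne_zero.2 hQ0)
      (measure_mono (labelCell_subset_closedBall σ k x))).ne'
  rw [← ENNReal.mul_le_mul_iff_right hQ0 hQt, mul_add]
  refine h1.trans (add_le_add_right ?_ _)
  rw [← mul_assoc, mul_comm (volume Q)]
  calc (∫⁻ y in B, ‖(w y).toReal - (w x).toReal‖ₑ)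
      = volume B * ((∫⁻ y in B, ‖(w y).toReal - (w x).toReal‖ₑ) / volume B) :=
        (ENNReal.mul_div_cancel hB0 hBt).symm
    _ ≤ _ := mul_le_mul_left (volume_closedBall_le σ k x) _

theorem isGrid_dyadic (σ : Fin n → Fin 2) :
    IsGrid (volume : Measure (En n)) (2 ^ n) (labelGrid (dyadicLabel σ)) :=
  isGrid_labelGrid (fun k x y => dyadicLabel_succ σ k x y) (one_le_pow₀ one_le_two)
    (measurableSet_labelCell σ) (volume_labelCell_ne_zero σ) (volume_labelCell_ne_top σ)
    (fun k x => by rw [volume_labelCell_succ]; simp)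
    fun _ hw hwC => ae_le_of_avgOn_labelCell_le σ hw hwC

end

section

variable {n : ℕ}

theorem exists_floor_sub_eq {s : ℝ} (hs : s = 1 / 3 ∨ s = -(1 / 3)) (u : ℝ) {δ : ℝ}
    (hδ0 : 0 ≤ δ) (hδ : δ < 1 / 3) : ∃ e : Fin 2, ⌊u + δ - (e : ℕ) * s⌋ = ⌊u - (e : ℕ) * s⌋ := by
  by_contra! h
  have key : ∀ r : ℝ, ⌊u + δ - r⌋ ≠ ⌊u - r⌋ → ∃ m : ℤ, u < m + r ∧ (m : ℝ) + r ≤ u + δ := by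
    intro r hr
    refine ⟨⌊u + δ - r⌋, ?_, by linarith [Int.floor_le (u + δ - r)]⟩
    have hlt : ⌊u - r⌋ < ⌊u + δ - r⌋ :=
      lt_of_le_of_ne (Int.floor_le_floor (by linarith)) hr.symm
    linarith [Int.floor_lt.1 hlt]
  obtain ⟨m, hm1, hm2⟩ := key _ (h 0)
  obtain ⟨m', hm1', hm2'⟩ := key _ (h 1)
  simp only [Fin.val_zero, Nat.cast_zero, zero_mul, add_zero, Fin.val_one, Nat.cast_one,
    one_mul] at hm1 hm2 hm1' hm2'
  rcases hs with rfl | rfl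
  · have h1 : (0 : ℝ) < (m - m' : ℤ) := by push_cast; linarith
    have h2 : ((m - m' : ℤ) : ℝ) < 1 := by push_cast; linarith
    norm_cast at h1 h2
    omega
  · have h1 : (-1 : ℝ) < (m - m' : ℤ) := by push_cast; linarith
    have h2 : ((m - m' : ℤ) : ℝ) < 0 := by push_cast; linarith
    have h1' : (-1 : ℤ) < m - m' := by exact_mod_cast h1
    norm_cast at h2
    omega

theorem exists_cube_subset_labelCell (a : En n) {l : ℝ} (hl : 0 < l) {k : ℤ}
    (hk : 3 * l < 2 ^ k) : ∃ σ, cube a l ⊆ labelCell (dyadicLabel σ) k a := by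
  have h2 : (0 : ℝ) < 2 ^ k := by positivity
  have hs : (-1 : ℝ) ^ k / 3 = 1 / 3 ∨ (-1 : ℝ) ^ k / 3 = -(1 / 3) := by
    rcases Int.even_or_odd k with h | h
    · left; rw [h.neg_one_zpow]
    · right; rw [h.neg_one_zpow]; norm_num
  have hδ : l / 2 ^ k < 1 / 3 := by rw [div_lt_iff₀ h2]; linarith
  choose σ hσ using fun i : Fin n => exists_floor_sub_eq hs (a i / 2 ^ k) (by positivity) hδ
  refine ⟨σ, fun y hy => ?_⟩
  ext i
  have h := hσ i
  rw [← mul_div_assoc, ← add_div] at h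
  simp only [dyadicLabel, dyadicShift]
  refine le_antisymm ?_ (Int.floor_le_floor ?_)
  · rw [← h]
    refine Int.floor_le_floor ?_
    gcongr
    exact (hy i).2
  · gcongr
    exact (hy i).1

theorem exists_cubeAvg_le (g : En n → ℝ≥0∞) (a : En n) {l : ℝ} (hl : 0 < l) :
    ∃ σ k, cube a l ⊆ labelCell (dyadicLabel σ) k a ∧
      cubeAvg g a l ≤ 6 ^ n * avgOn volume g (labelCell (dyadicLabel σ) k a) := by
  obtain ⟨m, hm1, hm2⟩ := exists_mem_Ico_zpow (by positivity : 0 < 3 * l) (one_lt_two : (1 : ℝ) < 2)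
  obtain ⟨σ, hσ⟩ := exists_cube_subset_labelCell a hl hm2
  refine ⟨σ, m + 1, hσ, ?_⟩
  have hc0 : volume (cube a l) ≠ 0 := by
    rw [volume_cube]; exact pow_ne_zero _ (ENNReal.ofReal_pos.2 hl).ne'
  have hct : volume (cube a l) ≠ ∞ := by
    rw [volume_cube]; exact ENNReal.pow_ne_top ENNReal.ofReal_ne_top
  have hvol : volume (labelCell (dyadicLabel σ) (m + 1) a) ≤ 6 ^ n * volume (cube a l) := by
    rw [volume_labelCell, volume_cube, ← mul_pow]
    gcongr
    rw [show (6 : ℝ≥0∞) = ENNReal.ofReal 6 by simp, ← ENNReal.ofReal_mul (by norm_num)]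
    refine ENNReal.ofReal_le_ofReal ?_
    rw [zpow_add_one₀ two_ne_zero]
    linarith
  rw [cubeAvg, ENNReal.inv_mul_le_iff hc0 hct]
  calc ∫⁻ y in cube a l, g y ≤ ∫⁻ y in labelCell (dyadicLabel σ) (m + 1) a, g y :=
        lintegral_mono_set hσ
    _ = volume (labelCell (dyadicLabel σ) (m + 1) a) *
        avgOn volume g (labelCell (dyadicLabel σ) (m + 1) a) :=
        (measure_mul_avgOn (volume_labelCell_ne_zero _ _ _) (volume_labelCell_ne_top _ _ _) g).symm
    _ ≤ _ := by
        rw [← mul_assoc, mul_comm (volume (cube a l))]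
        gcongr

theorem exists_maximal_le (g : En n → ℝ≥0∞) (x : En n) :
    ∃ σ, maximal g x ≤ 6 ^ n * gridMax volume (labelGrid (dyadicLabel σ)) g x := by
  obtain ⟨σ, -, hσ⟩ := Finset.exists_mem_eq_sup (Finset.univ : Finset (Fin n → Fin 2))
    Finset.univ_nonempty fun σ => gridMax volume (labelGrid (dyadicLabel σ)) g x
  refine ⟨σ, iSup₂_le fun a l => iSup₂_le fun hl hx => ?_⟩
  obtain ⟨τ, k, hsub, hle⟩ := exists_cubeAvg_le g a hl
  rw [← hσ]
  refine hle.trans (mul_le_mul_right ?_ _)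
  exact (avgOn_le_gridMax (labelCell_mem_labelGrid k a) (hsub hx) g).trans
    (Finset.le_sup (f := fun σ => gridMax volume (labelGrid (dyadicLabel σ)) g x)
      (Finset.mem_univ τ))

theorem gridMax_le_maximal (σ : Fin n → Fin 2) (g : En n → ℝ≥0∞) (x : En n) :
    gridMax volume (labelGrid (dyadicLabel σ)) g x ≤ maximal g x := by
  refine iSup_le fun Q => iSup₂_le ?_
  rintro ⟨k, z, rfl⟩ hx
  refine le_trans ?_ (le_iSup₂_of_le (dyadicCorner σ k z) (2 ^ k)
    (le_iSup₂_of_le (by positivity) (labelCell_subset_cube σ k z hx) le_rfl))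
  rw [avgOn, cubeAvg, volume_cube, volume_labelCell]
  gcongr
  exact labelCell_subset_cube σ k z

theorem maximal_congr {g h : En n → ℝ≥0∞}
    (H : ∀ s, MeasurableSet s → ∫⁻ y in s, g y = ∫⁻ y in s, h y) : maximal g = maximal h := by
  ext x
  simp only [maximal, cubeAvg, H _ (measurableSet_cube _ _)]

theorem maximal_const_mul (g : En n → ℝ≥0∞) {c : ℝ≥0∞} (hc : c ≠ ∞) (x : En n) :
    maximal (fun y => c * g y) x = c * maximal g x := by
  simp only [maximal, cubeAvg, lintegral_const_mul' _ _ hc, ENNReal.mul_iSup]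
  simp only [mul_left_comm]

end

section

variable {n : ℕ} {p q : En n → ℝ}

theorem vNorm_congr {α : Type*} [MeasureSpace α] {p q : α → ℝ}
    (h : p =ᵐ[volume] q) (g : α → ℝ≥0∞) : vNorm p g = vNorm q g := by
  have : ∀ lam : ℝ≥0∞, ∫⁻ x, (g x / lam) ^ p x = ∫⁻ x, (g x / lam) ^ q x := fun lam =>
    lintegral_congr_ae (h.mono fun x hx => by simp only [hx])
  simp only [vNorm, this]

theorem gridBounded_of_vNorm_le {P : ℝ} (hp0 : ∀ x, 0 ≤ p x) (hP : ∀ x, p x ≤ P) {C : ℝ≥0}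
    (H : ∀ f : En n → ℂ, vNorm p (maximal fun x => (‖f x‖₊ : ℝ≥0∞)) ≤ C * vNormC p f)
    (hpos : ∀ x, 0 < p x) (hpm : Measurable p) (σ : Fin n → Fin 2) :
    GridBounded volume (labelGrid (dyadicLabel σ)) p ((C + 1) ^ P) := by
  intro g hg hg1
  have hfin : ∀ᵐ x, g x ≠ ∞ := by
    filter_upwards [ae_lt_top (hg.pow hpm) (hg1.trans_lt ENNReal.one_lt_top).ne] with x hx hgx
    rw [hgx, ENNReal.top_rpow_of_pos (hpos x)] at hx
    exact hx.ne rfl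
  have hgf : (fun x => (‖((g x).toReal : ℂ)‖₊ : ℝ≥0∞)) =ᵐ[volume] g := by
    filter_upwards [hfin] with x hx
    rw [← enorm_eq_nnnorm, ← ofReal_norm, Complex.norm_real,
      Real.norm_of_nonneg ENNReal.toReal_nonneg, ENNReal.ofReal_toReal hx]
  have hM : maximal (fun x => (‖((g x).toReal : ℂ)‖₊ : ℝ≥0∞)) = maximal g :=
    maximal_congr fun s _ => lintegral_congr_ae (ae_restrict_of_ae hgf)
  have hN : vNormC p (fun x => ((g x).toReal : ℂ)) ≤ 1 := by
    refine sInf_le ⟨one_pos, le_trans (le_of_eq ?_) hg1⟩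
    exact lintegral_congr_ae (hgf.mono fun x hx => by simp only [hx, div_one])
  have hlt : vNorm p (maximal g) < (C + 1 : ℝ≥0) := by
    have := H fun x => ((g x).toReal : ℂ)
    rw [hM] at this
    calc vNorm p (maximal g) ≤ C * 1 := this.trans (mul_le_mul_right hN _)
      _ < (C + 1 : ℝ≥0) := by rw [mul_one]; exact_mod_cast lt_add_one C
  obtain ⟨lam, ⟨hlam0, hlam1⟩, hlamC⟩ := sInf_lt_iff.1 hlt
  have hC1 : (1 : ℝ≥0∞) ≤ (C + 1 : ℝ≥0) := by exact_mod_cast le_add_self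
  have hC0 : ((C + 1 : ℝ≥0) : ℝ≥0∞) ≠ 0 := (zero_lt_one.trans_le hC1).ne'
  calc ∫⁻ x, gridMax volume (labelGrid (dyadicLabel σ)) g x ^ p x
      ≤ ∫⁻ x, ((C + 1 : ℝ≥0) * (maximal g x / lam)) ^ p x := by
        refine lintegral_mono fun x => ENNReal.rpow_le_rpow ?_ (hp0 x)
        refine (gridMax_le_maximal σ g x).trans ?_
        calc maximal g x = (C + 1 : ℝ≥0) * (maximal g x / (C + 1 : ℝ≥0)) :=
              (ENNReal.mul_div_cancel hC0 ENNReal.coe_ne_top).symm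
          _ ≤ _ := by gcongr
    _ ≤ (C + 1 : ℝ≥0) ^ P * ∫⁻ x, (maximal g x / lam) ^ p x :=
        modular_const_mul_le hp0 hP _ hC1 ENNReal.coe_ne_top
    _ ≤ (C + 1 : ℝ≥0) ^ P * 1 := by gcongr
    _ = ((C + 1) ^ P : ℝ≥0) := by
        rw [mul_one, ENNReal.coe_rpow_of_ne_zero (by positivity)]

theorem lintegral_maximal_le {Q : ℝ} (hq0 : ∀ x, 0 ≤ q x) (hqm : Measurable q)
    (hQ : ∀ x, q x ≤ Q) (hQ0 : 0 ≤ Q) {C : (Fin n → Fin 2) → ℝ≥0}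
    (H : ∀ σ, GridBounded volume (labelGrid (dyadicLabel σ)) q (C σ)) {g : En n → ℝ≥0∞}
    (hg : Measurable g) (hg1 : ∫⁻ x, g x ^ q x ≤ 1) :
    ∫⁻ x, maximal g x ^ q x ≤ ((6 ^ n) ^ Q * ∑ σ, C σ : ℝ≥0) := by
  have h6 : (1 : ℝ≥0∞) ≤ 6 ^ n := one_le_pow₀ (by norm_num)
  have h6t : (6 : ℝ≥0∞) ^ n ≠ ∞ := ENNReal.pow_ne_top (by simp)
  have hmeas : ∀ σ : Fin n → Fin 2,
      Measurable fun x => gridMax volume (labelGrid (dyadicLabel σ)) g x ^ q x := fun σ =>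
    (measurable_gridMax (isGrid_dyadic σ).countable (isGrid_dyadic σ).measurableSet g).pow hqm
  calc ∫⁻ x, maximal g x ^ q x
      ≤ ∫⁻ x, (6 ^ n) ^ Q * ∑ σ, gridMax volume (labelGrid (dyadicLabel σ)) g x ^ q x := by
        refine lintegral_mono fun x => ?_
        obtain ⟨σ, hσ⟩ := exists_maximal_le g x
        refine (ENNReal.rpow_le_rpow hσ (hq0 x)).trans ?_
        rw [ENNReal.mul_rpow_of_nonneg _ _ (hq0 x)]
        exact mul_le_mul' (ENNReal.rpow_le_rpow_of_exponent_le h6 (hQ x))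
          (Finset.single_le_sum (f := fun σ =>
            gridMax volume (labelGrid (dyadicLabel σ)) g x ^ q x) (fun _ _ => zero_le)
            (Finset.mem_univ σ))
    _ = (6 ^ n) ^ Q * ∑ σ, ∫⁻ x, gridMax volume (labelGrid (dyadicLabel σ)) g x ^ q x := by
        rw [lintegral_const_mul' _ _ (ENNReal.rpow_ne_top_of_nonneg hQ0 h6t),
          lintegral_finsetSum _ fun σ _ => hmeas σ]
    _ ≤ (6 ^ n) ^ Q * ∑ σ, (C σ : ℝ≥0∞) := by
        gcongr with σ
        exact H σ g hg hg1
    _ = _ := by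
        push_cast
        rw [ENNReal.coe_rpow_of_nonneg _ hQ0]
        simp

theorem vNorm_maximal_le (hq1 : ∀ x, 1 ≤ q x) {C : ℝ≥0}
    (H : ∀ g : En n → ℝ≥0∞, Measurable g → ∫⁻ x, g x ^ q x ≤ 1 → ∫⁻ x, maximal g x ^ q x ≤ C)
    (h : En n → ℝ≥0∞) : vNorm q (maximal h) ≤ (C + 1 : ℝ≥0) * vNorm q h := by
  have hq0 : ∀ x, 0 ≤ q x := fun x => zero_le_one.trans (hq1 x)
  have hC1 : (1 : ℝ≥0∞) ≤ (C + 1 : ℝ≥0) := by exact_mod_cast le_add_self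
  have hC0 : ((C + 1 : ℝ≥0) : ℝ≥0∞) ≠ 0 := (zero_lt_one.trans_le hC1).ne'
  have hCt : ((C + 1 : ℝ≥0) : ℝ≥0∞) ≠ ∞ := ENNReal.coe_ne_top
  rw [mul_comm, ← ENNReal.div_le_iff hC0 hCt]
  refine le_sInf ?_
  rintro lam ⟨hlam0, hlam1⟩
  rw [ENNReal.div_le_iff hC0 hCt]
  rcases eq_or_ne lam ∞ with rfl | hlamt
  · rw [ENNReal.top_mul hC0]; exact le_top
  refine sInf_le ⟨pos_iff_ne_zero.2 (mul_ne_zero hlam0.ne' hC0), ?_⟩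
  obtain ⟨g, hgm, hgh, hgint⟩ := exists_measurable_le_forall_setLIntegral_eq (volume) h
  have hMh : maximal h = maximal g := maximal_congr fun s _ => hgint s
  have hMg : ∀ x, maximal h x / (lam * (C + 1 : ℝ≥0)) =
      ((C + 1 : ℝ≥0) : ℝ≥0∞)⁻¹ * maximal (fun y => lam⁻¹ * g y) x := by
    intro x
    rw [maximal_const_mul _ (ENNReal.inv_ne_top.2 hlam0.ne'), hMh, div_eq_mul_inv,
      ENNReal.mul_inv (Or.inl hlam0.ne') (Or.inl hlamt)]
    ring
  simp only [hMg]
  refine (modular_const_mul_le_of_le_one hq1 _ (ENNReal.inv_le_one.2 hC1)).trans ?_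
  rw [ENNReal.inv_mul_le_iff hC0 hCt, mul_one]
  refine (H _ (hgm.const_mul _) (le_trans (lintegral_mono fun x => ?_) hlam1)).trans
    (by exact_mod_cast le_self_add)
  refine ENNReal.rpow_le_rpow ?_ (hq0 x)
  rw [mul_comm, div_eq_mul_inv]
  exact mul_le_mul_left (hgh x) _

theorem exists_bounded_exponents (hp : Measurable p) (hlow : ∃ c : ℝ, 1 < c ∧ ∀ᵐ x, c ≤ p x)
    (hup : ∃ C : ℝ, ∀ᵐ x, p x ≤ C) (hconj : ∀ᵐ x, 1 / p x + 1 / q x = 1) :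
    ∃ p₁ q₁ : En n → ℝ, p =ᵐ[volume] p₁ ∧ q =ᵐ[volume] q₁ ∧ Measurable p₁ ∧ Measurable q₁ ∧
      (∀ x, (p₁ x).HolderConjugate (q₁ x)) ∧ ∃ c P c' P' : ℝ, 1 < c ∧ 1 < c' ∧
      ∀ x, c ≤ p₁ x ∧ p₁ x ≤ P ∧ c' ≤ q₁ x ∧ q₁ x ≤ P' := by
  obtain ⟨c, hc, hcp⟩ := hlow
  obtain ⟨C, hC⟩ := hup
  set P := max c C
  have hcP : c ≤ P := le_max_left _ _
  set p₁ : En n → ℝ := fun x => max c (min (p x) P) with hp₁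
  have h1 : ∀ x, c ≤ p₁ x := fun x => le_max_left _ _
  have h2 : ∀ x, p₁ x ≤ P := fun x => max_le hcP (min_le_right _ _)
  have hm : Measurable p₁ := measurable_const.max (hp.min measurable_const)
  have he : p =ᵐ[volume] p₁ := by
    filter_upwards [hcp, hC] with x hx1 hx2
    simp only [hp₁]
    rw [min_eq_left (hx2.trans (le_max_right _ _)), max_eq_right hx1]
  refine ⟨p₁, fun x => 1 + 1 / (p₁ x - 1), he, ?_, hm, by fun_prop, ?_, c, P, 1 + 1 / (P - 1),
    1 + 1 / (c - 1), hc, ?_, fun x => ⟨h1 x, h2 x, ?_, ?_⟩⟩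
  · filter_upwards [he, hconj, hcp] with x hx hx2 hx3
    have hp1 : 1 < p x := hc.trans_le hx3
    rw [← hx]
    have hq0 : q x ≠ 0 := by
      intro h0
      rw [h0, div_zero, add_zero, div_eq_one_iff_eq (by linarith)] at hx2
      linarith
    have : p x - 1 ≠ 0 := by linarith
    have : p x ≠ 0 := by linarith
    field_simp at hx2 ⊢
    linarith
  · intro x
    have := h1 x
    have h3 : p₁ x - 1 ≠ 0 := by linarith
    rw [Real.holderConjugate_iff]
    refine ⟨by linarith, ?_⟩
    have : p₁ x ≠ 0 := by linarith
    have h4 : 1 + 1 / (p₁ x - 1) = p₁ x / (p₁ x - 1) := by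
      rw [eq_div_iff h3, add_mul, div_mul_cancel₀ _ h3]
      ring
    beta_reduce
    rw [h4, inv_div, inv_eq_one_div, ← add_div, add_sub_cancel, div_self this]
  · have : 0 < P - 1 := by linarith
    have : 0 < 1 / (P - 1) := by positivity
    linarith
  · have := one_div_le_one_div_of_le (by linarith [h1 x]) (sub_le_sub_right (h2 x) 1)
    simpa using this
  · have := one_div_le_one_div_of_le (by linarith) (sub_le_sub_right (h1 x) 1)
    simpa using this

theorem MemBM.conjugate (H : MemBM p) (hq : Measurable q)
    (hconj : ∀ᵐ x, 1 / p x + 1 / q x = 1) : MemBM q := by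
  obtain ⟨hp, hlow, hup, C, hC⟩ := H
  obtain ⟨p₁, q₁, hpp, hqq, hpm, hqm, hpq, c, P, c', P', hc, hc', hb⟩ :=
    exists_bounded_exponents hp hlow hup hconj
  have hpos : ∀ x, 0 < p₁ x := fun x => by linarith [(hb x).1]
  have hqpos : ∀ x, 0 < q₁ x := fun x => by linarith [(hb x).2.2.1]
  have hP1 : 1 ≤ P := by linarith [(hb 0).1, (hb 0).2.1]
  have hP0' : 0 ≤ P' := (hqpos 0).le.trans (hb 0).2.2.2
  have hC₁ : ∀ f : En n → ℂ,
      vNorm p₁ (maximal fun x => (‖f x‖₊ : ℝ≥0∞)) ≤ C * vNormC p₁ f := fun f => by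
    rw [vNormC, ← vNorm_congr hpp, ← vNorm_congr hpp]
    exact hC f
  choose K hK using fun σ : Fin n → Fin 2 =>
    (gridBounded_of_vNorm_le (fun x => (hpos x).le) (fun x => (hb x).2.1) hC₁ hpos hpm
      σ).exists_dual (isGrid_dyadic σ) hpm hqm hpq hc (fun x => (hb x).1) (fun x => (hb x).2.1) hP1
      fun x => (hb x).2.2.2
  refine ⟨hq, ⟨c', hc', hqq.mono fun x hx => hx ▸ (hb x).2.2.1⟩,
    ⟨P', hqq.mono fun x hx => hx ▸ (hb x).2.2.2⟩, (6 ^ n) ^ P' * ∑ σ, K σ + 1, fun f => ?_⟩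
  rw [vNormC, vNorm_congr hqq, vNorm_congr hqq]
  exact vNorm_maximal_le (fun x => hc'.le.trans (hb x).2.2.1) (fun g hg hg1 =>
    lintegral_maximal_le (fun x => (hqpos x).le) hqm (fun x => (hb x).2.2.2) hP0' hK hg hg1) _

end

/-- Diening. For a measurable exponent `p` with
`1 < ess inf p` and `ess sup p < ∞` and its pointwise conjugate `p'`, the
Hardy–Littlewood maximal operator is bounded on `L^{p(·)}(ℝⁿ)` if and only if
it is bounded on `L^{p'(·)}(ℝⁿ)`; that is, `p ∈ 𝓑_M(ℝⁿ) ↔ p' ∈ 𝓑_M(ℝⁿ)`. -/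
theorem diening_duality {n : ℕ} (p p' : En n → ℝ)
    (hp : Measurable p) (hp' : Measurable p')
    (hlow : ∃ c : ℝ, 1 < c ∧ ∀ᵐ x ∂volume, c ≤ p x)
    (hup : ∃ C : ℝ, ∀ᵐ x ∂volume, p x ≤ C)
    (hconj : ∀ᵐ x ∂volume, 1 / p x + 1 / p' x = 1) :
    MemBM p ↔ MemBM p' :=
  ⟨fun H => H.conjugate hp' hconj,
    fun H => H.conjugate hp (hconj.mono fun _ h => (add_comm _ _).trans h)⟩
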